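/- Let d ≥ 5 and let P be a prime centrally symmetric simplicial d-polytope with g_2(P) = C(d,2) − d and natural embedding p, and assume additionally that every d vertices of P, no two of which are antipodal, are affinely independent. Let G' be a subgraph of the graph of ∂P whose vertex and edge sets are closed under the involution v ↦ −v, such that (G', p) is infinitesimally rigid in ℝ^d and p(V(G')) affinely spans ℝ^d. Then G' equals the graph of ∂P (same vertices and same edges). -/

import Mathlib

open Finset
open scoped Classical

noncomputable section

/-- A finite graph: a finite vertex set together with a finite set of edges,
where each edge is (intended to be) a 2-element subset of the vertex set. -/
structure FinGraph (ι : Type) where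
  verts : Finset ι
  edges : Finset (Finset ι)

/-- Every edge is a 2-element subset of the vertex set. -/
def FinGraph.Good {ι : Type} (G : FinGraph ι) : Prop :=
  ∀ e ∈ G.edges, e ⊆ G.verts ∧ e.card = 2

/-- The standard inner (dot) product on `ℝ^d`. -/
def dotR {d : ℕ} (x y : Fin d → ℝ) : ℝ := ∑ i, x i * y i

/-- An infinitesimal motion of the framework `(G, p)`. -/
def IsMotion {ι : Type} {d : ℕ} (G : FinGraph ι) (p m : ι → Fin d → ℝ) : Prop :=
  ∀ e ∈ G.edges, ∀ u ∈ e, ∀ v ∈ e, dotR (p u - p v) (m u - m v) = 0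

/-- The framework `(G, p)` is infinitesimally rigid in `ℝ^d`: every infinitesimal
motion is the restriction of a motion `x ↦ A x + b` of `ℝ^d` with `A` skew-symmetric. -/
def IsInfRigid {ι : Type} (d : ℕ) (G : FinGraph ι) (p : ι → Fin d → ℝ) : Prop :=
  ∀ m : ι → Fin d → ℝ, IsMotion G p m →
    ∃ (A : Matrix (Fin d) (Fin d) ℝ) (b : Fin d → ℝ),
      A.transpose = -A ∧ ∀ v ∈ G.verts, m v = A.mulVec (p v) + b

/-- A stress on the framework `(G, p)`. -/
def IsStress {ι : Type} {d : ℕ} (G : FinGraph ι) (p : ι → Fin d → ℝ)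
    (ω : Finset ι → ℝ) : Prop :=
  ∀ v ∈ G.verts,
    (∑ e ∈ G.edges.filter (fun e => v ∈ e), ∑ u ∈ e.erase v, ω e • (p v - p u)) = 0

/-- A centrally symmetric framework with free involution `ν` satisfying `p (ν v) = -(p v)`. -/
def IsCSFramework {ι : Type} {d : ℕ} (G : FinGraph ι) (p : ι → Fin d → ℝ) (ν : ι → ι) : Prop :=
  (∀ v ∈ G.verts, ν (ν v) = v) ∧
  (∀ v ∈ G.verts, ν v ∈ G.verts) ∧
  (∀ v ∈ G.verts, ν v ≠ v) ∧
  (∀ e ∈ G.edges, e.image ν ∈ G.edges) ∧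
  (∀ e ∈ G.edges, e.image ν ≠ e) ∧
  (∀ v ∈ G.verts, p (ν v) = -(p v))

/-- The convex body spanned by a finite point set. -/
def polyBody {d : ℕ} (V : Finset (Fin d → ℝ)) : Set (Fin d → ℝ) :=
  convexHull ℝ (V : Set (Fin d → ℝ))

/-- `(f, c)` is a supporting functional for `conv V` exposing the face `F`. -/
def IsSupport {d : ℕ} (V : Finset (Fin d → ℝ)) (f : (Fin d → ℝ) →ₗ[ℝ] ℝ) (c : ℝ)
    (F : Set (Fin d → ℝ)) : Prop :=
  (∀ y ∈ polyBody V, f y ≤ c) ∧ F = {y ∈ polyBody V | f y = c}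

/-- A proper face of the polytope `conv V`. -/
def IsProperFace {d : ℕ} (V : Finset (Fin d → ℝ)) (F : Set (Fin d → ℝ)) : Prop :=
  (∃ f c, IsSupport V f c F) ∧ F ≠ polyBody V

/-- A simplicial `d`-polytope in `ℝ^d`, recorded by its vertex set `V`: the polytope is
`conv V`, it is `d`-dimensional, every element of `V` is a vertex, and every proper face
is a simplex (the convex hull of its affinely independent vertex set). -/
structure SPolytope (d : ℕ) where
  V : Finset (Fin d → ℝ)
  span_top : affineSpan ℝ (V : Set (Fin d → ℝ)) = ⊤
  extreme : ∀ v ∈ V, v ∉ convexHull ℝ ((V.erase v : Finset (Fin d → ℝ)) : Set (Fin d → ℝ))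
  simplicial : ∀ F : Set (Fin d → ℝ), IsProperFace V F →
    AffineIndependent ℝ
      (fun x : {y : Fin d → ℝ // y ∈ (V : Set (Fin d → ℝ)) ∩ F} => (x : Fin d → ℝ)) ∧
    F = convexHull ℝ ((V : Set (Fin d → ℝ)) ∩ F)

/-- `s` is a face of the boundary complex `∂P`. -/
def BFace {d : ℕ} (P : SPolytope d) (s : Finset (Fin d → ℝ)) : Prop :=
  s ⊆ P.V ∧ ∃ F : Set (Fin d → ℝ), IsProperFace P.V F ∧ (s : Set (Fin d → ℝ)) ⊆ F

/-- The number of vertices of `∂P`. -/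
def f0 {d : ℕ} (P : SPolytope d) : ℕ := P.V.card

/-- The edges of `∂P`. -/
def edgeFinset {d : ℕ} (P : SPolytope d) : Finset (Finset (Fin d → ℝ)) :=
  P.V.powerset.filter fun e => e.card = 2 ∧ BFace P e

/-- The number of edges of `∂P`. -/
def f1 {d : ℕ} (P : SPolytope d) : ℕ := (edgeFinset P).card

/-- `g₂(P) = f₁ - d f₀ + C(d+1, 2)`. -/
def g2 {d : ℕ} (P : SPolytope d) : ℤ :=
  (f1 P : ℤ) - (d : ℤ) * (f0 P : ℤ) + ((d + 1).choose 2 : ℤ)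

/-- `P` is centrally symmetric. -/
def IsCS {d : ℕ} (P : SPolytope d) : Prop := ∀ v ∈ P.V, -v ∈ P.V

/-- A missing face of `∂P`. -/
def IsMissingFace {d : ℕ} (P : SPolytope d) (σ : Finset (Fin d → ℝ)) : Prop :=
  σ ⊆ P.V ∧ ¬ BFace P σ ∧ ∀ τ ⊂ σ, BFace P τ

/-- `P` is prime: `∂P` has no missing facet, i.e. no missing face of cardinality `d`. -/
def IsPrimePoly {d : ℕ} (P : SPolytope d) : Prop :=
  ¬ ∃ σ : Finset (Fin d → ℝ), IsMissingFace P σ ∧ σ.card = d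

/-- The graph (1-skeleton) of `∂P` as a framework graph. -/
def fullGraph {d : ℕ} (P : SPolytope d) : FinGraph (Fin d → ℝ) :=
  ⟨P.V, edgeFinset P⟩

/-- The graph (1-skeleton) of the star of the face `τ` in `∂P`. -/
def starGraph {d : ℕ} (P : SPolytope d) (τ : Finset (Fin d → ℝ)) : FinGraph (Fin d → ℝ) :=
  ⟨P.V.filter fun v => BFace P (insert v τ),
   P.V.powerset.filter fun e => e.card = 2 ∧ BFace P (e ∪ τ)⟩

/-- Adjacency in the graph of `∂P`. -/
def Adj {d : ℕ} (P : SPolytope d) (u v : Fin d → ℝ) : Prop :=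
  u ≠ v ∧ BFace P {u, v}

/-- `σ` is a face of the link of the face `τ` in `∂P`. -/
def LinkFace {d : ℕ} (P : SPolytope d) (τ σ : Finset (Fin d → ℝ)) : Prop :=
  Disjoint σ τ ∧ BFace P (σ ∪ τ)

/-- `P` is a `d`-dimensional cross-polytope: its vertex set is `{±b₁, …, ±b_d}`
for some basis `b₁, …, b_d` of `ℝ^d`. -/
def IsCrossPolytope {d : ℕ} (P : SPolytope d) : Prop :=
  ∃ b : Fin d → (Fin d → ℝ), LinearIndependent ℝ b ∧
    (P.V : Set (Fin d → ℝ)) = Set.range b ∪ Set.range (fun i => -(b i))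

/-- A facet of `P`: a proper face with `d` vertices. -/
def IsFacet {d : ℕ} (P : SPolytope d) (F : Set (Fin d → ℝ)) : Prop :=
  IsProperFace P.V F ∧ ((P.V : Set (Fin d → ℝ)) ∩ F).ncard = d

/-- `x` lies beyond exactly one facet of `P`: it is strictly separated from `P` by the
affine hull of one facet `F`, and not separated from `P` by the affine hull of any
other facet. -/
def BeyondExactlyOne {d : ℕ} (P : SPolytope d) (x : Fin d → ℝ) : Prop :=
  ∃ F : Set (Fin d → ℝ), IsFacet P F ∧
    (∀ f c, IsSupport P.V f c F → c < f x) ∧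
    (∀ F' : Set (Fin d → ℝ), IsFacet P F' → F' ≠ F →
      ∀ f c, IsSupport P.V f c F' → f x < c)

/-- `P` is obtained from a `d`-dimensional cross-polytope by symmetric stacking: there is
a sequence of cs simplicial `d`-polytopes starting at a cross-polytope and ending at `P`,
each obtained from the previous one as `conv (P_k ∪ {v, -v})` for a point `v` lying
beyond exactly one facet of `P_k`. -/
def SymmetricStackingFrom {d : ℕ} (P : SPolytope d) : Prop :=
  ∃ (m : ℕ) (Q : Fin (m + 1) → SPolytope d),
    (∀ k, IsCS (Q k)) ∧
    IsCrossPolytope (Q 0) ∧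
    Q (Fin.last m) = P ∧
    ∀ k : Fin m, ∃ v : Fin d → ℝ,
      BeyondExactlyOne (Q (Fin.castSucc k)) v ∧
      polyBody (Q (Fin.succ k)).V =
        convexHull ℝ (polyBody (Q (Fin.castSucc k)).V ∪ {v, -v})

/-- `P` is a stacked `d`-polytope: obtained from a `d`-simplex by repeatedly adding a
point beyond exactly one facet. -/
def IsStacked {d : ℕ} (P : SPolytope d) : Prop :=
  ∃ (m : ℕ) (R : Fin (m + 1) → SPolytope d),
    (R 0).V.card = d + 1 ∧
    R (Fin.last m) = P ∧
    ∀ k : Fin m, ∃ v : Fin d → ℝ,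
      BeyondExactlyOne (R (Fin.castSucc k)) v ∧
      polyBody (R (Fin.succ k)).V =
        convexHull ℝ (polyBody (R (Fin.castSucc k)).V ∪ {v})

/-- Every `d` vertices of `P`, no two of which are antipodal, are affinely independent. -/
def GenPos {d : ℕ} (P : SPolytope d) : Prop :=
  ∀ S : Finset (Fin d → ℝ), S ⊆ P.V → S.card = d →
    (∀ x ∈ S, ∀ y ∈ S, x ≠ -y) →
    AffineIndependent ℝ (fun s : {x : Fin d → ℝ // x ∈ S} => (s : Fin d → ℝ))

/-- The graph of the cone `v₀ * S` over a simplicial complex `S` (a set of finsets):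
the vertices of `S` together with `v₀`, and the edges of `S` together with all edges
from `v₀` to vertices of `S`. -/
def coneGraph {d : ℕ} (P : SPolytope d) (v0 : Fin d → ℝ)
    (S : Set (Finset (Fin d → ℝ))) : FinGraph (Fin d → ℝ) :=
  ⟨insert v0 (P.V.filter fun u => ({u} : Finset (Fin d → ℝ)) ∈ S),
   (P.V.powerset.filter fun e => e.card = 2 ∧ e ∈ S) ∪
     (P.V.filter fun u => ({u} : Finset (Fin d → ℝ)) ∈ S).image
       fun u => ({v0, u} : Finset (Fin d → ℝ))⟩

/-! ### Linear algebra helpers -/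

/-- linear independence of a finite set of vectors -/
def LI {d : ℕ} (s : Finset (Fin d → ℝ)) : Prop :=
  ∀ c : (Fin d → ℝ) → ℝ, ∑ v ∈ s, c v • v = 0 → ∀ v ∈ s, c v = 0

theorem LI.mono {d : ℕ} {s t : Finset (Fin d → ℝ)} (h : LI t) (hst : s ⊆ t) : LI s := by
  intro c hc v hv
  have := h (fun v => if v ∈ s then c v else 0) (by
    rw [← hc, ← Finset.sum_subset hst]
    · exact Finset.sum_congr rfl (fun x hx => by simp [hx])
    · intro x _ hx; simp [hx]) v (hst hv)
  simpa [hv] using this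

theorem LI.linInd {d : ℕ} {s : Finset (Fin d → ℝ)} (h : LI s) :
    LinearIndepOn ℝ id (s : Set (Fin d → ℝ)) := by
  rw [linearIndepOn_finset_iff]
  intro c hc v hv
  exact h c (by simpa using hc) v hv

theorem LI.card_le {d : ℕ} {s : Finset (Fin d → ℝ)} (h : LI s) : s.card ≤ d := by
  have h1 := h.linInd
  have h2 := LinearIndependent.fintype_card_le_finrank h1
  simpa using h2

theorem dot_of_lin {d : ℕ} (f : (Fin d → ℝ) →ₗ[ℝ] ℝ) :
    ∃ a : Fin d → ℝ, ∀ x, a ⬝ᵥ x = f x := by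
  refine ⟨fun i => f (Pi.single i 1), fun x => ?_⟩
  conv_rhs => rw [LinearMap.pi_apply_eq_sum_univ f x]
  simp only [dotProduct, smul_eq_mul]
  refine Finset.sum_congr rfl fun i _ => ?_
  rw [mul_comm]
  congr 1
  congr 1
  ext j
  simp [Pi.single_apply, eq_comm]

theorem dot_lin {d : ℕ} (a : Fin d → ℝ) :
    ∃ f : (Fin d → ℝ) →ₗ[ℝ] ℝ, ∀ x, f x = a ⬝ᵥ x :=
  ⟨⟨⟨fun x => a ⬝ᵥ x, fun x y => dotProduct_add _ _ _⟩, fun c x => by simp [dotProduct_smul]⟩,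
    fun _ => rfl⟩

theorem LI.exists_map {d : ℕ} {W : Type} [AddCommGroup W] [Module ℝ W]
    {s : Finset (Fin d → ℝ)} (h : LI s) (φ : (Fin d → ℝ) → W) :
    ∃ f : (Fin d → ℝ) →ₗ[ℝ] W, ∀ v ∈ s, f v = φ v := by
  have h1 := h.linInd
  have h2 : LinearIndependent ℝ (fun x : (s : Set (Fin d → ℝ)) => id (x : Fin d → ℝ)) := h1
  let b := Module.Basis.extend h1
  refine ⟨b.constr ℝ (fun x => φ x), fun v hv => ?_⟩
  have hv' : v ∈ h1.extend (Set.subset_univ _) := by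
    have := h1.subset_extend (Set.subset_univ _)
    exact this (by simpa using hv)
  have h3 := b.constr_basis ℝ (fun x => φ x) ⟨v, hv'⟩
  have h4 : b ⟨v, hv'⟩ = v := Module.Basis.extend_apply_self h1 ⟨v, hv'⟩
  rw [h4] at h3
  exact h3

theorem LI.exists_dual {d : ℕ} {s : Finset (Fin d → ℝ)} (h : LI s)
    (φ : (Fin d → ℝ) → ℝ) : ∃ a : Fin d → ℝ, ∀ v ∈ s, a ⬝ᵥ v = φ v := by
  obtain ⟨f, hf⟩ := h.exists_map φ
  obtain ⟨a, ha⟩ := dot_of_lin f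
  exact ⟨a, fun v hv => by rw [ha, hf v hv]⟩

theorem rel_of_card {d : ℕ} {s : Finset (Fin d → ℝ)} (h : d < s.card) :
    ∃ c : (Fin d → ℝ) → ℝ, ∑ v ∈ s, c v • v = 0 ∧ ∃ v ∈ s, c v ≠ 0 := by
  have := Module.exists_nontrivial_relation_of_finrank_lt_card (R := ℝ) (t := s) (by simpa using h)
  simpa using this

theorem LI.insert_of {d : ℕ} {s : Finset (Fin d → ℝ)} (hs : LI s) {x : Fin d → ℝ}
    (h : ∀ c : (Fin d → ℝ) → ℝ, x ≠ ∑ v ∈ s, c v • v) : LI (insert x s) := by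
  have hx : x ∉ s := by
    intro hx
    refine h (fun v => if v = x then 1 else 0) ?_
    simp [ite_smul, hx]
  intro c hc
  rw [Finset.sum_insert hx] at hc
  have hcx : c x = 0 := by
    by_contra hne
    refine h (fun v => -(c x)⁻¹ * c v) ?_
    have : ∑ v ∈ s, (-(c x)⁻¹ * c v) • v = -(c x)⁻¹ • ∑ v ∈ s, c v • v := by
      rw [Finset.smul_sum]; simp [mul_smul]
    rw [this, eq_neg_of_add_eq_zero_right hc, smul_neg, smul_smul, neg_mul, inv_mul_cancel₀ hne]
    simp
  rw [hcx, zero_smul, zero_add] at hc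
  intro v hv
  rcases Finset.mem_insert.1 hv with rfl | hv
  · exact hcx
  · exact hs c hc v hv

theorem LI.spans {d : ℕ} {s : Finset (Fin d → ℝ)} (hs : LI s) (hc : s.card = d)
    (x : Fin d → ℝ) : ∃ c : (Fin d → ℝ) → ℝ, x = ∑ v ∈ s, c v • v := by
  by_contra hne
  push Not at hne
  have h := (hs.insert_of hne).card_le
  have hx : x ∉ s := by
    intro hx
    refine hne (fun v => if v = x then 1 else 0) ?_
    simp [ite_smul, hx]
  rw [Finset.card_insert_of_notMem hx] at h
  omega

theorem dot_sum_smul {d : ℕ} (a : Fin d → ℝ) (s : Finset (Fin d → ℝ)) (c : (Fin d → ℝ) → ℝ) :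
    a ⬝ᵥ (∑ v ∈ s, c v • v) = ∑ v ∈ s, c v * (a ⬝ᵥ v) := by
  simp [dotProduct_sum, dotProduct_smul]

theorem LI.eq_zero {d : ℕ} {s : Finset (Fin d → ℝ)} (hs : LI s) (hc : s.card = d)
    {h : Fin d → ℝ} (hh : ∀ v ∈ s, h ⬝ᵥ v = 0) : h = 0 := by
  obtain ⟨c, hx⟩ := hs.spans hc h
  have : h ⬝ᵥ h = 0 := by
    conv_lhs => rw [hx, ← hx]
    nth_rw 2 [hx]
    rw [dot_sum_smul]
    exact Finset.sum_eq_zero fun v hv => by rw [hh v hv, mul_zero]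
  exact dotProduct_self_eq_zero.1 this

theorem LI.dual_ext {d : ℕ} {s : Finset (Fin d → ℝ)} (hs : LI s) (hc : s.card = d)
    {a b : Fin d → ℝ} (hh : ∀ v ∈ s, a ⬝ᵥ v = b ⬝ᵥ v) : a = b := by
  have := hs.eq_zero hc (h := a - b) (fun v hv => by rw [sub_dotProduct, hh v hv, sub_self])
  exact sub_eq_zero.1 this

theorem exists_perp {d : ℕ} {s : Finset (Fin d → ℝ)} (h : s.card < d) :
    ∃ a : Fin d → ℝ, a ≠ 0 ∧ ∀ v ∈ s, a ⬝ᵥ v = 0 := by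
  let T : (Fin d → ℝ) →ₗ[ℝ] (s → ℝ) :=
    { toFun := fun a v => a ⬝ᵥ (v : Fin d → ℝ)
      map_add' := fun a b => by ext v; simp [add_dotProduct]
      map_smul' := fun a b => by ext v; simp [smul_dotProduct] }
  have hni : ¬ Function.Injective T := by
    intro hi
    have := LinearMap.finrank_le_finrank_of_injective hi
    simp at this
    omega
  have : ∃ a, T a = 0 ∧ a ≠ 0 := by
    by_contra hcon
    push Not at hcon
    exact hni ((injective_iff_map_eq_zero T).2 hcon)
  obtain ⟨a, ha, hne⟩ := this
  refine ⟨a, hne, fun v hv => ?_⟩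
  exact congrFun ha ⟨v, hv⟩

theorem gen_eps {ι : Type} (s : Finset ι) (a b : ι → ℝ) (h : ∀ i ∈ s, a i ≠ 0 ∨ b i ≠ 0)
    {δ : ℝ} (hδ : 0 < δ) : ∃ ε, 0 < ε ∧ ε < δ ∧ ∀ i ∈ s, a i + ε * b i ≠ 0 := by
  obtain ⟨ε, hε, hn⟩ := (Set.Ioo_infinite hδ).exists_notMem_finset (s.image fun i => - a i / b i)
  refine ⟨ε, hε.1, hε.2, fun i hi h0 => ?_⟩
  by_cases hb : b i = 0
  · rw [hb, mul_zero, add_zero] at h0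
    rcases h i hi with h1 | h1
    · exact h1 h0
    · exact h1 hb
  · apply hn
    rw [Finset.mem_image]
    refine ⟨i, hi, ?_⟩
    field_simp
    linarith

theorem gen_vec {d : ℕ} (s : Finset (Fin d → ℝ)) (h : ∀ v ∈ s, v ≠ 0) :
    ∃ q : Fin d → ℝ, ∀ v ∈ s, v ⬝ᵥ q ≠ 0 := by
  induction s using Finset.induction_on with
  | empty => exact ⟨0, by simp⟩
  | insert e s he ih =>
    obtain ⟨q, hq⟩ := ih fun v hv => h v (Finset.mem_insert_of_mem hv)
    obtain ⟨ε, _, _, hε⟩ := gen_eps (insert e s) (fun v => v ⬝ᵥ q) (fun v => v ⬝ᵥ e) (by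
      intro v hv
      rcases Finset.mem_insert.1 hv with rfl | hv
      · right
        intro h0
        exact h v (by simp) (dotProduct_self_eq_zero.1 h0)
      · left; exact hq v hv) one_pos
    refine ⟨q + ε • e, fun v hv => ?_⟩
    have := hε v hv
    simpa [dotProduct_add, dotProduct_smul] using this

/-! ### Abstract cs simplicial polytopes -/

structure CSP (d : ℕ) where
  V : Finset (Fin d → ℝ)
  neg : ∀ v ∈ V, -v ∈ V
  span : ∀ h : Fin d → ℝ, (∀ v ∈ V, h ⬝ᵥ v = 0) → h = 0
  simp : ∀ a : Fin d → ℝ, (∀ v ∈ V, a ⬝ᵥ v ≤ 1) → LI (V.filter fun v => a ⬝ᵥ v = 1)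
  vert : ∀ v ∈ V, ∃ a : Fin d → ℝ, (∀ v ∈ V, a ⬝ᵥ v ≤ 1) ∧ a ⬝ᵥ v = 1

namespace CSP
variable {d : ℕ} (K : CSP d)

def Pol (a : Fin d → ℝ) : Prop := ∀ v ∈ K.V, a ⬝ᵥ v ≤ 1
def Fc (s : Finset (Fin d → ℝ)) : Prop :=
  s ⊆ K.V ∧ ∃ a, K.Pol a ∧ ∀ v ∈ s, a ⬝ᵥ v = 1
def tight (a : Fin d → ℝ) : Finset (Fin d → ℝ) := K.V.filter fun v => a ⬝ᵥ v = 1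
def Facet (F : Finset (Fin d → ℝ)) : Prop := K.Fc F ∧ F.card = d

variable {K}

theorem mem_tight {a v : Fin d → ℝ} : v ∈ K.tight a ↔ v ∈ K.V ∧ a ⬝ᵥ v = 1 := by
  simp [tight]

theorem Pol.fc_tight {a : Fin d → ℝ} (h : K.Pol a) : K.Fc (K.tight a) :=
  ⟨Finset.filter_subset _ _, a, h, fun _ hv => (mem_tight.1 hv).2⟩

theorem Fc.mono {s t : Finset (Fin d → ℝ)} (h : K.Fc t) (hst : s ⊆ t) : K.Fc s := by
  obtain ⟨h1, a, h2, h3⟩ := h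
  exact ⟨hst.trans h1, a, h2, fun v hv => h3 v (hst hv)⟩

theorem Fc.li {s : Finset (Fin d → ℝ)} (h : K.Fc s) : LI s := by
  obtain ⟨h1, a, h2, h3⟩ := h
  exact (K.simp a h2).mono fun v hv => by simp [h1 hv, h3 v hv]

theorem Fc.card_le {s : Finset (Fin d → ℝ)} (h : K.Fc s) : s.card ≤ d := h.li.card_le

theorem Fc.neg {s : Finset (Fin d → ℝ)} (h : K.Fc s) : K.Fc (s.image fun x => -x) := by
  obtain ⟨h1, a, h2, h3⟩ := h
  refine ⟨?_, -a, ?_, ?_⟩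
  · intro v hv
    obtain ⟨w, hw, rfl⟩ := Finset.mem_image.1 hv
    exact K.neg w (h1 hw)
  · intro v hv
    have := h2 (-v) (K.neg v hv)
    simpa using this
  · intro v hv
    obtain ⟨w, hw, rfl⟩ := Finset.mem_image.1 hv
    simpa using h3 w hw

theorem Fc.not_neg {s : Finset (Fin d → ℝ)} (h : K.Fc s) {v : Fin d → ℝ} (hv : v ∈ s) :
    -v ∉ s := by
  obtain ⟨h1, a, h2, h3⟩ := h
  intro hn
  have e1 := h3 v hv
  have e2 := h3 (-v) hn
  simp only [dotProduct_neg] at e2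
  linarith

theorem fc_single {v : Fin d → ℝ} (hv : v ∈ K.V) : K.Fc {v} := by
  obtain ⟨a, h1, h2⟩ := K.vert v hv
  exact ⟨by simpa using hv, a, h1, by simpa using h2⟩

theorem fc_empty : K.Fc ∅ := ⟨by simp, 0, fun v _ => by simp, by simp⟩

theorem zero_notMem : (0 : Fin d → ℝ) ∉ K.V := by
  intro h
  obtain ⟨a, _, h2⟩ := K.vert 0 h
  simp at h2

theorem ne_neg {v : Fin d → ℝ} (hv : v ∈ K.V) : v ≠ -v := by
  intro h
  have := (fc_single hv).not_neg (v := v) (by simp)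
  exact this (by simpa using h.symm)

theorem ray {a h : Fin d → ℝ} (ha : K.Pol a) (hh : ∃ v ∈ K.V, 0 < h ⬝ᵥ v) :
    ∃ t : ℝ, 0 ≤ t ∧ K.Pol (a + t • h) ∧ ∃ u ∈ K.V, 0 < h ⬝ᵥ u ∧ (a + t • h) ⬝ᵥ u = 1 := by
  let S := K.V.filter fun v => 0 < h ⬝ᵥ v
  have hS : S.Nonempty := by
    obtain ⟨v, hv, h1⟩ := hh
    exact ⟨v, by simp [S, hv, h1]⟩
  obtain ⟨u, hu, hmin⟩ := S.exists_min_image (fun v => (1 - a ⬝ᵥ v) / (h ⬝ᵥ v)) hS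
  have hu' : u ∈ K.V ∧ 0 < h ⬝ᵥ u := by simpa [S] using hu
  refine ⟨(1 - a ⬝ᵥ u) / (h ⬝ᵥ u), ?_, ?_, u, hu'.1, hu'.2, ?_⟩
  · exact div_nonneg (by linarith [ha u hu'.1]) hu'.2.le
  · intro v hv
    have ht : 0 ≤ (1 - a ⬝ᵥ u) / (h ⬝ᵥ u) := div_nonneg (by linarith [ha u hu'.1]) hu'.2.le
    simp only [add_dotProduct, smul_dotProduct, smul_eq_mul]
    by_cases hp : 0 < h ⬝ᵥ v
    · have := hmin v (by simp [S, hv, hp])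
      rw [le_div_iff₀ hp] at this
      linarith
    · have h1 := ha v hv
      have h2 : (1 - a ⬝ᵥ u) / (h ⬝ᵥ u) * (h ⬝ᵥ v) ≤ 0 :=
        mul_nonpos_of_nonneg_of_nonpos ht (not_lt.1 hp)
      linarith
  · simp only [add_dotProduct, smul_dotProduct, smul_eq_mul]
    have := hu'.2.ne'
    field_simp
    ring

theorem Fc.exists_facet {s : Finset (Fin d → ℝ)} (hs : K.Fc s) :
    ∃ F, K.Facet F ∧ s ⊆ F := by
  let C := (K.V.powerset).filter fun F => K.Fc F ∧ s ⊆ F ∧ ∃ a, K.Pol a ∧ F = K.tight a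
  have hC : C.Nonempty := by
    obtain ⟨h1, a, h2, h3⟩ := hs
    refine ⟨K.tight a, ?_⟩
    simp only [C, Finset.mem_filter, Finset.mem_powerset]
    refine ⟨Finset.filter_subset _ _, h2.fc_tight, fun v hv => mem_tight.2 ⟨h1 hv, h3 v hv⟩,
      a, h2, rfl⟩
  obtain ⟨F, hF, hmax⟩ := C.exists_max_image Finset.card hC
  simp only [C, Finset.mem_filter, Finset.mem_powerset] at hF
  obtain ⟨_, h1, h2, a, h3, h4⟩ := hF
  refine ⟨F, ⟨h1, ?_⟩, h2⟩
  by_contra hne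
  have hlt : F.card < d := lt_of_le_of_ne h1.card_le hne
  obtain ⟨h, hne0, hh⟩ := exists_perp hlt
  have hv : ∃ v ∈ K.V, 0 < h ⬝ᵥ v := by
    by_contra hcon
    push Not at hcon
    apply hne0
    apply K.span
    intro v hv
    have e1 := hcon v hv
    have e2 := hcon (-v) (K.neg v hv)
    rw [dotProduct_neg] at e2
    linarith
  obtain ⟨t, _, hpol, u, hu, hu1, hu2⟩ := ray h3 hv
  have huF : u ∉ F := fun hu => by rw [hh u hu] at hu1; exact lt_irrefl _ hu1
  have hsub : insert u F ⊆ K.tight (a + t • h) := by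
    intro v hv
    rcases Finset.mem_insert.1 hv with rfl | hv
    · exact mem_tight.2 ⟨hu, hu2⟩
    · rw [mem_tight]
      refine ⟨h1.1 hv, ?_⟩
      have : a ⬝ᵥ v = 1 := by rw [h4] at hv; exact (mem_tight.1 hv).2
      simp [add_dotProduct, smul_dotProduct, hh v hv, this]
  have := hmax (K.tight (a + t • h)) (by
    simp only [C, Finset.mem_filter, Finset.mem_powerset]
    exact ⟨Finset.filter_subset _ _, hpol.fc_tight,
      h2.trans ((Finset.subset_insert _ _).trans hsub), _, hpol, rfl⟩)
  have h5 := Finset.card_le_card hsub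
  rw [Finset.card_insert_of_notMem huF] at h5
  omega

end CSP

/-- functional with prescribed values on a set -/
def dual {d : ℕ} (F : Finset (Fin d → ℝ)) (φ : (Fin d → ℝ) → ℝ) : Fin d → ℝ :=
  if h : ∃ a : Fin d → ℝ, ∀ v ∈ F, a ⬝ᵥ v = φ v then h.choose else 0

theorem LI.dual_spec {d : ℕ} {F : Finset (Fin d → ℝ)} (h : LI F) (φ : (Fin d → ℝ) → ℝ) :
    ∀ v ∈ F, dual F φ ⬝ᵥ v = φ v := by
  have := h.exists_dual φ
  unfold dual
  rw [dif_pos this]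
  exact this.choose_spec

def nf {d : ℕ} (F : Finset (Fin d → ℝ)) : Fin d → ℝ := dual F fun _ => 1
def ev {d : ℕ} (F : Finset (Fin d → ℝ)) (z : Fin d → ℝ) : Fin d → ℝ :=
  dual F fun v => if v = z then 1 else 0

theorem LI.ev_apply {d : ℕ} {F : Finset (Fin d → ℝ)} (h : LI F) {z v : Fin d → ℝ} (hv : v ∈ F) :
    ev F z ⬝ᵥ v = if v = z then 1 else 0 := h.dual_spec _ v hv

theorem LI.ev_self {d : ℕ} {F : Finset (Fin d → ℝ)} (h : LI F) {z : Fin d → ℝ} (hv : z ∈ F) :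
    ev F z ⬝ᵥ z = 1 := by rw [h.ev_apply hv]; simp

theorem LI.ev_ne {d : ℕ} {F : Finset (Fin d → ℝ)} (h : LI F) {z v : Fin d → ℝ} (hv : v ∈ F)
    (hne : v ≠ z) : ev F z ⬝ᵥ v = 0 := by rw [h.ev_apply hv]; simp [hne]

theorem LI.expand {d : ℕ} {F : Finset (Fin d → ℝ)} (h : LI F) (hc : F.card = d)
    (x : Fin d → ℝ) : x = ∑ v ∈ F, (ev F v ⬝ᵥ x) • v := by
  obtain ⟨c, hx⟩ := h.spans hc x
  conv_lhs => rw [hx]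
  refine Finset.sum_congr rfl fun v hv => ?_
  congr 1
  rw [hx, dot_sum_smul, Finset.sum_eq_single v]
  · rw [h.ev_self hv, mul_one]
  · intro b hb hne
    rw [h.ev_ne hb hne, mul_zero]
  · intro h; exact absurd hv h

namespace CSP
variable {d : ℕ} {K : CSP d}

theorem Facet.li {F : Finset (Fin d → ℝ)} (h : K.Facet F) : LI F := h.1.li
theorem Facet.sub {F : Finset (Fin d → ℝ)} (h : K.Facet F) : F ⊆ K.V := h.1.1

theorem Facet.nf_one {F : Finset (Fin d → ℝ)} (h : K.Facet F) {v : Fin d → ℝ} (hv : v ∈ F) :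
    nf F ⬝ᵥ v = 1 := h.li.dual_spec _ v hv

theorem Facet.pol {F : Finset (Fin d → ℝ)} (h : K.Facet F) : K.Pol (nf F) := by
  obtain ⟨a, h1, h2⟩ := h.1.2
  rw [h.li.dual_ext h.2 (a := nf F) (b := a) fun v hv => by rw [h.nf_one hv, h2 v hv]]
  exact h1

theorem Facet.tight_eq {F : Finset (Fin d → ℝ)} (h : K.Facet F) : K.tight (nf F) = F := by
  symm
  apply Finset.eq_of_subset_of_card_le
  · intro v hv
    exact mem_tight.2 ⟨h.sub hv, h.nf_one hv⟩
  · rw [h.2]; exact h.pol.fc_tight.card_le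

theorem Facet.nf_lt {F : Finset (Fin d → ℝ)} (h : K.Facet F) {v : Fin d → ℝ} (hv : v ∈ K.V)
    (hn : v ∉ F) : nf F ⬝ᵥ v < 1 := by
  refine lt_of_le_of_ne (h.pol v hv) fun he => hn ?_
  rw [← h.tight_eq]
  exact mem_tight.2 ⟨hv, he⟩

theorem Facet.eq_of_nf {F G : Finset (Fin d → ℝ)} (hF : K.Facet F) (hG : K.Facet G)
    (h : nf F = nf G) : F = G := by
  rw [← hF.tight_eq, ← hG.tight_eq, h]

theorem Facet.eq_of_sub {F s : Finset (Fin d → ℝ)} (hF : K.Facet F) (hs : K.Fc s)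
    (h : F ⊆ s) : F = s :=
  Finset.eq_of_subset_of_card_le h (by rw [hF.2]; exact hs.card_le)

/-- facet containing a ridge: difference of normals -/
theorem Facet.nf_flip {F G : Finset (Fin d → ℝ)} (hF : K.Facet F) {z : Fin d → ℝ}
    (hz : z ∈ F) (hG : K.Facet G) (hsub : F.erase z ⊆ G) :
    nf G = nf F - (1 - nf G ⬝ᵥ z) • ev F z := by
  apply hF.li.dual_ext hF.2
  intro v hv
  simp only [sub_dotProduct, smul_dotProduct, smul_eq_mul, hF.nf_one hv]
  by_cases h : v = z
  · subst h
    rw [hF.li.ev_self hv]; ring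
  · rw [hF.li.ev_ne hv h, hG.nf_one (hsub (Finset.mem_erase.2 ⟨h, hv⟩))]; ring

theorem Facet.flip_uniq {F G H : Finset (Fin d → ℝ)} (hF : K.Facet F) {z : Fin d → ℝ}
    (hz : z ∈ F) (hG : K.Facet G) (hGs : F.erase z ⊆ G) (hH : K.Facet H) (hHs : F.erase z ⊆ H)
    (hGF : G ≠ F) (hHF : H ≠ F) : G = H := by
  have key : ∀ G H : Finset (Fin d → ℝ), K.Facet G → F.erase z ⊆ G → K.Facet H →
      F.erase z ⊆ H → G ≠ F → H ≠ F → ¬ nf G ⬝ᵥ z < nf H ⬝ᵥ z := by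
    intro G H hG hGs hH hHs hGF hHF hlt
    have e1 := hF.nf_flip hz hG hGs
    have e2 := hF.nf_flip hz hH hHs
    obtain ⟨w, hwH, hwF⟩ : ∃ w ∈ H, w ∉ F := by
      by_contra hcon
      push Not at hcon
      exact hHF (hH.eq_of_sub hF.1 hcon)
    have hw := hH.nf_one hwH
    have hz' : z ∉ H := by
      intro hzH
      apply hHF
      symm
      apply hF.eq_of_sub hH.1
      intro x hx
      by_cases h : x = z
      · rw [h]; exact hzH
      · exact hHs (Finset.mem_erase.2 ⟨h, hx⟩)
    have h1 := hF.nf_lt (hH.sub hwH) hwF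
    have h2 := hH.nf_lt (hF.sub hz) hz'
    have h3 := hG.pol w (hH.sub hwH)
    rw [e2] at hw
    rw [e1] at h3
    simp only [sub_dotProduct, smul_dotProduct, smul_eq_mul] at hw h3
    generalize nf G ⬝ᵥ z = g at *
    generalize nf H ⬝ᵥ z = h at *
    generalize nf F ⬝ᵥ w = f at *
    generalize ev F z ⬝ᵥ w = k at *
    have hk : k < 0 := by
      by_contra hk
      have : 0 ≤ (1 - h) * k := mul_nonneg (by linarith) (not_lt.1 hk)
      linarith
    nlinarith
  have h1 := key G H hG hGs hH hHs hGF hHF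
  have h2 := key H G hH hHs hG hGs hHF hGF
  have h3 : nf G ⬝ᵥ z = nf H ⬝ᵥ z := le_antisymm (not_lt.1 h2) (not_lt.1 h1)
  apply hG.eq_of_nf hH
  rw [hF.nf_flip hz hG hGs, hF.nf_flip hz hH hHs, h3]

theorem Facet.exists_flip {F : Finset (Fin d → ℝ)} (hF : K.Facet F) {z : Fin d → ℝ}
    (hz : z ∈ F) : ∃ u ∈ K.V, u ∉ F ∧ K.Facet (insert u (F.erase z)) := by
  obtain ⟨t, ht, hpol, u, hu, hu1, hu2⟩ := ray hF.pol (h := - ev F z)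
    ⟨-z, K.neg z (hF.sub hz), by simp [hF.li.ev_self hz]⟩
  have huF : u ∉ F := by
    intro h
    rw [neg_dotProduct, hF.li.ev_apply h] at hu1
    split_ifs at hu1 <;> linarith
  refine ⟨u, hu, huF, ?_, ?_⟩
  · apply hpol.fc_tight.mono
    intro v hv
    rw [mem_tight]
    rcases Finset.mem_insert.1 hv with rfl | hv
    · exact ⟨hu, hu2⟩
    · have hvF := (Finset.mem_erase.1 hv)
      refine ⟨hF.sub hvF.2, ?_⟩
      simp [add_dotProduct, hF.nf_one hvF.2, hF.li.ev_ne hvF.2 hvF.1]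
  · rw [Finset.card_insert_of_notMem (fun h => huF (Finset.mem_of_mem_erase h)),
      Finset.card_erase_of_mem hz]
    have := hF.2
    have : 0 < F.card := Finset.card_pos.2 ⟨z, hz⟩
    omega

/-- coordinate of the opposite vertex is negative -/
theorem Facet.ev_flip_neg {F : Finset (Fin d → ℝ)} (hF : K.Facet F) {z u : Fin d → ℝ}
    (hz : z ∈ F) (hu : u ∉ F) (hG : K.Facet (insert u (F.erase z))) : ev F z ⬝ᵥ u < 0 := by
  have huV : u ∈ K.V := hG.sub (by simp)
  have h1 := hF.nf_lt huV hu
  have hzG : z ∉ insert u (F.erase z) := by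
    intro h
    rcases Finset.mem_insert.1 h with h | h
    · exact hu (h ▸ hz)
    · exact (Finset.mem_erase.1 h).1 rfl
  have h2 := hG.nf_lt (hF.sub hz) hzG
  have h3 := hG.nf_one (v := u) (by simp)
  have h4 := congrArg (fun x => x ⬝ᵥ u) (hF.nf_flip hz hG (Finset.subset_insert _ _))
  simp only [sub_dotProduct, smul_dotProduct, smul_eq_mul, h3] at h4
  by_contra hk
  have := mul_nonneg (sub_nonneg.2 h2.le) (not_lt.1 hk)
  linarith

theorem fan {I J : Finset (Fin d → ℝ)} (hI : K.Fc I) (hJ : K.Fc J) {c e : (Fin d → ℝ) → ℝ}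
    (hc : ∀ v ∈ I, 0 < c v) (he : ∀ v ∈ J, 0 < e v)
    (h : ∑ v ∈ I, c v • v = ∑ v ∈ J, e v • v) : I = J := by
  have key : ∀ I J : Finset (Fin d → ℝ), K.Fc I → K.Fc J → ∀ c e : (Fin d → ℝ) → ℝ,
      (∀ v ∈ J, 0 < e v) → ∑ v ∈ I, c v • v = ∑ v ∈ J, e v • v →
      ∑ v ∈ I, c v ≤ ∑ v ∈ J, e v := by
    intro I J hI hJ c e he h
    obtain ⟨_, a, h2, h3⟩ := hI
    have h4 := congrArg (fun x => a ⬝ᵥ x) h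
    simp only [dot_sum_smul] at h4
    rw [Finset.sum_congr rfl (fun v hv => by rw [h3 v hv, mul_one])] at h4
    rw [h4]
    apply Finset.sum_le_sum
    intro v hv
    have := mul_le_mul_of_nonneg_left (h2 v (hJ.1 hv)) (he v hv).le
    linarith
  have hle := key I J hI hJ c e he h
  have hge := key J I hJ hI e c hc h.symm
  have hsum : ∑ v ∈ I, c v = ∑ v ∈ J, e v := le_antisymm hle hge
  obtain ⟨hIV, a, h2, h3⟩ := hI
  have h4 := congrArg (fun x => a ⬝ᵥ x) h
  simp only [dot_sum_smul] at h4
  rw [Finset.sum_congr rfl (fun v hv => by rw [h3 v hv, mul_one]), hsum] at h4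
  have h5 : ∀ v ∈ J, a ⬝ᵥ v = 1 := by
    have h6 : ∑ v ∈ J, e v * (1 - a ⬝ᵥ v) = 0 := by
      simp only [mul_sub, mul_one, Finset.sum_sub_distrib]
      linarith
    rw [Finset.sum_eq_zero_iff_of_nonneg] at h6
    · intro v hv
      have := h6 v hv
      rcases mul_eq_zero.1 this with h7 | h7
      · exact absurd h7 (he v hv).ne'
      · linarith
    · intro v hv
      exact mul_nonneg (he v hv).le (by linarith [h2 v (hJ.1 hv)])
  have hli := K.simp a h2
  set T := K.V.filter fun v => a ⬝ᵥ v = 1 with hT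
  have hIT : I ⊆ T := fun v hv => by simp [hT, hIV hv, h3 v hv]
  have hJT : J ⊆ T := fun v hv => by simp [hT, hJ.1 hv, h5 v hv]
  have h8 := hli (fun v => (if v ∈ I then c v else 0) - (if v ∈ J then e v else 0)) (by
    simp only [sub_smul, Finset.sum_sub_distrib, ite_smul, zero_smul]
    rw [← Finset.sum_filter, ← Finset.sum_filter, Finset.filter_mem_eq_inter,
      Finset.filter_mem_eq_inter, Finset.inter_eq_right.2 hIT, Finset.inter_eq_right.2 hJT, h,
      sub_self])
  ext v
  constructor
  · intro hv
    by_contra hn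
    have := h8 v (hIT hv)
    simp [hv, hn] at this
    exact (hc v hv).ne' this
  · intro hv
    by_contra hn
    have := h8 v (hJT hv)
    simp [hv, hn] at this
    exact (he v hv).ne' this

end CSP

theorem small_delta {ι : Type} (s : Finset ι) (k r : ι → ℝ) (hr : ∀ i ∈ s, 0 < r i) :
    ∃ δ : ℝ, 0 < δ ∧ ∀ i ∈ s, ∀ ε, 0 < ε → ε < δ → ε * k i < r i := by
  induction s using Finset.induction_on with
  | empty => exact ⟨1, one_pos, by simp⟩
  | insert e s he ih =>
    obtain ⟨δ, hδ, h⟩ := ih fun v hv => hr v (Finset.mem_insert_of_mem hv)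
    have hre := hr e (by simp)
    refine ⟨min δ (r e / (|k e| + 1)), lt_min hδ (by positivity), ?_⟩
    intro i hi ε h0 h1
    rcases Finset.mem_insert.1 hi with rfl | hi
    · have h2 : ε < r i / (|k i| + 1) := lt_of_lt_of_le h1 (min_le_right _ _)
      rw [lt_div_iff₀ (by positivity)] at h2
      have h3 : ε * k i ≤ ε * |k i| := mul_le_mul_of_nonneg_left (le_abs_self _) h0.le
      nlinarith
    · exact h i hi ε h0 (lt_of_lt_of_le h1 (min_le_left _ _))

namespace CSP
variable {d : ℕ} {K : CSP d}

theorem Facet.flip_back {F : Finset (Fin d → ℝ)} {z u : Fin d → ℝ} (hz : z ∈ F) (hu : u ∉ F) :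
    insert z ((insert u (F.erase z)).erase u) = F := by
  rw [Finset.erase_insert (fun h => hu (Finset.mem_of_mem_erase h)), Finset.insert_erase hz]

theorem connect {τ : Finset (Fin d → ℝ)} (x : Fin d → ℝ) (Pd : Finset (Fin d → ℝ) → Prop)
    (step : ∀ F z u, K.Facet F → τ ⊆ F → x ∉ F → z ∈ F → z ∉ τ → u ∉ F → u ≠ x →
      K.Facet (insert u (F.erase z)) → Pd F → Pd (insert u (F.erase z)))
    {F G : Finset (Fin d → ℝ)} (hF : K.Facet F) (hFτ : τ ⊆ F) (hFx : x ∉ F)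
    (hG : K.Facet G) (hGτ : τ ⊆ G) (hGx : x ∉ G) (hP : Pd F) : Pd G := by
  have step2 : ∀ F z u, K.Facet F → τ ⊆ F → x ∉ F → z ∈ F → z ∉ τ → u ∉ F → u ≠ x →
      K.Facet (insert u (F.erase z)) → (Pd (insert u (F.erase z)) ↔ Pd F) := by
    intro F z u h1 h2 h3 h4 h5 h6 h7 h8
    refine ⟨fun h => ?_, step F z u h1 h2 h3 h4 h5 h6 h7 h8⟩
    have := step (insert u (F.erase z)) u z h8 (fun y hy => Finset.mem_insert_of_mem
        (Finset.mem_erase.2 ⟨fun h => h5 (h ▸ hy), h2 hy⟩))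
      (fun hx => by
        rcases Finset.mem_insert.1 hx with hx | hx
        · exact h7 hx.symm
        · exact h3 (Finset.mem_of_mem_erase hx)) (by simp) (fun hu => h6 (h2 hu))
      (fun hz => by
        rcases Finset.mem_insert.1 hz with hx | hx
        · exact h6 (hx ▸ h4)
        · exact (Finset.mem_erase.1 hx).1 rfl) (fun hx => h3 (hx ▸ h4))
      (by rw [Facet.flip_back h4 h6]; exact h1) h
    rwa [Facet.flip_back h4 h6] at this
  let FS := K.V.powerset.filter fun F => K.Facet F
  have hFS : ∀ F, F ∈ FS ↔ K.Facet F := by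
    intro F
    simp only [FS, Finset.mem_filter, Finset.mem_powerset]
    exact ⟨fun h => h.2, fun h => ⟨h.sub, h⟩⟩
  let Q := (FS ×ˢ K.V).filter fun i => i.2 ∈ i.1
  have hQ : ∀ i, i ∈ Q ↔ K.Facet i.1 ∧ i.2 ∈ i.1 := by
    intro i
    simp only [Q, Finset.mem_filter, Finset.mem_product, hFS]
    exact ⟨fun h => ⟨h.1.1, h.2⟩, fun h => ⟨⟨h.1, h.1.sub h.2⟩, h.2⟩⟩
  obtain ⟨q, hq⟩ := gen_vec (Q.image fun i => ev i.1 i.2) (by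
    intro v hv
    obtain ⟨i, hi, rfl⟩ := Finset.mem_image.1 hv
    intro h0
    have := ((hQ i).1 hi).1.li.ev_self ((hQ i).1 hi).2
    rw [h0] at this
    simp at this)
  let Q2 := (FS ×ˢ FS).filter fun i => x ∉ i.1 ∧ x ∈ i.2
  obtain ⟨δ, hδ, hδ2⟩ := small_delta Q2 (fun i => nf i.2 ⬝ᵥ q - nf i.1 ⬝ᵥ q)
    (fun i => 1 - nf i.1 ⬝ᵥ x) (by
      intro i hi
      simp only [Q2, Finset.mem_filter, Finset.mem_product, hFS] at hi
      have := hi.1.1.nf_lt (hi.1.2.sub hi.2.2) hi.2.1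
      linarith)
  obtain ⟨ε, hε0, hε1, hε2⟩ := gen_eps Q (fun i => ev i.1 i.2 ⬝ᵥ (-x))
    (fun i => ev i.1 i.2 ⬝ᵥ q) (fun i hi => Or.inr (hq _ (Finset.mem_image_of_mem _ hi))) hδ
  set p := -x + ε • q with hp
  have hgen : ∀ F z, K.Facet F → z ∈ F → ev F z ⬝ᵥ p ≠ 0 := by
    intro F z hF hz
    have := hε2 (F, z) ((hQ _).2 ⟨hF, hz⟩)
    simpa [hp, dotProduct_add, dotProduct_smul] using this
  have hx : ∀ G G', K.Facet G → x ∉ G → K.Facet G' → x ∈ G' → nf G' ⬝ᵥ p < nf G ⬝ᵥ p := by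
    intro G G' h1 h2 h3 h4
    have := hδ2 (G, G') (by
      simp only [Q2, Finset.mem_filter, Finset.mem_product, hFS]; exact ⟨⟨h1, h3⟩, h2, h4⟩)
      ε hε0 hε1
    simp only [hp, dotProduct_add, dotProduct_smul, dotProduct_neg, smul_eq_mul, h3.nf_one h4]
    linarith
  -- local maxima
  have hloc : ∀ F, K.Facet F → τ ⊆ F → x ∉ F → ∃ M, K.Facet M ∧ τ ⊆ M ∧ x ∉ M ∧
      (Pd F ↔ Pd M) ∧ ∀ z ∈ M, z ∉ τ → 0 < ev M z ⬝ᵥ p := by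
    intro F hF h1 h2
    let C := FS.filter fun H => τ ⊆ H ∧ x ∉ H ∧ (Pd F ↔ Pd H)
    obtain ⟨M, hM, hmax⟩ := C.exists_max_image (fun H => nf H ⬝ᵥ p)
      ⟨F, by simp only [C, Finset.mem_filter, hFS]; exact ⟨hF, h1, h2, trivial⟩⟩
    simp only [C, Finset.mem_filter, hFS] at hM
    obtain ⟨hM1, hM2, hM3, hM4⟩ := hM
    refine ⟨M, hM1, hM2, hM3, hM4, fun z hz hzτ => ?_⟩
    obtain ⟨u, huV, huM, hu⟩ := hM1.exists_flip hz
    have hzG : z ∉ insert u (M.erase z) := by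
      intro h
      rcases Finset.mem_insert.1 h with h | h
      · exact huM (h ▸ hz)
      · exact (Finset.mem_erase.1 h).1 rfl
    have hlt := hu.nf_lt (hM1.sub hz) hzG
    have heq := congrArg (fun y => y ⬝ᵥ p) (hM1.nf_flip hz hu (Finset.subset_insert _ _))
    simp only [sub_dotProduct, smul_dotProduct, smul_eq_mul] at heq
    have hle : nf (insert u (M.erase z)) ⬝ᵥ p ≤ nf M ⬝ᵥ p := by
      by_cases hux : u = x
      · exact (hx _ _ hM1 hM3 hu (by simp [hux])).le
      · apply hmax
        simp only [C, Finset.mem_filter, hFS]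
        refine ⟨hu, fun y hy => Finset.mem_insert_of_mem
          (Finset.mem_erase.2 ⟨fun h => hzτ (h ▸ hy), hM2 hy⟩), ?_, ?_⟩
        · intro hx
          rcases Finset.mem_insert.1 hx with hx | hx
          · exact hux hx.symm
          · exact hM3 (Finset.mem_of_mem_erase hx)
        · rw [step2 M z u hM1 hM2 hM3 hz hzτ huM hux hu]; exact hM4
    have hne := hgen M z hM1 hz
    rcases lt_or_gt_of_ne hne with h | h
    · exfalso
      have := mul_pos_of_neg_of_neg (a := nf (insert u (M.erase z)) ⬝ᵥ z - 1) (by linarith) h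
      nlinarith
    · exact h
  obtain ⟨M, hM1, hM2, hM3, hM4, hM5⟩ := hloc F hF hFτ hFx
  obtain ⟨N, hN1, hN2, hN3, hN4, hN5⟩ := hloc G hG hGτ hGx
  have hMN : M = N := by
    -- shift by a large multiple of the sum of τ
    let L : ℝ := ∑ z ∈ τ, (|ev M z ⬝ᵥ p| + |ev N z ⬝ᵥ p|) + 1
    have hexp : ∀ M, K.Facet M → τ ⊆ M →
        p + L • ∑ z ∈ τ, z = ∑ z ∈ M, (ev M z ⬝ᵥ p + if z ∈ τ then L else 0) • z := by
      intro M hM hMτ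
      simp only [add_smul, Finset.sum_add_distrib, ite_smul, zero_smul]
      rw [← hM.li.expand hM.2 p, ← Finset.sum_filter, Finset.filter_mem_eq_inter,
        Finset.inter_eq_right.2 hMτ, Finset.smul_sum]
    have hL1 : ∀ z ∈ τ, |ev M z ⬝ᵥ p| + |ev N z ⬝ᵥ p| < L := by
      intro z hz
      have := Finset.single_le_sum (f := fun z => |ev M z ⬝ᵥ p| + |ev N z ⬝ᵥ p|)
        (fun i _ => by positivity) hz
      simp only [L]
      linarith
    refine fan hM1.1 hN1.1 (c := fun z => ev M z ⬝ᵥ p + if z ∈ τ then L else 0)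
      (e := fun z => ev N z ⬝ᵥ p + if z ∈ τ then L else 0) ?_ ?_ ?_
    · intro v hv
      by_cases hvτ : v ∈ τ
      · have := hL1 v hvτ
        simp only [hvτ, if_true]
        linarith [neg_abs_le (ev M v ⬝ᵥ p), abs_nonneg (ev N v ⬝ᵥ p)]
      · simp only [hvτ, if_false, add_zero]; exact hM5 v hv hvτ
    · intro v hv
      by_cases hvτ : v ∈ τ
      · have := hL1 v hvτ
        simp only [hvτ, if_true]
        linarith [neg_abs_le (ev N v ⬝ᵥ p), abs_nonneg (ev M v ⬝ᵥ p)]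
      · simp only [hvτ, if_false, add_zero]; exact hN5 v hv hvτ
    · rw [← hexp M hM1 hM2, ← hexp N hN1 hN2]
  rw [hN4, ← hMN, ← hM4]
  exact hP

end CSP

/-! ### volumes -/

/-- absolute determinant of a set of vectors with `d` elements -/
def vol {d : ℕ} (F : Finset (Fin d → ℝ)) : ℝ :=
  if h : ∃ e : Fin d → (Fin d → ℝ), Function.Injective e ∧ Finset.univ.image e = F then
    |(Matrix.of h.choose).det| else 0

theorem vol_eq {d : ℕ} {F : Finset (Fin d → ℝ)} {e : Fin d → (Fin d → ℝ)}
    (he : Function.Injective e) (hF : Finset.univ.image e = F) :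
    vol F = |(Matrix.of e).det| := by
  have h : ∃ e : Fin d → (Fin d → ℝ), Function.Injective e ∧ Finset.univ.image e = F := ⟨e, he, hF⟩
  unfold vol
  rw [dif_pos h]
  obtain ⟨h1, h2⟩ := h.choose_spec
  set e' := h.choose
  have hex : ∀ i, ∃ j, e j = e' i := by
    intro i
    have : e' i ∈ Finset.univ.image e := by rw [hF, ← h2]; simp
    simpa using this
  choose σ hσ using hex
  have hinj : Function.Injective σ := by
    intro i j hij
    apply h1
    rw [← hσ i, ← hσ j, hij]
  let π : Equiv.Perm (Fin d) := Equiv.ofBijective σ (Finite.injective_iff_bijective.1 hinj)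
  have : Matrix.of e' = (Matrix.of e).submatrix π id := by
    ext i j
    simp [π, Matrix.submatrix_apply, ← hσ i]
  rw [this, Matrix.det_permute]
  rcases Int.units_eq_one_or (Equiv.Perm.sign π) with h | h <;> simp [h]

theorem exists_enum {d : ℕ} {F : Finset (Fin d → ℝ)} (hF : F.card = d) :
    ∃ e : Fin d → (Fin d → ℝ), Function.Injective e ∧ Finset.univ.image e = F := by
  let φ := (F.equivFinOfCardEq hF).symm
  refine ⟨fun i => φ i, fun i j h => φ.injective (Subtype.ext h), ?_⟩
  ext v
  simp only [Finset.mem_image, Finset.mem_univ, true_and]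
  constructor
  · rintro ⟨i, rfl⟩; exact (φ i).2
  · intro hv; exact ⟨φ.symm ⟨v, hv⟩, by simp⟩

theorem LI.vol_pos {d : ℕ} {F : Finset (Fin d → ℝ)} (h : LI F) (hF : F.card = d) : 0 < vol F := by
  obtain ⟨e, h1, h2⟩ := exists_enum hF
  rw [vol_eq h1 h2, abs_pos]
  intro h0
  obtain ⟨w, hw, hw2⟩ := Matrix.exists_mulVec_eq_zero_iff.2 h0
  apply hw
  apply h.eq_zero hF
  intro v hv
  rw [← h2] at hv
  obtain ⟨i, _, rfl⟩ := Finset.mem_image.1 hv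
  have := congrFun hw2 i
  rw [dotProduct_comm]
  exact this

theorem LI.vol_flip {d : ℕ} {F : Finset (Fin d → ℝ)} (h : LI F) (hF : F.card = d)
    {z u : Fin d → ℝ} (hz : z ∈ F) (hu : u ∉ F) :
    vol (insert u (F.erase z)) = |ev F z ⬝ᵥ u| * vol F := by
  obtain ⟨e, h1, h2⟩ := exists_enum hF
  have hz' := hz
  rw [← h2] at hz'
  obtain ⟨k, _, hk⟩ := Finset.mem_image.1 hz'
  have heF : ∀ i, e i ∈ F := fun i => by rw [← h2]; simp
  have hu1 : u = ∑ i, (ev F (e i) ⬝ᵥ u) • e i := by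
    conv_lhs => rw [h.expand hF u, ← h2, Finset.sum_image (fun a _ b _ hab => h1 hab)]
    rw [h2]
  have hinj : Function.Injective (Function.update e k u) := by
    intro i j hij
    by_cases hi : i = k <;> by_cases hj : j = k
    · rw [hi, hj]
    · subst hi
      simp [hj] at hij
      exact absurd (heF j) (hij ▸ hu)
    · subst hj
      simp [hi] at hij
      exact absurd (heF i) (hij ▸ hu)
    · simp [hi, hj] at hij
      exact h1 hij
  have him : Finset.univ.image (Function.update e k u) = insert u (F.erase z) := by
    apply Finset.eq_of_subset_of_card_le
    · intro v hv
      obtain ⟨i, _, rfl⟩ := Finset.mem_image.1 hv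
      by_cases hi : i = k
      · subst hi; simp
      · rw [Function.update_of_ne hi]
        refine Finset.mem_insert_of_mem (Finset.mem_erase.2 ⟨?_, heF i⟩)
        rw [← hk]
        exact fun h => hi (h1 h)
    · rw [Finset.card_image_of_injective _ hinj]
      refine (Finset.card_insert_le _ _).trans ?_
      rw [Finset.card_erase_of_mem hz]
      have : 0 < F.card := Finset.card_pos.2 ⟨z, hz⟩
      simp
      omega
  rw [vol_eq hinj him, vol_eq h1 h2]
  have hdet : (Matrix.of (Function.update e k u)).det =
      (ev F z ⬝ᵥ u) * (Matrix.of e).det := by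
    have e1 : Matrix.of (Function.update e k u) = (Matrix.of e).updateRow k u := rfl
    rw [e1]
    conv_lhs => rw [hu1]
    have := Matrix.det_updateRow_sum (Matrix.of e) k (fun i => ev F (e i) ⬝ᵥ u)
    rw [hk] at this
    exact this
  rw [hdet, abs_mul]

namespace CSP
variable {d : ℕ} {K : CSP d}

def al (F : Finset (Fin d → ℝ)) : ℝ := (vol F)⁻¹

theorem Facet.al_pos {F : Finset (Fin d → ℝ)} (h : K.Facet F) : 0 < al F :=
  inv_pos.2 (h.li.vol_pos h.2)

theorem Facet.balance {F : Finset (Fin d → ℝ)} (hF : K.Facet F) {z u : Fin d → ℝ}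
    (hz : z ∈ F) (hu : u ∉ F) (hG : K.Facet (insert u (F.erase z))) :
    ∃ c : (Fin d → ℝ) → ℝ,
      al F • z + al (insert u (F.erase z)) • u = ∑ r ∈ F.erase z, c r • r := by
  have hk := hF.ev_flip_neg hz hu hG
  have hv := hF.li.vol_pos hF.2
  have ha : al (insert u (F.erase z)) = al F * (-(ev F z ⬝ᵥ u))⁻¹ := by
    unfold al
    rw [hF.li.vol_flip hF.2 hz hu, abs_of_neg hk, mul_inv, mul_comm]
  refine ⟨fun r => al (insert u (F.erase z)) * (ev F r ⬝ᵥ u), ?_⟩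
  have h1 : ∑ r ∈ F.erase z, (al (insert u (F.erase z)) * (ev F r ⬝ᵥ u)) • r =
      al (insert u (F.erase z)) • (u - (ev F z ⬝ᵥ u) • z) := by
    have h0 := hF.li.expand hF.2 u
    rw [← Finset.add_sum_erase _ _ hz] at h0
    have h00 : u - (ev F z ⬝ᵥ u) • z = ∑ x ∈ F.erase z, (ev F x ⬝ᵥ u) • x := by
      rw [sub_eq_iff_eq_add']
      exact h0
    rw [h00, Finset.smul_sum]
    simp [mul_smul]
  rw [h1, smul_sub, smul_smul]
  have h2 : al (insert u (F.erase z)) * (ev F z ⬝ᵥ u) = - al F := by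
    rw [ha]
    have := hk.ne
    field_simp
  rw [h2, neg_smul, sub_neg_eq_add, add_comm]

end CSP

/-! ### The planar lemma -/

section Planar
variable {ι κ : Type} (I : Finset ι) (U : Finset κ) (p q : ι → κ) (α : ι → ℝ) (c : κ → ℝ)

def om (u : κ) (w : κ → ℝ) : ℝ :=
  ∑ i ∈ I, α i * ((if p i = u then w (q i) else 0) + (if q i = u then w (p i) else 0)) - c u * w u

theorem om_comb (u : κ) (w w' : κ → ℝ) (s t : ℝ) :
    om I p q α c u (fun v => s * w v + t * w' v) =
      s * om I p q α c u w + t * om I p q α c u w' := by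
  unfold om
  rw [mul_sub, mul_sub, Finset.mul_sum, Finset.mul_sum]
  have : ∀ A B C D : ℝ, A - B + (C - D) = A + C - (B + D) := by intros; ring
  rw [this, ← Finset.sum_add_distrib]
  congr 1
  · refine Finset.sum_congr rfl fun i _ => ?_
    split_ifs <;> ring
  · ring

theorem om_congr {u : κ} {w w' : κ → ℝ} (hu : w u = w' u)
    (h1 : ∀ i ∈ I, p i = u → w (q i) = w' (q i)) (h2 : ∀ i ∈ I, q i = u → w (p i) = w' (p i)) :
    om I p q α c u w = om I p q α c u w' := by
  unfold om
  rw [hu]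
  congr 1
  refine Finset.sum_congr rfl fun i hi => ?_
  congr 1
  congr 1
  · by_cases h : p i = u
    · rw [if_pos h, if_pos h, h1 i hi h]
    · rw [if_neg h, if_neg h]
  · by_cases h : q i = u
    · rw [if_pos h, if_pos h, h2 i hi h]
    · rw [if_neg h, if_neg h]

theorem om_symm (hp : ∀ i ∈ I, p i ∈ U) (hq : ∀ i ∈ I, q i ∈ U) (w w' : κ → ℝ) :
    ∑ u ∈ U, om I p q α c u w * w' u = ∑ u ∈ U, om I p q α c u w' * w u := by
  have key : ∀ w w' : κ → ℝ, ∑ u ∈ U, om I p q α c u w * w' u =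
      ∑ i ∈ I, α i * (w (q i) * w' (p i) + w (p i) * w' (q i)) - ∑ u ∈ U, c u * w u * w' u := by
    intro w w'
    unfold om
    simp only [sub_mul, Finset.sum_sub_distrib, Finset.sum_mul]
    congr 1
    rw [Finset.sum_comm]
    refine Finset.sum_congr rfl fun i hi => ?_
    simp only [mul_add, add_mul, Finset.sum_add_distrib, mul_ite, ite_mul, mul_zero, zero_mul,
      Finset.sum_ite_eq, hp i hi, hq i hi, if_true]
    ring
  rw [key, key]
  congr 1
  · exact Finset.sum_congr rfl fun i _ => by ring
  · exact Finset.sum_congr rfl fun i _ => by ring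

variable {I U p q α c}

theorem planar (hp : ∀ i ∈ I, p i ∈ U) (hq : ∀ i ∈ I, q i ∈ U)
    {X Y h : κ → ℝ} (hX : ∀ u ∈ U, X u ≠ 0)
    (hbX : ∀ u ∈ U, om I p q α c u X = 0) (hbY : ∀ u ∈ U, om I p q α c u Y = 0)
    (hα : ∀ i ∈ I, 0 < α i)
    (hdet : ∀ i ∈ I, X (p i) * Y (q i) - X (q i) * Y (p i) ≠ 0)
    {x y : ι → ℝ}
    (hhp : ∀ i ∈ I, h (p i) = x i * X (p i) + y i * Y (p i))
    (hhq : ∀ i ∈ I, h (q i) = x i * X (q i) + y i * Y (q i))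
    (hhu : ∀ i ∈ I, ∀ u ∈ U, u ≠ p i → u ≠ q i → x i * X u + y i * Y u < h u)
    (hdist : ∀ i ∈ I, ∀ j ∈ I, i ≠ j → ∃ u, (u = p i ∨ u = q i) ∧ u ≠ p j ∧ u ≠ q j)
    (hcov : ∀ u ∈ U, ∃ j ∈ I, p j = u ∨ q j = u)
    (hlink : ∀ u ∈ U, ∀ j ∈ I, ∃ i ∈ I, i ≠ j ∧ (p i = u ∨ q i = u))
    {w : κ → ℝ} (hw : ∑ u ∈ U, om I p q α c u w * h u = 0) :
    ∑ u ∈ U, om I p q α c u w * w u ≤ 0 ∧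
      (∑ u ∈ U, om I p q α c u w * w u = 0 → ∀ u ∈ U, om I p q α c u w = 0) := by
  let D : ι → (κ → ℝ) → ℝ := fun i w => w (p i) / X (p i) - w (q i) / X (q i)
  have hom : ∀ u ∈ U, ∀ w, om I p q α c u w = ∑ i ∈ I, α i *
      ((if p i = u then - X (q i) * D i w else 0) + (if q i = u then X (p i) * D i w else 0)) := by
    intro u hu w
    have hXu := hX u hu
    have h1 := hbX u hu
    unfold om at h1 ⊢
    have hc : c u * w u = ∑ i ∈ I, α i * ((if p i = u then X (q i) else 0) +
        (if q i = u then X (p i) else 0)) * (w u / X u) := by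
      rw [← Finset.sum_mul, eq_of_sub_eq_zero h1]
      field_simp
    rw [hc, ← Finset.sum_sub_distrib]
    refine Finset.sum_congr rfl fun i hi => ?_
    have e1 := hX _ (hp i hi)
    have e2 := hX _ (hq i hi)
    simp only [D]
    by_cases hpu : p i = u <;> by_cases hqu : q i = u
    · subst hpu
      rw [if_pos rfl, if_pos hqu, if_pos rfl, if_pos hqu, if_pos rfl, if_pos hqu, hqu]
      field_simp
      ring
    · subst hpu
      simp only [if_true, hqu, if_false, add_zero]
      field_simp
      ring
    · subst hqu
      simp only [if_true, hpu, if_false, zero_add]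
      field_simp
    · simp [hpu, hqu]
  have hB : ∀ w w', ∑ u ∈ U, om I p q α c u w * w' u =
      - ∑ i ∈ I, α i * (X (p i) * X (q i)) * D i w * D i w' := by
    intro w w'
    rw [Finset.sum_congr rfl fun u hu => by rw [hom u hu w]]
    simp only [Finset.sum_mul]
    rw [Finset.sum_comm, ← Finset.sum_neg_distrib]
    refine Finset.sum_congr rfl fun i hi => ?_
    have e1 := hX _ (hp i hi)
    have e2 := hX _ (hq i hi)
    simp only [mul_add, add_mul, Finset.sum_add_distrib, mul_ite, ite_mul, mul_zero, zero_mul,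
      Finset.sum_ite_eq, hp i hi, hq i hi, if_true, D]
    field_simp
    ring
  have hle : ∀ i ∈ I, ∀ u ∈ U, x i * X u + y i * Y u ≤ h u := by
    intro i hi u hu
    by_cases h1 : u = p i
    · rw [h1, hhp i hi]
    · by_cases h2 : u = q i
      · rw [h2, hhq i hi]
      · exact (hhu i hi u hu h1 h2).le
  -- crossing arcs
  have hyne : ∀ i ∈ I, ∀ j ∈ I, i ≠ j → X (p i) * X (q i) < 0 → y i ≠ y j := by
    intro i hi j hj hij hcr hy
    have h1 := hle j hj _ (hp i hi)
    have h2 := hle j hj _ (hq i hi)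
    rw [hhp i hi, hy] at h1
    rw [hhq i hi, hy] at h2
    have hx : x i = x j := by
      have h1' : 0 ≤ (x i - x j) * X (p i) := by linarith
      have h2' : 0 ≤ (x i - x j) * X (q i) := by linarith
      have h3 := mul_nonneg h1' h2'
      have h4 : (x i - x j) * X (p i) * ((x i - x j) * X (q i)) =
        (x i - x j) ^ 2 * (X (p i) * X (q i)) := by ring
      rw [h4] at h3
      by_contra hne
      have h5 : 0 < (x i - x j) ^ 2 := by
        have := sub_ne_zero.2 hne
        positivity
      nlinarith
    obtain ⟨u, hu, hu1, hu2⟩ := hdist i hi j hj hij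
    rcases hu with rfl | rfl
    · have := hhu j hj _ (hp i hi) hu1 hu2
      rw [hhp i hi, hx, hy] at this
      exact lt_irrefl _ this
    · have := hhu j hj _ (hq i hi) hu1 hu2
      rw [hhq i hi, hx, hy] at this
      exact lt_irrefl _ this
  have hDY : ∀ i ∈ I, D i Y ≠ 0 := by
    intro i hi h0
    apply hdet i hi
    have e1 := hX _ (hp i hi)
    have e2 := hX _ (hq i hi)
    simp only [D] at h0
    field_simp at h0
    linarith
  have hDh : ∀ i ∈ I, D i h = y i * D i Y := by
    intro i hi
    have e1 := hX _ (hp i hi)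
    have e2 := hX _ (hq i hi)
    simp only [D]
    rw [hhp i hi, hhq i hi]
    field_simp
    ring
  -- monotonicity for crossing arcs : the sign of `D i Y * (X (p i))`
  have hmono : ∀ i ∈ I, ∀ j ∈ I, X (p j) * X (q j) < 0 →
      0 ≤ (y j - y i) * (D j Y * X (p j)) := by
    intro i hi j hj hcr
    have e1 := hX _ (hp j hj)
    have e2 := hX _ (hq j hj)
    have h1 := hle i hi _ (hp j hj)
    have h2 := hle i hi _ (hq j hj)
    rw [hhp j hj] at h1
    rw [hhq j hj] at h2
    have h1' : 0 ≤ (x j - x i) * X (p j) + (y j - y i) * Y (p j) := by linarith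
    have h2' : 0 ≤ (x j - x i) * X (q j) + (y j - y i) * Y (q j) := by linarith
    have h3 : (y j - y i) * (D j Y * X (p j)) =
      ((x j - x i) * X (p j) + (y j - y i) * Y (p j)) +
      ((x j - x i) * X (q j) + (y j - y i) * Y (q j)) * (- (X (p j) / X (q j))) := by
      simp only [D]
      field_simp
      ring
    rw [h3]
    have h4 : 0 ≤ - (X (p j) / X (q j)) := by
      rw [neg_nonneg]
      have : X (p j) / X (q j) = (X (p j) * X (q j)) / (X (q j)) ^ 2 := by field_simp
      rw [this]
      exact div_nonpos_of_nonpos_of_nonneg hcr.le (by positivity)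
    have := mul_nonneg h2' h4
    linarith
  -- three distinct crossing arcs are impossible
  have hthree : ∀ i ∈ I, ∀ j ∈ I, ∀ k ∈ I, i ≠ j → i ≠ k → j ≠ k →
      X (p i) * X (q i) < 0 → X (p j) * X (q j) < 0 → X (p k) * X (q k) < 0 → False := by
    have hsame : ∀ i ∈ I, ∀ j ∈ I, i ≠ j → X (p i) * X (q i) < 0 → X (p j) * X (q j) < 0 →
        0 < (D i Y * X (p i)) * (D j Y * X (p j)) → False := by
      intro i hi j hj hij ci cj hs
      apply hyne i hi j hj hij ci
      have m1 := hmono i hi j hj cj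
      have m2 := hmono j hj i hi ci
      by_contra hne
      have hpos : 0 < (y i - y j) ^ 2 := by
        have := sub_ne_zero.2 hne
        positivity
      nlinarith [mul_nonneg m1 m2, mul_pos hpos hs]
    intro i hi j hj k hk hij hik hjk ci cj ck
    have a1 := mul_ne_zero (hDY i hi) (hX _ (hp i hi))
    have a2 := mul_ne_zero (hDY j hj) (hX _ (hp j hj))
    have a3 := mul_ne_zero (hDY k hk) (hX _ (hp k hk))
    have b1 := hsame i hi j hj hij ci cj
    have b2 := hsame i hi k hk hik ci ck
    have b3 := hsame j hj k hk hjk cj ck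
    rcases lt_or_gt_of_ne a1 with s1 | s1 <;> rcases lt_or_gt_of_ne a2 with s2 | s2 <;>
      rcases lt_or_gt_of_ne a3 with s3 | s3
    · exact b1 (mul_pos_of_neg_of_neg s1 s2)
    · exact b1 (mul_pos_of_neg_of_neg s1 s2)
    · exact b2 (mul_pos_of_neg_of_neg s1 s3)
    · exact b3 (mul_pos s2 s3)
    · exact b3 (mul_pos_of_neg_of_neg s2 s3)
    · exact b2 (mul_pos s1 s3)
    · exact b1 (mul_pos s1 s2)
    · exact b1 (mul_pos s1 s2)
  -- choose t and β
  have hex : ∃ t β : ℝ, ∀ i ∈ I, X (p i) * X (q i) < 0 →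
      D i w - t * D i h - β * D i Y = 0 := by
    by_cases h0 : ∃ i ∈ I, X (p i) * X (q i) < 0
    · obtain ⟨i, hi, ci⟩ := h0
      by_cases h1 : ∃ j ∈ I, j ≠ i ∧ X (p j) * X (q j) < 0
      · obtain ⟨j, hj, hji, cj⟩ := h1
        have hy := sub_ne_zero.2 (hyne i hi j hj hji.symm ci)
        have n1 := hDY i hi
        have n2 := hDY j hj
        set A := D i w / D i Y with hA
        set C := D j w / D j Y with hC
        have hA' : D i w = A * D i Y := by rw [hA]; field_simp
        have hC' : D j w = C * D j Y := by rw [hC]; field_simp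
        refine ⟨(A - C) / (y i - y j), A - (A - C) / (y i - y j) * y i, ?_⟩
        intro k hk ck
        by_cases hki : k = i
        · subst hki
          rw [hA', hDh k hk]; ring
        · by_cases hkj : k = j
          · subst hkj
            rw [hC', hDh k hk]
            field_simp
            ring
          · exact (hthree k hk i hi j hj hki hkj hji.symm ck ci cj).elim
      · refine ⟨0, D i w / D i Y, fun k hk ck => ?_⟩
        by_cases hki : k = i
        · subst hki
          have := hDY k hk
          field_simp
          ring
        · exact (h1 ⟨k, hk, hki, ck⟩).elim
    · exact ⟨0, 0, fun i hi ci => (h0 ⟨i, hi, ci⟩).elim⟩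
  obtain ⟨t, β, htβ⟩ := hex
  -- positivity of B(h,h)
  have homh : ∀ u ∈ U, 0 < om I p q α c u h := by
    intro u hu
    obtain ⟨j, hj, hju⟩ := hcov u hu
    have hlin : om I p q α c u h =
        om I p q α c u (fun v => 1 * h v + (-1) * (x j * X v + y j * Y v)) := by
      rw [om_comb, om_comb, hbX u hu, hbY u hu]; ring
    rw [hlin]
    have hzero : h u = x j * X u + y j * Y u := by
      rcases hju with rfl | rfl
      · exact hhp j hj
      · exact hhq j hj
    unfold om
    simp only [hzero]
    have hnn : ∀ v ∈ U, 0 ≤ 1 * h v + (-1) * (x j * X v + y j * Y v) := by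
      intro v hv; linarith [hle j hj v hv]
    have : ∀ A : ℝ, A - c u * (1 * (x j * X u + y j * Y u) + -1 * (x j * X u + y j * Y u)) = A := by
      intro A; ring
    rw [this]
    apply Finset.sum_pos'
    · intro i hi
      refine mul_nonneg (hα i hi).le (add_nonneg ?_ ?_)
      · split_ifs
        · exact hnn _ (hq i hi)
        · exact le_rfl
      · split_ifs
        · exact hnn _ (hp i hi)
        · exact le_rfl
    · obtain ⟨i, hi, hij, hiu⟩ := hlink u hu j hj
      refine ⟨i, hi, mul_pos (hα i hi) ?_⟩
      obtain ⟨v, hv, hv1, hv2⟩ := hdist i hi j hj hij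
      have hvu : v ≠ u := by
        rcases hju with rfl | rfl
        · exact hv1
        · exact hv2
      have hn1 : 0 ≤ (if p i = u then 1 * h (q i) + (-1) * (x j * X (q i) + y j * Y (q i)) else 0) := by
        split_ifs
        · exact hnn _ (hq i hi)
        · exact le_rfl
      have hn2 : 0 ≤ (if q i = u then 1 * h (p i) + (-1) * (x j * X (p i) + y j * Y (p i)) else 0) := by
        split_ifs
        · exact hnn _ (hp i hi)
        · exact le_rfl
      rcases hv with rfl | rfl
      · have hqu : q i = u := by
          rcases hiu with h | h
          · exact absurd h hvu
          · exact h
        refine add_pos_of_nonneg_of_pos hn1 ?_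
        rw [if_pos hqu]
        linarith [hhu j hj _ (hp i hi) hv1 hv2]
      · have hqu : p i = u := by
          rcases hiu with h | h
          · exact h
          · exact absurd h hvu
        refine add_pos_of_pos_of_nonneg ?_ hn2
        rw [if_pos hqu]
        linarith [hhu j hj _ (hq i hi) hv1 hv2]
  rcases U.eq_empty_or_nonempty with hU | hU
  · subst hU; simp
  have hBhh : 0 < ∑ u ∈ U, om I p q α c u h * h u := by
    obtain ⟨u0, hu0⟩ := hU
    obtain ⟨j, hj, _⟩ := hcov u0 hu0
    have hz : ∑ u ∈ U, om I p q α c u h * (x j * X u + y j * Y u) = 0 := by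
      rw [om_symm I U p q α c hp hq]
      apply Finset.sum_eq_zero
      intro u hu
      rw [om_comb, hbX u hu, hbY u hu]; ring
    have : ∑ u ∈ U, om I p q α c u h * h u =
        ∑ u ∈ U, om I p q α c u h * (h u - (x j * X u + y j * Y u)) := by
      simp only [mul_sub, Finset.sum_sub_distrib, hz, sub_zero]
    rw [this]
    apply Finset.sum_pos'
    · intro u hu
      exact mul_nonneg (homh u hu).le (sub_nonneg.2 (hle j hj u hu))
    · obtain ⟨i, hi, hij, _⟩ := hlink u0 hu0 j hj
      obtain ⟨v, hv, hv1, hv2⟩ := hdist i hi j hj hij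
      have hvU : v ∈ U := by
        rcases hv with rfl | rfl
        · exact hp i hi
        · exact hq i hi
      exact ⟨v, hvU, mul_pos (homh v hvU) (sub_pos.2 (hhu j hj v hvU hv1 hv2))⟩
  set w' : κ → ℝ := fun v => 1 * w v + (-1) * (t * h v + β * Y v) with hw'
  have homw' : ∀ u ∈ U, om I p q α c u w' = om I p q α c u w - t * om I p q α c u h := by
    intro u hu
    rw [hw', om_comb, om_comb, hbY u hu]; ring
  have hBY : ∀ g : κ → ℝ, ∑ u ∈ U, om I p q α c u g * Y u = 0 := by
    intro g
    rw [om_symm I U p q α c hp hq]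
    exact Finset.sum_eq_zero fun u hu => by rw [hbY u hu, zero_mul]
  have hBw' : ∑ u ∈ U, om I p q α c u w' * w' u =
      ∑ u ∈ U, om I p q α c u w * w u + t ^ 2 * ∑ u ∈ U, om I p q α c u h * h u := by
    have e1 : ∑ u ∈ U, om I p q α c u h * w u = 0 := by
      rw [om_symm I U p q α c hp hq]; exact hw
    have e2 := hBY w
    have e3 := hBY h
    have : ∑ u ∈ U, om I p q α c u w' * w' u =
      ∑ u ∈ U, om I p q α c u w * w u - t * ∑ u ∈ U, om I p q α c u w * h u
      - β * ∑ u ∈ U, om I p q α c u w * Y u - t * ∑ u ∈ U, om I p q α c u h * w u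
      + t ^ 2 * ∑ u ∈ U, om I p q α c u h * h u + t * β * ∑ u ∈ U, om I p q α c u h * Y u := by
      simp only [Finset.mul_sum, ← Finset.sum_sub_distrib, ← Finset.sum_add_distrib]
      refine Finset.sum_congr rfl fun u hu => ?_
      rw [homw' u hu, hw']
      ring
    rw [this, hw, e1, e2, e3]; ring
  have hDw' : ∀ i ∈ I, D i w' = D i w - t * D i h - β * D i Y := by
    intro i _
    simp only [D, hw']
    ring
  have hterm : ∀ i ∈ I, 0 ≤ α i * (X (p i) * X (q i)) * D i w' * D i w' := by
    intro i hi
    by_cases hcr : X (p i) * X (q i) < 0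
    · rw [hDw' i hi, htβ i hi hcr]; simp
    · have := mul_nonneg (mul_nonneg (hα i hi).le (not_lt.1 hcr)) (mul_self_nonneg (D i w'))
      linarith
  have hneg : ∑ u ∈ U, om I p q α c u w' * w' u ≤ 0 := by
    rw [hB, neg_nonpos]
    exact Finset.sum_nonneg hterm
  constructor
  · nlinarith [mul_nonneg (sq_nonneg t) hBhh.le]
  · intro h0 u hu
    rw [h0, zero_add] at hBw'
    have ht2 : t ^ 2 * ∑ u ∈ U, om I p q α c u h * h u = 0 :=
      le_antisymm (hBw' ▸ hneg) (mul_nonneg (sq_nonneg t) hBhh.le)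
    have ht : t = 0 := by
      rcases mul_eq_zero.1 ht2 with h | h
      · exact pow_eq_zero_iff (two_ne_zero) |>.1 h
      · exact absurd h hBhh.ne'
    rw [ht2, hB, neg_eq_zero, Finset.sum_eq_zero_iff_of_nonneg hterm] at hBw'
    have hD0 : ∀ i ∈ I, D i w' = 0 := by
      intro i hi
      have := hBw' i hi
      have n1 := (hα i hi).ne'
      have n2 := hX _ (hp i hi)
      have n3 := hX _ (hq i hi)
      simpa [n1, n2, n3] using this
    have h1 := homw' u hu
    rw [ht, zero_mul, sub_zero] at h1
    rw [← h1, hom u hu]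
    exact Finset.sum_eq_zero fun i hi => by rw [hD0 i hi]; simp

end Planar

theorem om_bilin {ι κ : Type} (I : Finset ι) (U : Finset κ) (p q : ι → κ) (α : ι → ℝ) (c : κ → ℝ)
    (hp : ∀ i ∈ I, p i ∈ U) (hq : ∀ i ∈ I, q i ∈ U) (w w' : κ → ℝ) :
    ∑ u ∈ U, om I p q α c u w * w' u =
      ∑ i ∈ I, α i * (w (q i) * w' (p i) + w (p i) * w' (q i)) - ∑ u ∈ U, c u * (w u * w' u) := by
  unfold om
  simp only [sub_mul, Finset.sum_sub_distrib, Finset.sum_mul]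
  congr 1
  · rw [Finset.sum_comm]
    refine Finset.sum_congr rfl fun i hi => ?_
    simp only [mul_add, add_mul, Finset.sum_add_distrib, mul_ite, ite_mul, mul_zero, zero_mul,
      Finset.sum_ite_eq, hp i hi, hq i hi, if_true]
    ring
  · exact Finset.sum_congr rfl fun i _ => by ring

namespace CSP
variable {d : ℕ} (K : CSP d)

/-- facets containing a given set -/
def fs (R : Finset (Fin d → ℝ)) : Finset (Finset (Fin d → ℝ)) :=
  K.V.powerset.filter fun F => K.Facet F ∧ R ⊆ F

/-- vertices of the link -/
def lk (R : Finset (Fin d → ℝ)) : Finset (Fin d → ℝ) :=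
  K.V.filter fun u => u ∉ R ∧ K.Fc (insert u R)

def cc (R : Finset (Fin d → ℝ)) : (Fin d → ℝ) → ℝ :=
  if h : ∃ c : (Fin d → ℝ) → ℝ, ∑ F ∈ K.fs R, ∑ z ∈ F \ R, al F • z = ∑ r ∈ R, c r • r then
    h.choose else 0

def Om (R : Finset (Fin d → ℝ)) (φ : (Fin d → ℝ) → ℝ) : ℝ :=
  ∑ F ∈ K.fs R, ∑ z ∈ F \ R, al F * φ z - ∑ r ∈ R, K.cc R r * φ r

variable {K}

theorem mem_fs {R F : Finset (Fin d → ℝ)} : F ∈ K.fs R ↔ K.Facet F ∧ R ⊆ F := by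
  simp only [fs, Finset.mem_filter, Finset.mem_powerset]
  exact ⟨fun h => h.2, fun h => ⟨h.1.sub, h⟩⟩

theorem mem_lk {R : Finset (Fin d → ℝ)} {u : Fin d → ℝ} :
    u ∈ K.lk R ↔ u ∉ R ∧ K.Fc (insert u R) := by
  simp only [lk, Finset.mem_filter]
  exact ⟨fun h => h.2, fun h => ⟨h.2.1 (by simp), h⟩⟩

theorem ridge {R : Finset (Fin d → ℝ)} (hR : K.Fc R) (hc : R.card + 1 = d) :
    ∃ z u, z ∉ R ∧ u ∉ R ∧ z ≠ u ∧ K.Facet (insert z R) ∧ K.Facet (insert u R) ∧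
      K.fs R = {insert z R, insert u R} := by
  obtain ⟨F, hF, hRF⟩ := hR.exists_facet
  have hcard : (F \ R).card = 1 := by
    rw [Finset.card_sdiff_of_subset hRF, hF.2]; omega
  obtain ⟨z, hz⟩ := Finset.card_eq_one.1 hcard
  have hzF : z ∈ F ∧ z ∉ R := by
    have : z ∈ F \ R := by rw [hz]; simp
    simpa using this
  have hFe : F = insert z R := by
    rw [← Finset.sdiff_union_of_subset hRF, hz]; rfl
  have hRe : F.erase z = R := by rw [hFe, Finset.erase_insert hzF.2]
  obtain ⟨u, huV, huF, hu⟩ := hF.exists_flip hzF.1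
  rw [hRe] at hu
  have huR : u ∉ R := fun h => huF (hRF h)
  have hzu : z ≠ u := fun h => huF (h ▸ hzF.1)
  refine ⟨z, u, hzF.2, huR, hzu, hFe ▸ hF, hu, ?_⟩
  have hne : insert u R ≠ F := fun h => huF (h ▸ by simp)
  ext G
  rw [mem_fs]
  simp only [Finset.mem_insert, Finset.mem_singleton, ← hFe]
  constructor
  · rintro ⟨hG, hGR⟩
    by_cases hGF : G = F
    · exact Or.inl hGF
    · right
      exact hF.flip_uniq hzF.1 hG (by rw [hRe]; exact hGR) hu
        (by rw [hRe]; exact Finset.subset_insert _ _) hGF hne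
  · rintro (rfl | rfl)
    · exact ⟨hF, hRF⟩
    · exact ⟨hu, Finset.subset_insert _ _⟩

theorem sum_fs_ridge {W : Type} [AddCommMonoid W] {R : Finset (Fin d → ℝ)} {z u : Fin d → ℝ}
    (hz : z ∉ R) (hu : u ∉ R) (hzu : z ≠ u) (h : K.fs R = {insert z R, insert u R})
    (φ : Finset (Fin d → ℝ) → (Fin d → ℝ) → W) :
    ∑ F ∈ K.fs R, ∑ z ∈ F \ R, φ F z = φ (insert z R) z + φ (insert u R) u := by
  have hne : insert z R ≠ insert u R := by
    intro h
    have : z ∈ insert u R := h ▸ (by simp)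
    rcases Finset.mem_insert.1 this with h | h
    · exact hzu h
    · exact hz h
  have key : ∀ z ∉ R, insert z R \ R = {z} := by
    intro z hz
    ext x
    simp only [Finset.mem_sdiff, Finset.mem_insert, Finset.mem_singleton]
    constructor
    · rintro ⟨h | h, h2⟩
      · exact h
      · exact absurd h h2
    · rintro rfl; exact ⟨Or.inl rfl, hz⟩
  rw [h, Finset.sum_pair hne, key z hz, key u hu]
  simp

theorem cc_spec {R : Finset (Fin d → ℝ)} (hR : K.Fc R) (hc : R.card + 1 = d) :
    ∑ F ∈ K.fs R, ∑ z ∈ F \ R, al F • z = ∑ r ∈ R, K.cc R r • r := by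
  have h : ∃ c : (Fin d → ℝ) → ℝ,
      ∑ F ∈ K.fs R, ∑ z ∈ F \ R, al F • z = ∑ r ∈ R, c r • r := by
    obtain ⟨z, u, hz, hu, hzu, hFz, hFu, hfs⟩ := ridge hR hc
    have e : (insert z R).erase z = R := Finset.erase_insert hz
    obtain ⟨c, hcc⟩ := hFz.balance (z := z) (u := u) (by simp) (by simp [hu, hzu.symm])
      (by rw [e]; exact hFu)
    rw [e] at hcc
    exact ⟨c, by rw [sum_fs_ridge hz hu hzu hfs]; exact hcc⟩
  unfold cc
  rw [dif_pos h]
  exact h.choose_spec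

theorem Om_lin {R : Finset (Fin d → ℝ)} (hR : K.Fc R) (hc : R.card + 1 = d) (a : Fin d → ℝ) :
    K.Om R (fun v => a ⬝ᵥ v) = 0 := by
  have := congrArg (fun x => a ⬝ᵥ x) (cc_spec hR hc)
  simp only [dotProduct_sum, dotProduct_smul, smul_eq_mul] at this
  unfold Om
  rw [this, sub_self]

theorem Om_sub (R : Finset (Fin d → ℝ)) (φ ψ : (Fin d → ℝ) → ℝ) :
    K.Om R (fun v => φ v - ψ v) = K.Om R φ - K.Om R ψ := by
  unfold Om
  simp only [mul_sub, Finset.sum_sub_distrib]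
  ring

theorem Om_sub_lin {R : Finset (Fin d → ℝ)} (hR : K.Fc R) (hc : R.card + 1 = d)
    (φ : (Fin d → ℝ) → ℝ) (a : Fin d → ℝ) :
    K.Om R (fun v => φ v - a ⬝ᵥ v) = K.Om R φ := by
  rw [Om_sub, Om_lin hR hc, sub_zero]

/-- endpoints of the arc -/
def pq (ρ F : Finset (Fin d → ℝ)) : (Fin d → ℝ) × (Fin d → ℝ) :=
  if h : ∃ x : (Fin d → ℝ) × (Fin d → ℝ), x.1 ≠ x.2 ∧ F \ ρ = {x.1, x.2} then h.choose else (0, 0)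

def pp (ρ F : Finset (Fin d → ℝ)) : Fin d → ℝ := (pq ρ F).1
def qq (ρ F : Finset (Fin d → ℝ)) : Fin d → ℝ := (pq ρ F).2

theorem Facet.arc {ρ F : Finset (Fin d → ℝ)} (hF : K.Facet F) (h : ρ ⊆ F) (hc : ρ.card + 2 = d) :
    pp ρ F ≠ qq ρ F ∧ F \ ρ = {pp ρ F, qq ρ F} := by
  have hcard : (F \ ρ).card = 2 := by
    rw [Finset.card_sdiff_of_subset h, hF.2]; omega
  obtain ⟨x, y, hxy, he⟩ := Finset.card_eq_two.1 hcard
  have h : ∃ x : (Fin d → ℝ) × (Fin d → ℝ), x.1 ≠ x.2 ∧ F \ ρ = {x.1, x.2} := ⟨(x, y), hxy, he⟩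
  unfold pp qq pq
  rw [dif_pos h]
  exact h.choose_spec

theorem Om_om {ρ : Finset (Fin d → ℝ)} (hc : ρ.card + 2 = d) {u : Fin d → ℝ} (hu : u ∈ K.lk ρ)
    {w : (Fin d → ℝ) → ℝ} (hw : ∀ r ∈ ρ, w r = 0) :
    K.Om (insert u ρ) w = om (K.fs ρ) (pp ρ) (qq ρ) al (fun u => K.cc (insert u ρ) u) u w := by
  have huρ := (mem_lk.1 hu).1
  unfold Om om
  have h1 : ∑ r ∈ insert u ρ, K.cc (insert u ρ) r * w r = K.cc (insert u ρ) u * w u := by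
    rw [Finset.sum_insert huρ, Finset.sum_eq_zero (s := ρ) (fun r hr => by rw [hw r hr, mul_zero]),
      add_zero]
  rw [h1]
  congr 1
  have h2 : K.fs (insert u ρ) = (K.fs ρ).filter fun F => u ∈ F := by
    ext F
    simp only [mem_fs, Finset.mem_filter, Finset.insert_subset_iff]
    tauto
  rw [h2, Finset.sum_filter]
  refine Finset.sum_congr rfl fun F hF => ?_
  obtain ⟨hF1, hF2⟩ := mem_fs.1 hF
  obtain ⟨ha, hb⟩ := hF1.arc hF2 hc
  have h3 : F \ insert u ρ = ({pp ρ F, qq ρ F} : Finset (Fin d → ℝ)).erase u := by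
    rw [← hb]
    ext x
    simp only [Finset.mem_sdiff, Finset.mem_insert, Finset.mem_erase]
    tauto
  have hiff : u ∈ F ↔ pp ρ F = u ∨ qq ρ F = u := by
    have : u ∈ F ↔ u ∈ F \ ρ := by simp [huρ]
    rw [this, hb]
    simp [eq_comm]
  by_cases h4 : pp ρ F = u
  · have h5 : qq ρ F ≠ u := fun h => ha (h4.trans h.symm)
    rw [if_pos (hiff.2 (Or.inl h4)), h3, if_pos h4, if_neg h5, ← h4,
      Finset.erase_insert (by simpa using ha)]
    simp
  · by_cases h5 : qq ρ F = u
    · rw [if_pos (hiff.2 (Or.inr h5)), h3, if_neg h4, if_pos h5, ← h5, Finset.pair_comm,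
        Finset.erase_insert (by simpa using ha.symm)]
      simp
    · rw [if_neg (by rw [hiff]; tauto), if_neg h4, if_neg h5]
      simp

theorem pp_lk {ρ F : Finset (Fin d → ℝ)} (hc : ρ.card + 2 = d) (hF : F ∈ K.fs ρ) :
    pp ρ F ∈ K.lk ρ ∧ qq ρ F ∈ K.lk ρ ∧ pp ρ F ∈ F ∧ qq ρ F ∈ F := by
  obtain ⟨hF1, hF2⟩ := mem_fs.1 hF
  obtain ⟨ha, hb⟩ := hF1.arc hF2 hc
  have h1 : pp ρ F ∈ F \ ρ := by rw [hb]; simp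
  have h2 : qq ρ F ∈ F \ ρ := by rw [hb]; simp
  rw [Finset.mem_sdiff] at h1 h2
  refine ⟨mem_lk.2 ⟨h1.2, hF1.1.mono (Finset.insert_subset h1.1 hF2)⟩,
    mem_lk.2 ⟨h2.2, hF1.1.mono (Finset.insert_subset h2.1 hF2)⟩, h1.1, h2.1⟩

theorem planar_link {ρ : Finset (Fin d → ℝ)} (hρ : K.Fc ρ) (hc : ρ.card + 2 = d)
    {w : (Fin d → ℝ) → ℝ} (hw0 : ∀ r ∈ ρ, w r = 0) {A : Fin d → ℝ} (hA : ∀ r ∈ ρ, A ⬝ᵥ r = 1)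
    (h0 : ∑ u ∈ K.lk ρ, K.Om (insert u ρ) w * (1 - A ⬝ᵥ u) = 0) :
    ∑ u ∈ K.lk ρ, K.Om (insert u ρ) w * w u ≤ 0 ∧
      (∑ u ∈ K.lk ρ, K.Om (insert u ρ) w * w u = 0 →
        ∀ u ∈ K.lk ρ, K.Om (insert u ρ) w = 0) := by
  have hcard : ∀ u ∈ K.lk ρ, (insert u ρ).card + 1 = d := by
    intro u hu
    rw [Finset.card_insert_of_notMem (mem_lk.1 hu).1]; omega
  have hOm : ∀ u ∈ K.lk ρ, K.Om (insert u ρ) w =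
      om (K.fs ρ) (pp ρ) (qq ρ) al (fun u => K.cc (insert u ρ) u) u w :=
    fun u hu => Om_om hc hu hw0
  obtain ⟨F1, hF1, hρF1⟩ := hρ.exists_facet
  have hF1m : F1 ∈ K.fs ρ := mem_fs.2 ⟨hF1, hρF1⟩
  obtain ⟨hne1, hsd1⟩ := hF1.arc hρF1 hc
  obtain ⟨hpl, hql, hpF, hqF⟩ := pp_lk hc hF1m
  set p1 := pp ρ F1
  set q1 := qq ρ F1
  have hF1mem : ∀ v ∈ F1, v ∈ ρ ∨ v = p1 ∨ v = q1 := by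
    intro v hv
    by_cases h : v ∈ ρ
    · exact Or.inl h
    · right
      have : v ∈ F1 \ ρ := by simp [hv, h]
      rw [hsd1] at this
      simpa using this
  have hρp : ∀ r ∈ ρ, ev F1 p1 ⬝ᵥ r = 0 := fun r hr =>
    hF1.li.ev_ne (hρF1 hr) fun h => (mem_lk.1 hpl).1 (h ▸ hr)
  have hρq : ∀ r ∈ ρ, ev F1 q1 ⬝ᵥ r = 0 := fun r hr =>
    hF1.li.ev_ne (hρF1 hr) fun h => (mem_lk.1 hql).1 (h ▸ hr)
  obtain ⟨ε, hε0, _, hε⟩ := gen_eps (K.lk ρ) (fun u => ev F1 p1 ⬝ᵥ u) (fun u => ev F1 q1 ⬝ᵥ u) (by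
    intro u hu
    by_contra hcon
    push Not at hcon
    have hu' := mem_lk.1 hu
    -- u is a combination of ρ
    have hexp := hF1.li.expand hF1.2 u
    have hsub : u = ∑ v ∈ ρ, (ev F1 v ⬝ᵥ u) • v := by
      conv_lhs => rw [hexp]
      symm
      apply Finset.sum_subset hρF1
      intro v hv hvρ
      rcases hF1mem v hv with h | h | h
      · exact absurd h hvρ
      · rw [h, hcon.1, zero_smul]
      · rw [h, hcon.2, zero_smul]
    have := hu'.2.li (fun v => if v = u then 1 else -(ev F1 v ⬝ᵥ u)) (by
      rw [Finset.sum_insert hu'.1, if_pos rfl, one_smul,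
        Finset.sum_congr rfl (g := fun v => -((ev F1 v ⬝ᵥ u) • v))
          (fun v hv => by
            have hvu : v ≠ u := fun h => hu'.1 (h ▸ hv)
            rw [if_neg hvu, neg_smul]),
        Finset.sum_neg_distrib, ← hsub, add_neg_cancel]) u (by simp)
    simp at this) one_pos
  set Xv := ev F1 p1 + ε • ev F1 q1 with hXv
  set Yv := ev F1 q1 with hYv
  have hXρ : ∀ r ∈ ρ, Xv ⬝ᵥ r = 0 := by
    intro r hr
    simp [hXv, add_dotProduct, hρp r hr, hρq r hr]
  have hrep : ∀ a : Fin d → ℝ, (∀ r ∈ ρ, a ⬝ᵥ r = 0) →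
      a = (a ⬝ᵥ p1) • Xv + (a ⬝ᵥ q1 - ε * (a ⬝ᵥ p1)) • Yv := by
    intro a ha
    apply hF1.li.dual_ext hF1.2
    intro v hv
    rcases hF1mem v hv with h | h | h
    · rw [ha v h, add_dotProduct, smul_dotProduct, smul_dotProduct, hXρ v h, hρq v h]; simp
    · subst h
      simp [add_dotProduct, hXv, hYv, hF1.li.ev_self hpF, hF1.li.ev_ne hpF hne1]
    · subst h
      simp [add_dotProduct, hXv, hYv, hF1.li.ev_self hqF, hF1.li.ev_ne hqF hne1.symm]
      ring
  have hlinv : ∀ F ∈ K.fs ρ, ∃ x y : ℝ, nf F - A = x • Xv + y • Yv := by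
    intro F hF
    obtain ⟨hF1, hF2⟩ := mem_fs.1 hF
    exact ⟨_, _, hrep _ fun r hr => by
      rw [sub_dotProduct, hF1.nf_one (hF2 hr), hA r hr, sub_self]⟩
  choose! x y hxy using hlinv
  have hval : ∀ F ∈ K.fs ρ, ∀ u, x F * (Xv ⬝ᵥ u) + y F * (Yv ⬝ᵥ u) = nf F ⬝ᵥ u - A ⬝ᵥ u := by
    intro F hF u
    rw [← sub_dotProduct, hxy F hF]
    simp [add_dotProduct]
  have hX0 : ∀ u ∈ K.lk ρ, Xv ⬝ᵥ u ≠ 0 := by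
    intro u hu
    have := hε u hu
    simpa [hXv, add_dotProduct] using this
  have main := planar (I := K.fs ρ) (U := K.lk ρ) (p := pp ρ) (q := qq ρ) (α := al)
    (c := fun u => K.cc (insert u ρ) u) (fun F hF => (pp_lk hc hF).1)
    (fun F hF => (pp_lk hc hF).2.1) (X := fun u => Xv ⬝ᵥ u) (Y := fun u => Yv ⬝ᵥ u)
    (h := fun u => 1 - A ⬝ᵥ u) hX0
    (fun u hu => by
      rw [← Om_om hc hu hXρ]; exact Om_lin (mem_lk.1 hu).2 (hcard u hu) _)
    (fun u hu => by
      rw [← Om_om hc hu hρq]; exact Om_lin (mem_lk.1 hu).2 (hcard u hu) _)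
    (fun F hF => (mem_fs.1 hF).1.al_pos)
    (by
      intro F hF hdet
      obtain ⟨hFf, hFρ⟩ := mem_fs.1 hF
      obtain ⟨hl1, hl2, hm1, hm2⟩ := pp_lk hc hF
      have hz : (Yv ⬝ᵥ pp ρ F) • Xv - (Xv ⬝ᵥ pp ρ F) • Yv = 0 := by
        apply hFf.li.eq_zero hFf.2
        intro v hv
        simp only [sub_dotProduct, smul_dotProduct, smul_eq_mul]
        by_cases hvρ : v ∈ ρ
        · rw [hXρ v hvρ, hρq v hvρ]; ring
        · have : v ∈ F \ ρ := by simp [hv, hvρ]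
          rw [(hFf.arc hFρ hc).2] at this
          simp only [Finset.mem_insert, Finset.mem_singleton] at this
          rcases this with h | h
          · rw [h]; ring
          · rw [h]; linarith
      have z1 := congrArg (fun y => y ⬝ᵥ p1) hz
      have z2 := congrArg (fun y => y ⬝ᵥ q1) hz
      simp [sub_dotProduct, add_dotProduct, hXv, hYv, hF1.li.ev_self hpF,
        hF1.li.ev_ne hpF hne1] at z1
      simp only [sub_dotProduct, smul_dotProduct, hYv, hF1.li.ev_self hqF, z1] at z2
      simp at z2
      exact hX0 _ hl1 z2)
    (x := x) (y := y)
    (fun F hF => by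
      rw [hval F hF, (mem_fs.1 hF).1.nf_one (pp_lk hc hF).2.2.1])
    (fun F hF => by
      rw [hval F hF, (mem_fs.1 hF).1.nf_one (pp_lk hc hF).2.2.2])
    (by
      intro F hF u hu h1 h2
      rw [hval F hF]
      have hu' := mem_lk.1 hu
      obtain ⟨hFf, hFρ⟩ := mem_fs.1 hF
      have hn : u ∉ F := by
        intro h
        have : u ∈ F \ ρ := by simp [h, hu'.1]
        rw [(hFf.arc hFρ hc).2] at this
        simp only [Finset.mem_insert, Finset.mem_singleton] at this
        tauto
      have := hFf.nf_lt (hu'.2.1 (by simp)) hn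
      linarith)
    (by
      intro F hF G hG hne
      obtain ⟨hFf, hFρ⟩ := mem_fs.1 hF
      obtain ⟨hGf, hGρ⟩ := mem_fs.1 hG
      obtain ⟨u, huF, huG⟩ : ∃ u ∈ F, u ∉ G := by
        by_contra hcon
        push Not at hcon
        exact hne (hFf.eq_of_sub hGf.1 hcon)
      refine ⟨u, ?_, fun h => huG (h ▸ (pp_lk hc hG).2.2.1), fun h => huG (h ▸ (pp_lk hc hG).2.2.2)⟩
      have : u ∈ F \ ρ := Finset.mem_sdiff.2 ⟨huF, fun h => huG (hGρ h)⟩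
      rw [(hFf.arc hFρ hc).2] at this
      simpa using this)
    (by
      intro u hu
      have hu' := mem_lk.1 hu
      obtain ⟨F, hF, hs⟩ := hu'.2.exists_facet
      refine ⟨F, mem_fs.2 ⟨hF, (Finset.subset_insert _ _).trans hs⟩, ?_⟩
      have : u ∈ F \ ρ := by simp [hs (Finset.mem_insert_self u ρ), hu'.1]
      rw [(hF.arc ((Finset.subset_insert _ _).trans hs) hc).2] at this
      simpa [eq_comm] using this)
    (by
      intro u hu G hG
      have hu' := mem_lk.1 hu
      obtain ⟨z, z', hz, hz', hzz, hFz, hFz', _⟩ := ridge hu'.2 (hcard u hu)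
      have hgood : ∀ F, K.Facet F → insert u ρ ⊆ F → F ∈ K.fs ρ ∧ (pp ρ F = u ∨ qq ρ F = u) := by
        intro F hF hs
        have hs' := (Finset.subset_insert u ρ).trans hs
        refine ⟨mem_fs.2 ⟨hF, hs'⟩, ?_⟩
        have : u ∈ F \ ρ := by simp [hs (Finset.mem_insert_self u ρ), hu'.1]
        rw [(hF.arc hs' hc).2] at this
        simpa [eq_comm] using this
      by_cases h : insert z (insert u ρ) = G
      · refine ⟨_, (hgood _ hFz' (Finset.subset_insert _ _)).1, ?_,
          (hgood _ hFz' (Finset.subset_insert _ _)).2⟩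
        rw [← h]
        intro h2
        have : z ∈ insert z' (insert u ρ) := by rw [h2]; simp
        rcases Finset.mem_insert.1 this with h3 | h3
        · exact hzz h3
        · exact hz h3
      · exact ⟨_, (hgood _ hFz (Finset.subset_insert _ _)).1, h,
          (hgood _ hFz (Finset.subset_insert _ _)).2⟩)
    (w := w) (by
      rw [← h0]
      exact Finset.sum_congr rfl fun u hu => by rw [hOm u hu])
  rw [Finset.sum_congr rfl fun u hu => by rw [hOm u hu]]
  refine ⟨main.1, fun h u hu => ?_⟩
  rw [hOm u hu]
  exact main.2 h u hu

end CSP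

/-- skew maps from their values on a basis -/
theorem LI.skew {d : ℕ} {F : Finset (Fin d → ℝ)} (h : LI F) (hc : F.card = d)
    (k : (Fin d → ℝ) → (Fin d → ℝ)) (hk : ∀ p ∈ F, ∀ q ∈ F, q ⬝ᵥ k p + p ⬝ᵥ k q = 0) :
    ∃ S : (Fin d → ℝ) →ₗ[ℝ] (Fin d → ℝ), (∀ p ∈ F, S p = k p) ∧ ∀ x y, x ⬝ᵥ S y + y ⬝ᵥ S x = 0 := by
  obtain ⟨S, hS⟩ := h.exists_map k
  refine ⟨S, hS, fun x y => ?_⟩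
  have hex : ∀ x y : Fin d → ℝ, x ⬝ᵥ S y =
      ∑ p ∈ F, ∑ q ∈ F, (ev F p ⬝ᵥ x) * (ev F q ⬝ᵥ y) * (p ⬝ᵥ k q) := by
    intro x y
    conv_lhs => rw [h.expand hc x, h.expand hc y]
    rw [map_sum, sum_dotProduct]
    refine Finset.sum_congr rfl fun p hp => ?_
    rw [dotProduct_sum]
    refine Finset.sum_congr rfl fun q hq => ?_
    rw [map_smul, hS q hq, smul_dotProduct, dotProduct_smul, smul_eq_mul, smul_eq_mul]
    ring
  rw [hex x y, hex y x, Finset.sum_comm (s := F) (t := F), ← Finset.sum_add_distrib]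
  apply Finset.sum_eq_zero
  intro p hp
  rw [← Finset.sum_add_distrib]
  apply Finset.sum_eq_zero
  intro q hq
  have := hk p hp q hq
  have e : ev F q ⬝ᵥ x * ev F p ⬝ᵥ y * q ⬝ᵥ k p + ev F p ⬝ᵥ y * ev F q ⬝ᵥ x * p ⬝ᵥ k q =
    ev F q ⬝ᵥ x * ev F p ⬝ᵥ y * (q ⬝ᵥ k p + p ⬝ᵥ k q) := by ring
  rw [e, this, mul_zero]

/-- violation of an edge -/
def viol {d : ℕ} (m : (Fin d → ℝ) → (Fin d → ℝ)) (p q : Fin d → ℝ) : ℝ :=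
  (p - q) ⬝ᵥ (m p - m q)

theorem viol_exp {d : ℕ} (m : (Fin d → ℝ) → (Fin d → ℝ)) (p q : Fin d → ℝ) :
    viol m p q = p ⬝ᵥ m p + q ⬝ᵥ m q - p ⬝ᵥ m q - q ⬝ᵥ m p := by
  unfold viol
  rw [sub_dotProduct, dotProduct_sub, dotProduct_sub]; ring

theorem viol_comm {d : ℕ} (m : (Fin d → ℝ) → (Fin d → ℝ)) (p q : Fin d → ℝ) :
    viol m p q = viol m q p := by
  rw [viol_exp, viol_exp]; ring

theorem viol_self {d : ℕ} (m : (Fin d → ℝ) → (Fin d → ℝ)) (p : Fin d → ℝ) :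
    viol m p p = 0 := by simp [viol]

namespace CSP
variable {d : ℕ} {K : CSP d}

theorem Facet.trivial_on {F : Finset (Fin d → ℝ)} (hF : K.Facet F)
    {m : (Fin d → ℝ) → (Fin d → ℝ)} (hm : ∀ p ∈ F, ∀ q ∈ F, viol m p q = 0) :
    ∃ (B : Fin d → ℝ) (S : (Fin d → ℝ) →ₗ[ℝ] (Fin d → ℝ)),
      (∀ x y, x ⬝ᵥ S y + y ⬝ᵥ S x = 0) ∧ ∀ p ∈ F, m p = B + S p := by
  obtain ⟨B, hB⟩ := hF.li.exists_dual (fun v => v ⬝ᵥ m v)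
  obtain ⟨S, h1, h2⟩ := hF.li.skew hF.2 (fun v => m v - B) (by
    intro p hp q hq
    have e := hm p hp q hq
    rw [viol_exp] at e
    have e1 := hB p hp
    have e2 := hB q hq
    rw [dotProduct_comm] at e1 e2
    rw [dotProduct_sub, dotProduct_sub]
    linarith)
  exact ⟨B, S, h2, fun p hp => by rw [h1 p hp]; abel⟩

theorem mixed {ρ : Finset (Fin d → ℝ)} (hρ : K.Fc ρ) (hc : ρ.card + 2 = d)
    {m : (Fin d → ℝ) → (Fin d → ℝ)}
    (hm : ∀ p q, K.Fc (insert p (insert q ρ)) → viol m p q = 0)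
    {A : Fin d → ℝ} (hA : ∀ r ∈ ρ, A ⬝ᵥ r = 1) :
    ∑ u ∈ K.lk ρ, K.Om (insert u ρ) (fun v => v ⬝ᵥ m v) * (1 - A ⬝ᵥ u) = 0 := by
  have hcard : ∀ u ∈ K.lk ρ, (insert u ρ).card + 1 = d := by
    intro u hu
    rw [Finset.card_insert_of_notMem (mem_lk.1 hu).1]; omega
  obtain ⟨F, hF, hρF⟩ := hρ.exists_facet
  obtain ⟨B, S, hS, hBS⟩ := hF.trivial_on (m := m) (by
    intro p hp q hq
    exact hm p q (hF.1.mono (Finset.insert_subset hp (Finset.insert_subset hq hρF))))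
  set w : (Fin d → ℝ) → ℝ := fun v => v ⬝ᵥ m v - B ⬝ᵥ v with hwdef
  have hSS : ∀ x, x ⬝ᵥ S x = 0 := fun x => by linarith [hS x x]
  have hwF : ∀ v ∈ F, w v = 0 := by
    intro v hv
    simp only [hwdef, hBS v hv, dotProduct_add, hSS, dotProduct_comm B v]; ring
  set g : (Fin d → ℝ) → (Fin d → ℝ) := fun v => m v - B - w v • A - S v with hg
  have hgF : ∀ v ∈ F, g v = 0 := by
    intro v hv
    simp only [hg, hwF v hv, hBS v hv, zero_smul]
    abel
  have hgu : ∀ u, u ⬝ᵥ g u = w u * (1 - A ⬝ᵥ u) := by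
    intro u
    simp only [hg, dotProduct_sub, dotProduct_smul, hSS, smul_eq_mul, hwdef, dotProduct_comm B u,
      dotProduct_comm A u]
    ring
  have hgpq : ∀ p q, viol m p q = 0 →
      p ⬝ᵥ g q + q ⬝ᵥ g p = w p * (1 - A ⬝ᵥ q) + w q * (1 - A ⬝ᵥ p) := by
    intro p q h
    rw [viol_exp] at h
    have h2 := hS p q
    simp only [hg, dotProduct_sub, dotProduct_smul, smul_eq_mul, hwdef, dotProduct_comm B,
      dotProduct_comm A]
    linarith
  have hw0 : ∀ r ∈ ρ, w r = 0 := fun r hr => hwF r (hρF hr)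
  have e1 : ∑ u ∈ K.lk ρ, K.Om (insert u ρ) (fun v => v ⬝ᵥ m v) * (1 - A ⬝ᵥ u) =
      ∑ u ∈ K.lk ρ, om (K.fs ρ) (pp ρ) (qq ρ) al (fun u => K.cc (insert u ρ) u) u w
        * (1 - A ⬝ᵥ u) := by
    refine Finset.sum_congr rfl fun u hu => ?_
    rw [← Om_om hc hu hw0, hwdef, Om_sub_lin (mem_lk.1 hu).2 (hcard u hu)]
  have hpp : ∀ F ∈ K.fs ρ, pp ρ F ∈ K.lk ρ := fun F hF => (pp_lk hc hF).1
  have hqq : ∀ F ∈ K.fs ρ, qq ρ F ∈ K.lk ρ := fun F hF => (pp_lk hc hF).2.1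
  rw [e1, om_bilin _ _ _ _ _ _ hpp hqq]
  have hcoord : ∀ i : Fin d, ∀ u ∈ K.lk ρ,
      om (K.fs ρ) (pp ρ) (qq ρ) al (fun u => K.cc (insert u ρ) u) u
        (fun v => if v ∈ ρ then 0 else v i) = ∑ r ∈ ρ, K.cc (insert u ρ) r * r i := by
    intro i u hu
    have hu' := mem_lk.1 hu
    rw [← Om_om hc hu (fun r hr => by simp [hr])]
    have hlin := Om_lin hu'.2 (hcard u hu) (Pi.single i 1)
    simp only [single_one_dotProduct] at hlin
    unfold Om at hlin ⊢
    rw [Finset.sum_insert hu'.1] at hlin ⊢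
    beta_reduce at hlin ⊢
    have h1 : ∑ F ∈ K.fs (insert u ρ), ∑ z ∈ F \ insert u ρ, al F * (if z ∈ ρ then 0 else z i) =
        ∑ F ∈ K.fs (insert u ρ), ∑ z ∈ F \ insert u ρ, al F * z i := by
      refine Finset.sum_congr rfl fun F _ => Finset.sum_congr rfl fun z hz => ?_
      rw [if_neg]
      intro h
      exact (Finset.mem_sdiff.1 hz).2 (Finset.mem_insert_of_mem h)
    rw [h1, if_neg hu'.1, Finset.sum_eq_zero (s := ρ) (fun r hr => by rw [if_pos hr, mul_zero])]
    linarith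
  have hzero : ∑ u ∈ K.lk ρ, ∑ r ∈ ρ, K.cc (insert u ρ) r * (r ⬝ᵥ g u) = 0 := by
    apply Finset.sum_eq_zero
    intro u hu
    apply Finset.sum_eq_zero
    intro r hr
    have hu' := mem_lk.1 hu
    have h1 := hgpq r u (hm r u (by
      rw [Finset.insert_eq_of_mem (Finset.mem_insert_of_mem hr)]; exact hu'.2))
    rw [hgF r (hρF hr), dotProduct_zero, add_zero, hw0 r hr, hA r hr] at h1
    rw [h1]; ring
  have e2 : ∑ u ∈ K.lk ρ, ∑ r ∈ ρ, K.cc (insert u ρ) r * (r ⬝ᵥ g u) =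
      ∑ i : Fin d, ∑ u ∈ K.lk ρ, om (K.fs ρ) (pp ρ) (qq ρ) al (fun u => K.cc (insert u ρ) u) u
        (fun v => if v ∈ ρ then 0 else v i) * g u i := by
    rw [Finset.sum_comm (s := Finset.univ)]
    refine Finset.sum_congr rfl fun u hu => ?_
    simp only [hcoord _ u hu]
    simp only [Finset.sum_mul, dotProduct, Finset.mul_sum]
    rw [Finset.sum_comm]
    exact Finset.sum_congr rfl fun i _ => Finset.sum_congr rfl fun r _ => by ring
  rw [e2, Finset.sum_congr rfl (fun i _ => om_bilin _ _ _ _ _ _ hpp hqq _ _),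
    Finset.sum_sub_distrib, Finset.sum_comm, Finset.sum_comm (s := Finset.univ)] at hzero
  rw [← hzero]
  congr 1
  · refine Finset.sum_congr rfl fun F hF => ?_
    rw [← Finset.mul_sum]
    congr 1
    have n1 := (mem_lk.1 (hpp F hF)).1
    have n2 := (mem_lk.1 (hqq F hF)).1
    obtain ⟨hFf, hFρ⟩ := mem_fs.1 hF
    have h3 := hgpq (pp ρ F) (qq ρ F) (hm _ _ (hFf.1.mono (Finset.insert_subset
      (pp_lk hc hF).2.2.1 (Finset.insert_subset (pp_lk hc hF).2.2.2 hFρ))))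
    simp only [if_neg n1, if_neg n2, Finset.sum_add_distrib]
    simp only [dotProduct] at h3 ⊢
    linarith
  · refine Finset.sum_congr rfl fun u hu => ?_
    rw [← Finset.mul_sum]
    congr 1
    simp only [if_neg (mem_lk.1 hu).1]
    exact (hgu u).symm

theorem local_rigid {τ : Finset (Fin d → ℝ)} (hτ : K.Fc τ) (hc : τ.card + 3 = d)
    {m : (Fin d → ℝ) → (Fin d → ℝ)}
    (hm : ∀ p q, K.Fc (insert p (insert q τ)) → viol m p q = 0)
    {u v : Fin d → ℝ} (hv : v ∈ K.lk τ) (hu : u ∈ K.lk (insert v τ)) :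
    K.Om (insert u (insert v τ)) (fun v => v ⬝ᵥ m v) = 0 := by
  set f : (Fin d → ℝ) → ℝ := fun v => v ⬝ᵥ m v with hf
  have hcard : ∀ v ∈ K.lk τ, (insert v τ).card + 2 = d := by
    intro v hv
    rw [Finset.card_insert_of_notMem (mem_lk.1 hv).1]; omega
  have hcard2 : ∀ v ∈ K.lk τ, ∀ u ∈ K.lk (insert v τ), (insert u (insert v τ)).card + 1 = d := by
    intro v hv u hu
    rw [Finset.card_insert_of_notMem (mem_lk.1 hu).1]; have := hcard v hv; omega
  -- a facet containing τ but not v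
  obtain ⟨F0, hF0, hτF0, hvF0⟩ : ∃ F0, K.Facet F0 ∧ τ ⊆ F0 ∧ v ∉ F0 := by
    obtain ⟨F, hF, hs⟩ := (mem_lk.1 hv).2.exists_facet
    have hvF : v ∈ F := hs (Finset.mem_insert_self v τ)
    obtain ⟨x, _, hxF, hx⟩ := hF.exists_flip hvF
    refine ⟨_, hx, ?_, ?_⟩
    · intro t ht
      refine Finset.mem_insert_of_mem (Finset.mem_erase.2 ⟨?_, hs (Finset.mem_insert_of_mem ht)⟩)
      rintro rfl
      exact (mem_lk.1 hv).1 ht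
    · intro h
      rcases Finset.mem_insert.1 h with h | h
      · exact hxF (h ▸ hvF)
      · exact (Finset.mem_erase.1 h).1 rfl
  obtain ⟨b0, hb0⟩ := hτ.li.exists_dual f
  set fh : (Fin d → ℝ) → ℝ := fun v => f v - b0 ⬝ᵥ v with hfh
  set l : (Fin d → ℝ) → ℝ := fun v => 1 - nf F0 ⬝ᵥ v with hl
  set β : (Fin d → ℝ) → (Fin d → ℝ) := fun v => ev (insert v τ) v with hβ
  have hβv : ∀ v ∈ K.lk τ, β v ⬝ᵥ v = 1 := fun v hv =>
    (mem_lk.1 hv).2.li.ev_self (Finset.mem_insert_self v τ)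
  have hβt : ∀ v ∈ K.lk τ, ∀ t ∈ τ, β v ⬝ᵥ t = 0 := fun v hv t ht =>
    (mem_lk.1 hv).2.li.ev_ne (Finset.mem_insert_of_mem ht) (by
      rintro rfl; exact (mem_lk.1 hv).1 ht)
  set Q : (Fin d → ℝ) → (Fin d → ℝ) → ℝ := fun v u => K.Om (insert u (insert v τ)) f with hQ
  have hmix : ∀ v ∈ K.lk τ, ∑ u ∈ K.lk (insert v τ), Q v u * (l u - l v * (β v ⬝ᵥ u)) = 0 := by
    intro v hv
    have := mixed (mem_lk.1 hv).2 (hcard v hv) (m := m) (by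
      intro p q h
      exact hm p q (h.mono (Finset.insert_subset_insert _ (Finset.insert_subset_insert _
        (Finset.subset_insert _ _))))) (A := nf F0 + l v • β v) (by
      intro r hr
      rw [add_dotProduct, smul_dotProduct, smul_eq_mul]
      rcases Finset.mem_insert.1 hr with rfl | hr
      · rw [hβv r hv]; simp only [hl]; ring
      · rw [hβt v hv r hr, hF0.nf_one (hτF0 hr)]; ring)
    rw [← this]
    refine Finset.sum_congr rfl fun u _ => ?_
    rw [add_dotProduct, smul_dotProduct, smul_eq_mul]
    simp only [hQ, hl]
    ring
  have hplan : ∀ v ∈ K.lk τ, ∑ u ∈ K.lk (insert v τ), Q v u * (fh u - fh v * (β v ⬝ᵥ u)) ≤ 0 ∧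
      (∑ u ∈ K.lk (insert v τ), Q v u * (fh u - fh v * (β v ⬝ᵥ u)) = 0 →
        ∀ u ∈ K.lk (insert v τ), Q v u = 0) := by
    intro v hv
    set b := b0 + fh v • β v with hb
    have hOmw : ∀ u ∈ K.lk (insert v τ),
        K.Om (insert u (insert v τ)) (fun x => f x - b ⬝ᵥ x) = Q v u :=
      fun u hu => Om_sub_lin (mem_lk.1 hu).2 (hcard2 v hv u hu) _ _
    have hwx : ∀ x, f x - b ⬝ᵥ x = fh x - fh v * (β v ⬝ᵥ x) := by
      intro x
      rw [hb, add_dotProduct, smul_dotProduct, smul_eq_mul]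
      simp only [hfh]; ring
    have := planar_link (mem_lk.1 hv).2 (hcard v hv) (w := fun x => f x - b ⬝ᵥ x) (by
      intro r hr
      rw [hwx]
      rcases Finset.mem_insert.1 hr with rfl | hr
      · rw [hβv r hv]; ring
      · rw [hβt v hv r hr]; simp only [hfh, hb0 r hr]; ring)
      (A := nf F0 + l v • β v) (by
      intro r hr
      rw [add_dotProduct, smul_dotProduct, smul_eq_mul]
      rcases Finset.mem_insert.1 hr with rfl | hr
      · rw [hβv r hv]; simp only [hl]; ring
      · rw [hβt v hv r hr, hF0.nf_one (hτF0 hr)]; ring) (by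
      rw [← hmix v hv]
      refine Finset.sum_congr rfl fun u hu => ?_
      rw [hOmw u hu, add_dotProduct, smul_dotProduct, smul_eq_mul]
      simp only [hl]
      ring)
    rw [Finset.sum_congr rfl (fun u hu => by rw [hOmw u hu, hwx u])] at this
    refine ⟨this.1, fun h u hu => ?_⟩
    rw [← hOmw u hu]
    exact this.2 h u hu
  have hanti : ∑ v ∈ K.lk τ, ∑ u ∈ K.lk (insert v τ), Q v u * (l v * fh u - fh v * l u) = 0 := by
    have hfil : ∀ v ∈ K.lk τ, K.lk (insert v τ) =
        (K.lk τ).filter fun u => u ≠ v ∧ K.Fc (insert u (insert v τ)) := by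
      intro v hv
      ext u
      simp only [Finset.mem_filter, mem_lk, Finset.mem_insert, not_or]
      constructor
      · rintro ⟨⟨h1, h2⟩, h3⟩
        exact ⟨⟨h2, h3.mono (Finset.insert_subset_insert _ (Finset.subset_insert _ _))⟩, h1, h3⟩
      · rintro ⟨⟨h1, _⟩, h2, h3⟩
        exact ⟨⟨h2, h1⟩, h3⟩
    rw [Finset.sum_congr rfl (fun v hv => by rw [hfil v hv, Finset.sum_filter])]
    set T := ∑ v ∈ K.lk τ, ∑ u ∈ K.lk τ,
      (if u ≠ v ∧ K.Fc (insert u (insert v τ)) then Q v u * (l v * fh u - fh v * l u) else 0) with hT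
    have : T = - T := by
      conv_lhs => rw [hT, Finset.sum_comm]
      rw [hT, ← Finset.sum_neg_distrib]
      refine Finset.sum_congr rfl fun v _ => ?_
      rw [← Finset.sum_neg_distrib]
      refine Finset.sum_congr rfl fun u _ => ?_
      simp only [hQ]
      rw [Finset.insert_comm v u τ]
      by_cases h : u ≠ v ∧ K.Fc (insert u (insert v τ))
      · rw [if_pos h, if_pos ⟨h.1.symm, h.2⟩]; ring
      · rw [if_neg h, if_neg (fun h' => h ⟨h'.1.symm, h'.2⟩)]; ring
    linarith
  have hsum : ∑ v ∈ K.lk τ, l v * ∑ u ∈ K.lk (insert v τ), Q v u * (fh u - fh v * (β v ⬝ᵥ u)) = 0 := by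
    have : ∀ v ∈ K.lk τ, l v * ∑ u ∈ K.lk (insert v τ), Q v u * (fh u - fh v * (β v ⬝ᵥ u)) =
        ∑ u ∈ K.lk (insert v τ), Q v u * (l v * fh u - fh v * l u) := by
      intro v hv
      have h1 := hmix v hv
      have h2 : l v * ∑ u ∈ K.lk (insert v τ), Q v u * (fh u - fh v * (β v ⬝ᵥ u)) -
        fh v * ∑ u ∈ K.lk (insert v τ), Q v u * (l u - l v * (β v ⬝ᵥ u)) =
        ∑ u ∈ K.lk (insert v τ), Q v u * (l v * fh u - fh v * l u) := by
        rw [Finset.mul_sum, Finset.mul_sum, ← Finset.sum_sub_distrib]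
        exact Finset.sum_congr rfl fun u _ => by ring
      rw [h1, mul_zero, sub_zero] at h2
      exact h2
    rw [Finset.sum_congr rfl this, hanti]
  have hl0 : ∀ v ∈ K.lk τ, 0 ≤ l v := fun v hv => by
    simp only [hl]
    linarith [hF0.pol v ((mem_lk.1 hv).2.1 (Finset.mem_insert_self v τ))]
  rw [Finset.sum_eq_zero_iff_of_nonpos
    (fun v hv => mul_nonpos_of_nonneg_of_nonpos (hl0 v hv) (hplan v hv).1)] at hsum
  have hlv : 0 < l v := by
    simp only [hl]
    linarith [hF0.nf_lt ((mem_lk.1 hv).2.1 (Finset.mem_insert_self v τ)) hvF0]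
  have h1 := hsum v hv
  rcases mul_eq_zero.1 h1 with h2 | h2
  · exact absurd h2 hlv.ne'
  · exact (hplan v hv).2 h2 u hu

end CSP

namespace CSP
variable {d : ℕ} {K : CSP d}

/-- skew maps -/
def Skw {d : ℕ} (S : (Fin d → ℝ) →ₗ[ℝ] (Fin d → ℝ)) : Prop := ∀ x y, x ⬝ᵥ S y + y ⬝ᵥ S x = 0

theorem Skw.self {S : (Fin d → ℝ) →ₗ[ℝ] (Fin d → ℝ)} (h : Skw S) (x : Fin d → ℝ) :
    x ⬝ᵥ S x = 0 := by linarith [h x x]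

theorem Skw.viol {S : (Fin d → ℝ) →ₗ[ℝ] (Fin d → ℝ)} (h : Skw S) {B : Fin d → ℝ}
    {m : (Fin d → ℝ) → (Fin d → ℝ)} {p q : Fin d → ℝ} (hp : m p = B + S p) (hq : m q = B + S q) :
    viol m p q = 0 := by
  unfold _root_.viol
  rw [hp, hq]
  have : B + S p - (B + S q) = S (p - q) := by rw [map_sub]; abel
  rw [this]; exact h.self _

theorem propagate {F τ : Finset (Fin d → ℝ)} {z u : Fin d → ℝ} (hF : K.Facet F) (hz : z ∈ F)
    (hu : u ∉ F) (hG : K.Facet (insert u (F.erase z))) (hτ : τ ⊆ F.erase z) (hc : τ.card + 3 = d)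
    {m : (Fin d → ℝ) → (Fin d → ℝ)}
    (hm : ∀ p q, K.Fc (insert p (insert q τ)) → viol m p q = 0)
    {B : Fin d → ℝ} {S : (Fin d → ℝ) →ₗ[ℝ] (Fin d → ℝ)} (hS : Skw S)
    (hFm : ∀ p ∈ F, m p = B + S p) : ∀ p ∈ insert u (F.erase z), m p = B + S p := by
  set R := F.erase z with hR
  have hzR : z ∉ R := by simp [hR]
  have huR : u ∉ R := fun h => hu (Finset.mem_of_mem_erase h)
  have hzu : z ≠ u := by rintro rfl; exact hu hz
  have hRc : R.card + 1 = d := by rw [hR, Finset.card_erase_add_one hz, hF.2]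
  have hRf : K.Fc R := hF.1.mono (Finset.erase_subset _ _)
  have hFR : insert z R = F := Finset.insert_erase hz
  obtain ⟨a, b, hab, hRe⟩ : ∃ a b, a ≠ b ∧ R \ τ = {a, b} := by
    apply Finset.card_eq_two.1
    rw [Finset.card_sdiff_of_subset hτ]; omega
  have ha : a ∈ R \ τ := by rw [hRe]; simp
  have hb : b ∈ R \ τ := by rw [hRe]; simp
  rw [Finset.mem_sdiff] at ha hb
  have hReq : insert a (insert b τ) = R := by
    rw [← Finset.sdiff_union_of_subset hτ, hRe]
    ext x; simp
  have hOm : K.Om R (fun v => v ⬝ᵥ m v) = 0 := by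
    rw [← hReq]
    refine local_rigid (hRf.mono hτ) hc hm (mem_lk.2 ⟨hb.2, hRf.mono ?_⟩) (mem_lk.2 ⟨?_, ?_⟩)
    · exact Finset.insert_subset hb.1 hτ
    · simp [hab, ha.2]
    · rw [hReq]; exact hRf
  have hwF : ∀ v ∈ F, v ⬝ᵥ m v - B ⬝ᵥ v = 0 := by
    intro v hv
    rw [hFm v hv, dotProduct_add, hS.self, dotProduct_comm B v]; ring
  rw [← Om_sub_lin hRf hRc _ B] at hOm
  have hfs : K.fs R = {insert z R, insert u R} := by
    obtain ⟨z', u', hz', hu', hzu', hFz, hFu, hfs⟩ := ridge hRf hRc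
    have h1 : insert z R ∈ K.fs R := mem_fs.2 ⟨by rw [hFR]; exact hF, Finset.subset_insert _ _⟩
    have h2 : insert u R ∈ K.fs R := mem_fs.2 ⟨hG, Finset.subset_insert _ _⟩
    have hne : insert z R ≠ insert u R := by
      intro h
      have : u ∈ insert z R := h ▸ Finset.mem_insert_self u R
      rw [hFR] at this; exact hu this
    symm
    apply Finset.eq_of_subset_of_card_le
    · intro x hx
      simp only [Finset.mem_insert, Finset.mem_singleton] at hx
      rcases hx with rfl | rfl <;> assumption
    · rw [Finset.card_pair hne, hfs]; exact Finset.card_le_two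
  unfold Om at hOm
  rw [sum_fs_ridge hzR huR hzu hfs] at hOm
  beta_reduce at hOm
  rw [hwF z hz, Finset.sum_eq_zero (s := R) (fun r hr => by
    rw [hwF r (Finset.mem_of_mem_erase hr), mul_zero])] at hOm
  have hwu : u ⬝ᵥ m u - B ⬝ᵥ u = 0 := by
    have h1 : al (insert u R) * (u ⬝ᵥ m u - B ⬝ᵥ u) = 0 := by linarith
    exact (mul_eq_zero.1 h1).resolve_left hG.al_pos.ne'
  have hk : m u - B - S u = 0 := by
    apply hG.li.eq_zero hG.2
    intro v hv
    rw [dotProduct_comm]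
    rcases Finset.mem_insert.1 hv with rfl | hr
    · rw [dotProduct_sub, dotProduct_sub, hS.self, dotProduct_comm v B]; linarith
    · have h1 := hm u v (hG.1.mono (Finset.insert_subset_insert _ (Finset.insert_subset hr hτ)))
      have h2 := hwF v (Finset.mem_of_mem_erase hr)
      rw [viol_exp] at h1
      have h3 := hS u v
      have h4 : u ⬝ᵥ m v = u ⬝ᵥ B + u ⬝ᵥ S v := by
        rw [hFm v (Finset.mem_of_mem_erase hr), dotProduct_add]
      rw [dotProduct_sub, dotProduct_sub]
      rw [dotProduct_comm B] at h2 hwu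
      linarith
  intro p hp
  rcases Finset.mem_insert.1 hp with rfl | hr
  · rw [sub_sub, sub_eq_zero] at hk; exact hk
  · exact hFm p (Finset.mem_of_mem_erase hr)

theorem star_rigid {τ : Finset (Fin d → ℝ)} (hτ : K.Fc τ) (hc : τ.card + 3 ≤ d)
    {m : (Fin d → ℝ) → (Fin d → ℝ)}
    (hm : ∀ p q, K.Fc (insert p (insert q τ)) → viol m p q = 0) :
    ∃ (B : Fin d → ℝ) (S : (Fin d → ℝ) →ₗ[ℝ] (Fin d → ℝ)), Skw S ∧
      ∀ u, K.Fc (insert u τ) → m u = B + S u := by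
  obtain ⟨F, hF, hτF⟩ := hτ.exists_facet
  obtain ⟨B, S, hS, hBS⟩ := hF.trivial_on (m := m) (by
    intro p hp q hq
    exact hm p q (hF.1.mono (Finset.insert_subset hp (Finset.insert_subset hq hτF))))
  have h0 : ∀ F, K.Facet F → (0 : Fin d → ℝ) ∉ F := fun F hF h => zero_notMem (hF.sub h)
  refine ⟨B, S, hS, fun u hu => ?_⟩
  obtain ⟨G, hG, huG⟩ := hu.exists_facet
  refine connect (τ := τ) 0 (fun G => ∀ p ∈ G, m p = B + S p) ?_ hF hτF (h0 F hF) hG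
    ((Finset.subset_insert _ _).trans huG) (h0 G hG) hBS u (huG (Finset.mem_insert_self _ _))
  intro F z u hF hτF _ hz hzτ hu _ hG hFm
  have hsub : τ ⊆ F.erase z := fun t ht => Finset.mem_erase.2 ⟨by rintro rfl; exact hzτ ht, hτF ht⟩
  obtain ⟨τ', h1, h2, h3⟩ := Finset.exists_subsuperset_card_eq (n := d - 3) hsub (by omega) (by
    rw [Finset.card_erase_of_mem hz, hF.2]; omega)
  refine propagate hF hz hu hG h2 (by omega) ?_ hS hFm
  intro p q h
  exact hm p q (h.mono (Finset.insert_subset_insert _ (Finset.insert_subset_insert _ h1)))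

end CSP

def ngF {d : ℕ} (e : Finset (Fin d → ℝ)) : Finset (Fin d → ℝ) := e.image fun x => -x

theorem ngF_ngF {d : ℕ} (e : Finset (Fin d → ℝ)) : ngF (ngF e) = e := by
  unfold ngF; rw [Finset.image_image]; simp

theorem mem_ngF {d : ℕ} {e : Finset (Fin d → ℝ)} {x : Fin d → ℝ} : x ∈ ngF e ↔ -x ∈ e := by
  unfold ngF
  constructor
  · intro h
    obtain ⟨y, hy, rfl⟩ := Finset.mem_image.1 h
    simpa using hy
  · intro h
    exact Finset.mem_image.2 ⟨-x, h, by simp⟩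

theorem ngF_pair {d : ℕ} (p q : Fin d → ℝ) : ngF {p, q} = {-p, -q} := by
  unfold ngF; simp [Finset.image_insert]

theorem card_ngF {d : ℕ} (e : Finset (Fin d → ℝ)) : (ngF e).card = e.card :=
  Finset.card_image_of_injective _ neg_injective

/-- violation as a function of the edge -/
def vE {d : ℕ} (m : (Fin d → ℝ) → (Fin d → ℝ)) (e : Finset (Fin d → ℝ)) : ℝ :=
  2 * ∑ p ∈ e, p ⬝ᵥ m p - (∑ p ∈ e, p) ⬝ᵥ (∑ p ∈ e, m p)

theorem vE_pair {d : ℕ} (m : (Fin d → ℝ) → (Fin d → ℝ)) {p q : Fin d → ℝ} (h : p ≠ q) :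
    vE m {p, q} = viol m p q := by
  unfold vE
  rw [Finset.sum_pair h, Finset.sum_pair h, Finset.sum_pair h, viol_exp, add_dotProduct,
    dotProduct_add, dotProduct_add]
  ring

theorem viol_neg {d : ℕ} {m : (Fin d → ℝ) → (Fin d → ℝ)} (hm : ∀ v, m (-v) = m v)
    (p q : Fin d → ℝ) : viol m (-p) (-q) = - viol m p q := by
  unfold viol
  rw [hm, hm, ← neg_dotProduct]
  congr 1; abel

theorem half_card {α : Type} [DecidableEq α] (s : Finset α) (ν : α → α) (hν : ∀ x ∈ s, ν x ∈ s)
    (hνν : ∀ x, ν (ν x) = x) (f : α → ℝ) (hf : ∀ x, f (ν x) = - f x) (h0 : ∀ x ∈ s, f x ≠ 0) :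
    2 * (s.filter fun x => 0 < f x).card = s.card := by
  have h1 := Finset.card_filter_add_card_filter_not (s := s) (fun x => 0 < f x)
  have h2 : (s.filter fun x => 0 < f x).card = (s.filter fun x => ¬ 0 < f x).card := by
    apply Finset.card_nbij' ν ν
    · intro x hx
      simp only [Finset.mem_coe, Finset.mem_filter] at hx ⊢
      exact ⟨hν x hx.1, by rw [hf]; linarith [hx.2]⟩
    · intro x hx
      simp only [Finset.mem_coe, Finset.mem_filter] at hx ⊢
      refine ⟨hν x hx.1, ?_⟩
      rw [hf]
      have := lt_of_le_of_ne (not_lt.1 hx.2) (h0 x hx.1)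
      linarith
    · intro x _; exact hνν x
    · intro x _; exact hνν x
  omega

namespace CSP
variable {d : ℕ}

def edges (K : CSP d) : Finset (Finset (Fin d → ℝ)) :=
  K.V.powerset.filter fun e => e.card = 2 ∧ K.Fc e

variable {K : CSP d}

theorem mem_edges {e : Finset (Fin d → ℝ)} : e ∈ K.edges ↔ e.card = 2 ∧ K.Fc e := by
  simp only [edges, Finset.mem_filter, Finset.mem_powerset]
  exact ⟨fun h => h.2, fun h => ⟨h.2.1, h⟩⟩

theorem even_const (hd : 3 ≤ d) {m : (Fin d → ℝ) → (Fin d → ℝ)} (hev : ∀ v, m (-v) = m v)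
    (hm : ∀ p q, K.Fc {p, q} → viol m p q = 0) : ∃ B, ∀ v ∈ K.V, m v = B := by
  obtain ⟨B, S, hS, h⟩ := star_rigid (K := K) fc_empty (by simpa using hd) (m := m) (by
    intro p q h; exact hm p q (by simpa using h))
  refine ⟨B, fun v hv => ?_⟩
  have h1 := h v (by simpa using fc_single hv)
  have h2 := h (-v) (by simpa using fc_single (K.neg v hv))
  rw [hev, h1, map_neg] at h2
  have h3 : S v = - S v := add_left_cancel h2
  have h4 : S v = 0 := self_eq_neg.1 h3
  rw [h1, h4, add_zero]

def mext {V0 : Finset (Fin d → ℝ)} (m : V0 → (Fin d → ℝ)) (v : Fin d → ℝ) : Fin d → ℝ :=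
  if h : v ∈ V0 then m ⟨v, h⟩ else if h : -v ∈ V0 then m ⟨-v, h⟩ else 0

theorem exists_motion (hd : 3 ≤ d) (hE : K.edges.card + 2 * d = d * K.V.card)
    (lam : Finset (Fin d → ℝ) → ℝ) (hlam : ∀ e ∈ K.edges, lam (ngF e) = - lam e) :
    ∃ m : (Fin d → ℝ) → (Fin d → ℝ), (∀ v, m (-v) = m v) ∧
      ∀ p q, p ≠ q → K.Fc {p, q} → viol m p q = lam {p, q} := by
  have hedge : ∀ e ∈ K.edges, ∃ p q, p ≠ q ∧ e = {p, q} := by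
    intro e he
    exact Finset.card_eq_two.1 (mem_edges.1 he).1
  have hes : ∀ e ∈ K.edges, (∑ p ∈ e, p) ≠ 0 := by
    intro e he h0
    obtain ⟨p, q, hpq, rfl⟩ := hedge e he
    rw [Finset.sum_pair hpq] at h0
    have := (mem_edges.1 he).2.not_neg (v := p) (by simp)
    apply this
    rw [neg_eq_of_add_eq_zero_right h0]; simp
  obtain ⟨q, hq⟩ := gen_vec (K.V ∪ K.edges.image fun e => ∑ p ∈ e, p) (by
    intro v hv
    rcases Finset.mem_union.1 hv with h | h
    · rintro rfl; exact zero_notMem h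
    · obtain ⟨e, he, rfl⟩ := Finset.mem_image.1 h; exact hes e he)
  set V0 := K.V.filter fun v => 0 < v ⬝ᵥ q with hV0
  set E0 := K.edges.filter fun e => 0 < (∑ p ∈ e, p) ⬝ᵥ q with hE0
  have hsum : ∀ e : Finset (Fin d → ℝ), ∑ p ∈ ngF e, p = - ∑ p ∈ e, p := by
    intro e
    unfold ngF
    rw [Finset.sum_image (fun x _ y _ h => neg_injective h), Finset.sum_neg_distrib]
  have hng : ∀ e ∈ K.edges, ngF e ∈ K.edges := by
    intro e he
    rw [mem_edges] at he ⊢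
    exact ⟨by rw [card_ngF, he.1], he.2.neg⟩
  have cV : 2 * V0.card = K.V.card := half_card _ (fun v => -v) K.neg (fun x => neg_neg x) _
    (fun x => by rw [neg_dotProduct]) (fun v hv => hq v (Finset.mem_union_left _ hv))
  have cE : 2 * E0.card = K.edges.card := half_card _ ngF hng ngF_ngF _
    (fun x => by rw [hsum, neg_dotProduct])
    (fun e he => hq _ (Finset.mem_union_right _ (Finset.mem_image_of_mem _ he)))
  have hdisj : ∀ v, v ∈ V0 → -v ∉ V0 := by
    intro v h1 h2
    have e1 := (Finset.mem_filter.1 h1).2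
    have e2 := (Finset.mem_filter.1 h2).2
    rw [neg_dotProduct] at e2; linarith
  have hor : ∀ v ∈ K.V, v ∈ V0 ∨ -v ∈ V0 := by
    intro v hv
    rcases lt_or_gt_of_ne (hq v (Finset.mem_union_left _ hv)) with h | h
    · right; exact Finset.mem_filter.2 ⟨K.neg v hv, by rw [neg_dotProduct]; linarith⟩
    · left; exact Finset.mem_filter.2 ⟨hv, h⟩
  have hmev : ∀ (m : V0 → (Fin d → ℝ)) v, mext m (-v) = mext m v := by
    intro m v
    unfold mext
    by_cases h1 : v ∈ V0
    · have h2 := hdisj v h1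
      simp [h1, h2]
    · by_cases h2 : -v ∈ V0
      · simp [h1, h2]
      · simp [h1, h2]
  have hadd : ∀ (m m' : V0 → (Fin d → ℝ)) v, mext (m + m') v = mext m v + mext m' v := by
    intro m m' v
    unfold mext
    split_ifs <;> simp
  have hsmul : ∀ (c : ℝ) (m : V0 → (Fin d → ℝ)) v, mext (c • m) v = c • mext m v := by
    intro c m v
    unfold mext
    split_ifs <;> simp
  let Ψ : (V0 → (Fin d → ℝ)) →ₗ[ℝ] (E0 → ℝ) :=
    { toFun := fun m e => vE (mext m) e
      map_add' := by
        intro m m'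
        ext e
        simp only [vE, hadd, Pi.add_apply, dotProduct_add, Finset.sum_add_distrib]
        ring
      map_smul' := by
        intro c m
        ext e
        simp only [vE, hsmul, Pi.smul_apply, dotProduct_smul, ← Finset.smul_sum, smul_eq_mul,
          RingHom.id_apply, ← Finset.mul_sum]
        ring }
  have hΨ : ∀ m e, Ψ m e = vE (mext m) e := fun m e => rfl
  have hall : ∀ (m : V0 → (Fin d → ℝ)) (lam : Finset (Fin d → ℝ) → ℝ),
      (∀ e ∈ K.edges, lam (ngF e) = - lam e) → (∀ e : E0, Ψ m e = lam e) →
      ∀ p q, p ≠ q → K.Fc {p, q} → viol (mext m) p q = lam {p, q} := by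
    intro m lam hlam h p r hpr hf
    have he : ({p, r} : Finset (Fin d → ℝ)) ∈ K.edges := mem_edges.2 ⟨Finset.card_pair hpr, hf⟩
    rcases lt_or_gt_of_ne (hq _ (Finset.mem_union_right _ (Finset.mem_image_of_mem _ he))) with h0 | h0
    · have h1 : ngF {p, r} ∈ E0 := Finset.mem_filter.2 ⟨hng _ he, by
        rw [hsum, neg_dotProduct]; linarith⟩
      have h2 := h ⟨_, h1⟩
      rw [hΨ] at h2
      simp only at h2
      rw [hlam _ he, ngF_pair, vE_pair _ (fun h => hpr (neg_injective h)), viol_neg (hmev m)] at h2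
      linarith
    · have h1 : ({p, r} : Finset (Fin d → ℝ)) ∈ E0 := Finset.mem_filter.2 ⟨he, h0⟩
      have h2 := h ⟨_, h1⟩
      rw [hΨ] at h2
      simp only at h2
      rw [vE_pair _ hpr] at h2
      exact h2
  have hker : Module.finrank ℝ (LinearMap.ker Ψ) ≤ d := by
    let C : (Fin d → ℝ) →ₗ[ℝ] (V0 → (Fin d → ℝ)) :=
      { toFun := fun b _ => b, map_add' := fun _ _ => rfl, map_smul' := fun _ _ => rfl }
    have hle : LinearMap.ker Ψ ≤ LinearMap.range C := by
      intro m hm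
      rw [LinearMap.mem_ker] at hm
      have h1 := hall m (fun _ => 0) (by simp) (fun e => by rw [hm]; rfl)
      obtain ⟨B, hB⟩ := even_const hd (K := K) (hmev m) (by
        intro p q hf
        by_cases hpq : p = q
        · rw [hpq, viol_self]
        · exact h1 p q hpq hf)
      refine ⟨B, ?_⟩
      funext v
      have h2 := hB v (Finset.mem_filter.1 v.2).1
      unfold mext at h2
      rw [dif_pos v.2] at h2
      exact h2.symm
    calc _ ≤ Module.finrank ℝ (LinearMap.range C) := Submodule.finrank_mono hle
      _ ≤ Module.finrank ℝ (Fin d → ℝ) := LinearMap.finrank_range_le C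
      _ = d := by simp
  have hrn := LinearMap.finrank_range_add_finrank_ker Ψ
  have hdom : Module.finrank ℝ (V0 → (Fin d → ℝ)) = V0.card * d := by
    rw [Module.finrank_pi_fintype]; simp
  have hcod : Module.finrank ℝ (E0 → ℝ) = E0.card := by simp
  have hsurj : LinearMap.range Ψ = ⊤ := by
    apply Submodule.eq_top_of_finrank_eq
    apply le_antisymm (Submodule.finrank_le _)
    rw [hcod]
    have : K.V.card * d = 2 * (V0.card * d) := by rw [← cV]; ring
    rw [mul_comm d] at hE
    omega
  have : (fun e : E0 => lam e) ∈ LinearMap.range Ψ := by rw [hsurj]; trivial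
  obtain ⟨m, hm⟩ := this
  exact ⟨mext m, hmev m, hall m lam hlam (fun e => by rw [hm])⟩

/-- even motion violating only one edge and its antipode -/
theorem exists_single (hd : 3 ≤ d) (hE : K.edges.card + 2 * d = d * K.V.card) {x y : Fin d → ℝ}
    (hxy : x ≠ y) (hf : K.Fc {x, y}) :
    ∃ m : (Fin d → ℝ) → (Fin d → ℝ), (∀ v, m (-v) = m v) ∧ viol m x y = 1 ∧
      ∀ p q, K.Fc {p, q} → ({p, q} : Finset (Fin d → ℝ)) ≠ {x, y} →
        ({p, q} : Finset (Fin d → ℝ)) ≠ {-x, -y} → viol m p q = 0 := by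
  have hne : ({x, y} : Finset (Fin d → ℝ)) ≠ {-x, -y} := by
    intro h
    have h1 : -x ∈ ({x, y} : Finset (Fin d → ℝ)) := by rw [h]; simp
    exact hf.not_neg (by simp) h1
  obtain ⟨m, h1, h2⟩ := exists_motion hd hE (fun e => if e = {x, y} then 1 else
    if e = {-x, -y} then -1 else 0) (by
    intro e _
    have ea : ngF e = {x, y} ↔ e = {-x, -y} := by
      constructor
      · intro h; rw [← ngF_ngF e, h, ngF_pair]
      · intro h; rw [h, ngF_pair]; simp
    have eb : ngF e = {-x, -y} ↔ e = {x, y} := by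
      constructor
      · intro h; rw [← ngF_ngF e, h, ngF_pair]; simp
      · intro h; rw [h, ngF_pair]
    simp only [ea, eb]
    by_cases h1 : e = {x, y}
    · have h2 : e ≠ {-x, -y} := h1 ▸ hne
      simp [h1, hne]
    · by_cases h2 : e = {-x, -y}
      · simp [h2, hne.symm]
      · simp [h1, h2])
  refine ⟨m, h1, ?_, ?_⟩
  · rw [h2 x y hxy hf]; simp
  · intro p q hpq n1 n2
    by_cases h : p = q
    · rw [h, viol_self]
    · rw [h2 p q h hpq, if_neg n1, if_neg n2]

end CSP

theorem dot_even {d : ℕ} {m : (Fin d → ℝ) → (Fin d → ℝ)} (hm : ∀ v, m (-v) = m v)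
    (w a : Fin d → ℝ) : a ⬝ᵥ (m w - m a) = (viol m w (-a) - viol m w a) / 2 := by
  unfold viol
  rw [hm, sub_dotProduct w (-a), sub_dotProduct w a, neg_dotProduct]
  ring

theorem pair_ne_of_left {d : ℕ} {p q x y : Fin d → ℝ} (h1 : p ≠ x) (h2 : p ≠ y) :
    ({p, q} : Finset (Fin d → ℝ)) ≠ {x, y} := by
  intro h
  have : p ∈ ({x, y} : Finset (Fin d → ℝ)) := by rw [← h]; simp
  simp only [Finset.mem_insert, Finset.mem_singleton] at this
  tauto

theorem pair_ne_of_right {d : ℕ} {p q x y : Fin d → ℝ} (h1 : q ≠ x) (h2 : q ≠ y) :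
    ({p, q} : Finset (Fin d → ℝ)) ≠ {x, y} := by
  rw [Finset.pair_comm]; exact pair_ne_of_left h1 h2

namespace CSP
variable {d : ℕ} {K : CSP d}

theorem F1 (hd : 3 ≤ d) (hE : K.edges.card + 2 * d = d * K.V.card) {Z : Finset (Fin d → ℝ)}
    (hanti : ∀ a ∈ Z, -a ∉ Z) {w w' : Fin d → ℝ} (hw : w ∈ Z) (hw' : w' ∈ Z) (hne : w ≠ w')
    (h : ∀ a ∈ Z, a ≠ w → K.Fc {w, a} ∧ K.Fc {w, -a})
    (h' : ∀ a ∈ Z, a ≠ w' → K.Fc {w', a} ∧ K.Fc {w', -a}) : LI Z := by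
  have hneg : ∀ a ∈ Z, ∀ b ∈ Z, a ≠ -b := by
    rintro a ha b hb rfl
    exact hanti b hb ha
  intro c hc
  by_contra hcon
  push Not at hcon
  obtain ⟨a1, ha1, hca1⟩ := hcon
  obtain ⟨a0, ha0, h0w, h0w', hca0⟩ : ∃ a0 ∈ Z, a0 ≠ w ∧ a0 ≠ w' ∧ c a0 ≠ 0 := by
    by_contra hcon
    push Not at hcon
    have h2 : ∑ v ∈ ({w, w'} : Finset (Fin d → ℝ)), c v • v = 0 := by
      rw [← hc]
      apply Finset.sum_subset
      · intro v hv
        simp only [Finset.mem_insert, Finset.mem_singleton] at hv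
        rcases hv with rfl | rfl <;> assumption
      · intro v hv hv2
        simp only [Finset.mem_insert, Finset.mem_singleton, not_or] at hv2
        rw [hcon v hv hv2.1 hv2.2, zero_smul]
    have h3 := (h w' hw' hne.symm).1.li c h2
    by_cases e1 : a1 = w
    · exact hca1 (h3 a1 (by simp [e1]))
    · by_cases e2 : a1 = w'
      · exact hca1 (h3 a1 (by simp [e2]))
      · exact hca1 (hcon a1 ha1 e1 e2)
  obtain ⟨m, hev, h1, hz⟩ := exists_single hd hE h0w.symm (h a0 ha0 h0w).1
  have key : ∀ p : Fin d → ℝ, ∑ a ∈ Z, c a * (a ⬝ᵥ (m p - m a)) = - ∑ a ∈ Z, c a * (a ⬝ᵥ m a) := by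
    intro p
    have e := dot_sum_smul (m p) Z c
    rw [hc, dotProduct_zero] at e
    simp only [dotProduct_sub, mul_sub, Finset.sum_sub_distrib]
    simp only [dotProduct_comm _ (m p)]
    rw [← e]; ring
  have k1 := key w
  have k2 := key w'
  rw [Finset.sum_eq_zero (s := Z) (f := fun a => c a * (a ⬝ᵥ (m w' - m a)))] at k2
  · rw [Finset.sum_eq_single a0] at k1
    · rw [← k2, dot_even hev, h1, hz w (-a0) (h a0 ha0 h0w).2] at k1
      · apply hca0; linarith
      · exact pair_ne_of_right (fun e => hneg w hw a0 ha0 e.symm)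
          (fun e => hneg a0 ha0 a0 ha0 e.symm)
      · exact pair_ne_of_left (hneg w hw w hw) (hneg w hw a0 ha0)
    · intro a ha hne0
      by_cases haw : a = w
      · rw [haw]; simp
      · obtain ⟨f1, f2⟩ := h a ha haw
        rw [dot_even hev, hz w a f1, hz w (-a) f2]
        · simp
        · exact pair_ne_of_right (fun e => hneg w hw a ha e.symm) (fun e => hneg a0 ha0 a ha e.symm)
        · exact pair_ne_of_left (hneg w hw w hw) (hneg w hw a0 ha0)
        · exact pair_ne_of_right haw hne0
        · exact pair_ne_of_left (hneg w hw w hw) (hneg w hw a0 ha0)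
    · intro h; exact absurd ha0 h
  · intro a ha
    by_cases haw : a = w'
    · rw [haw]; simp
    · obtain ⟨f1, f2⟩ := h' a ha haw
      rw [dot_even hev, hz w' a f1, hz w' (-a) f2]
      · simp
      · exact pair_ne_of_left hne.symm h0w'.symm
      · exact pair_ne_of_left (hneg w' hw' w hw) (hneg w' hw' a0 ha0)
      · exact pair_ne_of_left hne.symm h0w'.symm
      · exact pair_ne_of_left (hneg w' hw' w hw) (hneg w' hw' a0 ha0)

theorem insert2_eq {p q x r : Fin d → ℝ} {τ : Finset (Fin d → ℝ)}
    (h : ({p, q} : Finset (Fin d → ℝ)) = {x, r}) : insert p (insert q τ) = insert x (insert r τ) := by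
  have e : ∀ p q : Fin d → ℝ, insert p (insert q τ) = {p, q} ∪ τ := by
    intro p q; ext; simp
  rw [e, e, h]

theorem F2 (hd : 3 ≤ d) (hE : K.edges.card + 2 * d = d * K.V.card) {τ : Finset (Fin d → ℝ)}
    (hc : τ.card + 3 ≤ d) {x r : Fin d → ℝ} (hx : K.Fc (insert x τ)) (hr : K.Fc (insert r τ))
    (hxr : K.Fc {x, r}) (hn : ¬ K.Fc (insert x (insert r τ))) :
    K.Fc (insert (-x) (insert (-r) τ)) := by
  by_contra hcon
  have hne : x ≠ r := by
    rintro rfl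
    rw [Finset.insert_idem] at hn
    exact hn hx
  obtain ⟨m, hev, h1, hz⟩ := exists_single hd hE hne hxr
  obtain ⟨B, S, hS, h⟩ := star_rigid (hx.mono (Finset.subset_insert _ _)) hc (m := m) (by
    intro p q hf
    apply hz p q (hf.mono (by intro y; simp; tauto))
    · intro e; rw [insert2_eq e] at hf; exact hn hf
    · intro e; rw [insert2_eq e] at hf; exact hcon hf)
  have := hS.viol (h x hx) (h r hr)
  rw [h1] at this
  exact one_ne_zero this

/-- missing faces -/
def Ms (K : CSP d) (M : Finset (Fin d → ℝ)) : Prop := ¬ K.Fc M ∧ ∀ x ∈ M, K.Fc (M.erase x)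

theorem Ms.flip (hd : 3 ≤ d) (hE : K.edges.card + 2 * d = d * K.V.card) {M : Finset (Fin d → ℝ)}
    (hM : K.Ms M) (h3 : 3 ≤ M.card) (h1 : M.card + 1 ≤ d) {x y : Fin d → ℝ} (hx : x ∈ M)
    (hy : y ∈ M) (hxy : x ≠ y) :
    K.Fc (insert (-x) (insert (-y) ((M.erase x).erase y))) := by
  have hyM : y ∈ M.erase x := Finset.mem_erase.2 ⟨hxy.symm, hy⟩
  have hxM : x ∈ M.erase y := Finset.mem_erase.2 ⟨hxy, hx⟩
  have e1 : insert y ((M.erase x).erase y) = M.erase x := Finset.insert_erase hyM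
  have e2 : insert x ((M.erase x).erase y) = M.erase y := by
    rw [Finset.erase_right_comm]; exact Finset.insert_erase hxM
  apply F2 hd hE
  · rw [Finset.card_erase_of_mem hyM, Finset.card_erase_of_mem hx]; omega
  · rw [e2]; exact hM.2 y hy
  · rw [e1]; exact hM.2 x hx
  · obtain ⟨z, hz, hzn⟩ := Finset.exists_mem_notMem_of_card_lt_card
      (s := ({x, y} : Finset (Fin d → ℝ))) (t := M) (lt_of_le_of_lt Finset.card_le_two h3)
    apply (hM.2 z hz).mono
    simp only [Finset.mem_insert, Finset.mem_singleton, not_or] at hzn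
    intro v hv
    simp only [Finset.mem_insert, Finset.mem_singleton] at hv
    rcases hv with rfl | rfl
    · exact Finset.mem_erase.2 ⟨fun e => hzn.1 e.symm, hx⟩
    · exact Finset.mem_erase.2 ⟨fun e => hzn.2 e.symm, hy⟩
  · rw [e1, Finset.insert_erase hx]; exact hM.1

theorem Ms.double (hd : 3 ≤ d) (hE : K.edges.card + 2 * d = d * K.V.card) {M : Finset (Fin d → ℝ)}
    (hM : K.Ms M) (h3 : 3 ≤ M.card) (h1 : M.card + 1 ≤ d) {x y : Fin d → ℝ} (hx : x ∈ M)
    (hy : y ∈ M) (hxy : x ≠ y) : K.Fc {x, y} ∧ K.Fc {x, -y} := by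
  obtain ⟨z, hz, hzn⟩ := Finset.exists_mem_notMem_of_card_lt_card
      (s := ({x, y} : Finset (Fin d → ℝ))) (t := M) (lt_of_le_of_lt Finset.card_le_two h3)
  simp only [Finset.mem_insert, Finset.mem_singleton, not_or] at hzn
  constructor
  · apply (hM.2 z hz).mono
    intro v hv
    simp only [Finset.mem_insert, Finset.mem_singleton] at hv
    rcases hv with rfl | rfl
    · exact Finset.mem_erase.2 ⟨fun e => hzn.1 e.symm, hx⟩
    · exact Finset.mem_erase.2 ⟨fun e => hzn.2 e.symm, hy⟩
  · apply (hM.flip hd hE h3 h1 hy hz (fun e => hzn.2 e.symm)).mono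
    intro v hv
    simp only [Finset.mem_insert, Finset.mem_singleton] at hv
    rcases hv with rfl | rfl
    · exact Finset.mem_insert_of_mem (Finset.mem_insert_of_mem (Finset.mem_erase.2
        ⟨fun e => hzn.1 e.symm, Finset.mem_erase.2 ⟨hxy, hx⟩⟩))
    · simp

end CSP

/-- test motion -/
def tm {d : ℕ} (a b c : Fin d → ℝ) (v : Fin d → ℝ) : Fin d → ℝ :=
  (-(1/2) * (a ⬝ᵥ v) ^ 2) • b + (-(1/2) * (b ⬝ᵥ v) ^ 2) • a + ((1/4) * (a ⬝ᵥ v)) • a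
    + (-(1/2) * (a ⬝ᵥ v)) • b + ((1/4) * (b ⬝ᵥ v)) • b + (-(1/4) * (c ⬝ᵥ v)) • c

theorem tm_viol {d : ℕ} (a b c p q : Fin d → ℝ) : viol (tm a b c) p q =
    -(1/2) * ((a ⬝ᵥ p) ^ 2 - (a ⬝ᵥ q) ^ 2) * (b ⬝ᵥ p - b ⬝ᵥ q)
    - (1/2) * ((b ⬝ᵥ p) ^ 2 - (b ⬝ᵥ q) ^ 2) * (a ⬝ᵥ p - a ⬝ᵥ q)
    + (1/4) * (a ⬝ᵥ p - a ⬝ᵥ q) ^ 2 - (1/2) * (a ⬝ᵥ p - a ⬝ᵥ q) * (b ⬝ᵥ p - b ⬝ᵥ q)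
    + (1/4) * (b ⬝ᵥ p - b ⬝ᵥ q) ^ 2 - (1/4) * (c ⬝ᵥ p - c ⬝ᵥ q) ^ 2 := by
  unfold viol tm
  simp only [dotProduct_sub, dotProduct_add, dotProduct_smul, sub_dotProduct, smul_eq_mul]
  rw [dotProduct_comm p a, dotProduct_comm p b, dotProduct_comm p c, dotProduct_comm q a,
    dotProduct_comm q b, dotProduct_comm q c]
  ring

theorem viol_sub {d : ℕ} (m m' : (Fin d → ℝ) → (Fin d → ℝ)) (p q : Fin d → ℝ) :
    viol (fun v => m v - m' v) p q = viol m p q - viol m' p q := by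
  simp only [viol, dotProduct_sub]; ring

namespace CSP
variable {d : ℕ} {K : CSP d}

/-- both signs in the link -/
def Bs (K : CSP d) (τ : Finset (Fin d → ℝ)) (u : Fin d → ℝ) : Prop :=
  K.Fc (insert u τ) ∧ K.Fc (insert (-u) τ)

theorem Bs.neg {τ : Finset (Fin d → ℝ)} {u : Fin d → ℝ} (h : K.Bs τ u) : K.Bs τ (-u) :=
  ⟨h.2, by rw [neg_neg]; exact h.1⟩

set_option maxHeartbeats 1000000 in
theorem F3_core (hd : 3 ≤ d) (hE : K.edges.card + 2 * d = d * K.V.card) {τ : Finset (Fin d → ℝ)}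
    (hτ : τ.card + 3 = d) {x y u : Fin d → ℝ} (hx : K.Bs τ x) (hy : K.Bs τ y)
    (hli : LI {x, y, u}) (hfxy : K.Fc {x, y}) (hxy : x ≠ y) (hxu : x ≠ u) (hyu : y ≠ u)
    (hB : ∀ b, K.Bs τ b → b = x ∨ b = -x ∨ b = y ∨ b = -y ∨ b = u ∨ b = -u)
    (hn : ¬ K.Fc (insert x (insert y τ))) : False := by
  set a := ev {x, y, u} x
  set b := ev {x, y, u} y
  set c := ev {x, y, u} u
  have ax : a ⬝ᵥ x = 1 := hli.ev_self (by simp)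
  have ay : a ⬝ᵥ y = 0 := hli.ev_ne (by simp) hxy.symm
  have au : a ⬝ᵥ u = 0 := hli.ev_ne (by simp) hxu.symm
  have bx : b ⬝ᵥ x = 0 := hli.ev_ne (by simp) hxy
  have bY : b ⬝ᵥ y = 1 := hli.ev_self (by simp)
  have bu : b ⬝ᵥ u = 0 := hli.ev_ne (by simp) hyu.symm
  have cx : c ⬝ᵥ x = 0 := hli.ev_ne (by simp) hxu
  have cy : c ⬝ᵥ y = 0 := hli.ev_ne (by simp) hyu
  have cu : c ⬝ᵥ u = 1 := hli.ev_self (by simp)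
  set m := tm a b c with hm
  have hmxy : viol m x y = 2 := by
    rw [hm, tm_viol, ax, ay, bx, bY, cx, cy]; norm_num
  have hm0 : ∀ p q, K.Bs τ p → K.Bs τ q → K.Fc {p, q} → ({p, q} : Finset (Fin d → ℝ)) ≠ {x, y} →
      viol m p q = 0 := by
    intro p q hp hq hf hne
    have hpq : q ≠ -p := by
      rintro rfl
      exact hf.not_neg (v := p) (by simp) (by simp)
    by_cases hpe : p = q
    · rw [hpe, viol_self]
    rw [hm, tm_viol]
    rcases hB p hp with rfl | rfl | rfl | rfl | rfl | rfl <;>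
    rcases hB q hq with rfl | rfl | rfl | rfl | rfl | rfl <;>
    first
      | with_reducible exact absurd rfl hpe
      | with_reducible exact absurd rfl hpq
      | with_reducible exact absurd (neg_neg _).symm hpq
      | with_reducible exact absurd rfl hne
      | with_reducible exact absurd (Finset.pair_comm _ _) hne
      | (simp only [dotProduct_neg, ax, ay, au, bx, bY, bu, cx, cy, cu]; norm_num)
  set A : Finset (Fin d → ℝ) → Prop := fun e => K.Fc (e ∪ τ) ∧ ¬ ∀ v ∈ e, K.Bs τ v with hA
  have hAA : ∀ e, A e → ¬ A (ngF e) := by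
    rintro e ⟨h1, h2⟩ ⟨h3, _⟩
    apply h2
    intro v hv
    refine ⟨h1.mono (Finset.insert_subset (Finset.mem_union_left _ hv) Finset.subset_union_right),
      h3.mono (Finset.insert_subset (Finset.mem_union_left _ (mem_ngF.2 ?_))
        Finset.subset_union_right)⟩
    rw [neg_neg]; exact hv
  set lam : Finset (Fin d → ℝ) → ℝ := fun e => if A e then vE m e else
    if A (ngF e) then - vE m (ngF e) else 0 with hlam
  obtain ⟨m', hev, hm'⟩ := exists_motion hd hE lam (by
    intro e _
    simp only [hlam, ngF_ngF]
    by_cases h1 : A e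
    · simp [h1, hAA e h1]
    · by_cases h2 : A (ngF e)
      · simp [h1, h2]
      · simp [h1, h2])
  have hlamB : ∀ e, (∀ v ∈ e, K.Bs τ v) → lam e = 0 := by
    intro e he
    simp only [hlam]
    have hn2 : ¬ A (ngF e) := by
      intro h
      apply h.2
      intro v hv
      have := (he _ (mem_ngF.1 hv)).neg
      rwa [neg_neg] at this
    rw [if_neg (fun h => h.2 he), if_neg hn2]
  have e2 : ∀ p q : Fin d → ℝ, insert p (insert q τ) = {p, q} ∪ τ := by
    intro p q; ext; simp
  obtain ⟨B, S, hS, h⟩ := star_rigid (hx.1.mono (Finset.subset_insert _ _)) hτ.le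
    (m := fun v => m v - m' v) (by
    intro p q hf
    by_cases hpq : p = q
    · rw [hpq, viol_self]
    have hfpq : K.Fc {p, q} := hf.mono (by intro y; simp; tauto)
    rw [viol_sub, hm' p q hpq hfpq]
    by_cases h1 : ∀ v ∈ ({p, q} : Finset (Fin d → ℝ)), K.Bs τ v
    · rw [hlamB _ h1, hm0 p q (h1 p (by simp)) (h1 q (by simp)) hfpq, sub_zero]
      intro e
      rw [insert2_eq e] at hf
      exact hn hf
    · have hAe : A {p, q} := ⟨by rw [← e2]; exact hf, h1⟩
      simp only [hlam]
      rw [if_pos hAe, vE_pair _ hpq, sub_self])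
  have h0 := hS.viol (m := fun v => m v - m' v) (h x hx.1) (h y hy.1)
  rw [viol_sub, hmxy, hm' x y hxy hfxy, hlamB] at h0
  · norm_num at h0
  · intro v hv
    simp only [Finset.mem_insert, Finset.mem_singleton] at hv
    rcases hv with rfl | rfl <;> assumption

theorem Bs.notMem {τ : Finset (Fin d → ℝ)} {u : Fin d → ℝ} (h : K.Bs τ u) : u ∉ τ ∧ -u ∉ τ := by
  constructor
  · intro hu
    exact h.2.not_neg (Finset.mem_insert_of_mem hu) (Finset.mem_insert_self _ _)
  · intro hu
    exact h.1.not_neg (Finset.mem_insert_self _ _) (Finset.mem_insert_of_mem hu)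

theorem F3 (hd : 5 ≤ d) (hE : K.edges.card + 2 * d = d * K.V.card) {σ : Finset (Fin d → ℝ)}
    (hσ : K.Ms σ) (hc : σ.card + 1 = d) : False := by
  have hd3 : 3 ≤ d := by omega
  obtain ⟨x, hx, y, hy, hxy⟩ := Finset.one_lt_card.1 (show 1 < σ.card by omega)
  have hfl := hσ.flip hd3 hE (by omega) (by omega) hx hy hxy
  have hyM : y ∈ σ.erase x := Finset.mem_erase.2 ⟨hxy.symm, hy⟩
  have hxM : x ∈ σ.erase y := Finset.mem_erase.2 ⟨hxy, hx⟩
  set τ := (σ.erase x).erase y with hτ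
  have e1 : insert y τ = σ.erase x := Finset.insert_erase hyM
  have e2 : insert x τ = σ.erase y := by
    rw [hτ, Finset.erase_right_comm]; exact Finset.insert_erase hxM
  have e3 : insert x (insert y τ) = σ := by rw [e1, Finset.insert_erase hx]
  have hτc : τ.card + 3 = d := by
    rw [hτ, Finset.card_erase_of_mem hyM, Finset.card_erase_of_mem hx]; omega
  have hBx : K.Bs τ x := ⟨by rw [e2]; exact hσ.2 y hy, hfl.mono (Finset.insert_subset_insert _
    (Finset.subset_insert _ _))⟩
  have hBy : K.Bs τ y := ⟨by rw [e1]; exact hσ.2 x hx, hfl.mono (Finset.subset_insert _ _)⟩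
  have hτf : K.Fc τ := hBx.1.mono (Finset.subset_insert _ _)
  have hτσ : τ ⊆ σ := (Finset.erase_subset _ _).trans (Finset.erase_subset _ _)
  have hfxy : K.Fc {x, y} := (hσ.double hd3 hE (by omega) (by omega) hx hy hxy).1
  obtain ⟨t, ht, t', ht', htt⟩ := Finset.one_lt_card.1 (show 1 < τ.card by omega)
  have hLI : ∀ U : Finset (Fin d → ℝ), (∀ u ∈ U, K.Bs τ u) → (∀ u ∈ U, -u ∉ U) → LI (U ∪ τ) := by
    intro U hU hUn
    have hdb : ∀ t ∈ τ, ∀ a ∈ U ∪ τ, a ≠ t → K.Fc {t, a} ∧ K.Fc {t, -a} := by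
      intro t ht a ha hne
      rcases Finset.mem_union.1 ha with h | h
      · have hh := hU a h
        constructor
        · apply hh.1.mono
          rw [Finset.pair_comm]
          exact Finset.insert_subset_insert _ (by simpa using ht)
        · apply hh.2.mono
          rw [Finset.pair_comm]
          exact Finset.insert_subset_insert _ (by simpa using ht)
      · exact hσ.double hd3 hE (by omega) (by omega) (hτσ ht) (hτσ h) hne.symm
    refine F1 hd3 hE ?_ (Finset.mem_union_right _ ht) (Finset.mem_union_right _ ht') htt
      (hdb t ht) (hdb t' ht')
    intro a ha hna
    rcases Finset.mem_union.1 ha with h | h <;> rcases Finset.mem_union.1 hna with h2 | h2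
    · exact hUn a h h2
    · exact (hU a h).notMem.2 h2
    · have := (hU _ h2).notMem.2
      rw [neg_neg] at this
      exact this h
    · exact hτf.not_neg h h2
  have hcardU : ∀ U : Finset (Fin d → ℝ), (∀ u ∈ U, K.Bs τ u) → (∀ u ∈ U, -u ∉ U) → U.card ≤ 3 := by
    intro U hU hUn
    have h1 := (hLI U hU hUn).card_le
    rw [Finset.card_union_of_disjoint] at h1
    · omega
    · rw [Finset.disjoint_left]
      intro u hu; exact (hU u hu).notMem.1
  have hxny : x ≠ -y := by
    rintro rfl
    exact hfxy.not_neg (v := y) (by simp) (by simp)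
  have hBn : ∀ u, K.Bs τ u → u ≠ -u := fun u hu => ne_neg (hu.1.1 (by simp))
  by_cases hex : ∃ u, K.Bs τ u ∧ u ≠ x ∧ u ≠ -x ∧ u ≠ y ∧ u ≠ -y
  · obtain ⟨u, hu, n1, n2, n3, n4⟩ := hex
    have hnu : ∀ {a b : Fin d → ℝ}, a ≠ -b → -a ≠ b := fun h e => h (by rw [← e, neg_neg])
    have hnu2 : ∀ {a b : Fin d → ℝ}, a ≠ -b → -b ≠ a := fun h e => h e.symm
    refine F3_core hd3 hE hτc hBx hBy (u := u) ?_ hfxy hxy n1.symm n3.symm ?_ (by rw [e3]; exact hσ.1)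
    · refine (hLI {x, y, u} ?_ ?_).mono Finset.subset_union_left
      · intro v hv
        simp only [Finset.mem_insert, Finset.mem_singleton] at hv
        rcases hv with rfl | rfl | rfl <;> assumption
      · intro v hv
        simp only [Finset.mem_insert, Finset.mem_singleton, not_or] at hv ⊢
        rcases hv with rfl | rfl | rfl
        · exact ⟨(hBn _ hBx).symm, hnu hxny, n2.symm⟩
        · exact ⟨hxny.symm, (hBn _ hBy).symm, n4.symm⟩
        · exact ⟨hnu n2, hnu n4, (hBn _ hu).symm⟩
    · intro b hb
      by_contra hcon
      push Not at hcon
      obtain ⟨b1, b2, b3, b4, b5, b6⟩ := hcon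
      have := hcardU {x, y, u, b} (by
        intro v hv
        simp only [Finset.mem_insert, Finset.mem_singleton] at hv
        rcases hv with rfl | rfl | rfl | rfl <;> assumption) (by
        intro v hv
        simp only [Finset.mem_insert, Finset.mem_singleton, not_or] at hv ⊢
        rcases hv with rfl | rfl | rfl | rfl
        · exact ⟨(hBn _ hBx).symm, hnu hxny, n2.symm, b2.symm⟩
        · exact ⟨hxny.symm, (hBn _ hBy).symm, n4.symm, b4.symm⟩
        · exact ⟨hnu n2, hnu n4, (hBn _ hu).symm, b6.symm⟩
        · exact ⟨hnu b2, hnu b4, hnu b6, (hBn _ hb).symm⟩)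
      rw [Finset.card_insert_of_notMem, Finset.card_insert_of_notMem,
        Finset.card_insert_of_notMem, Finset.card_singleton] at this
      · omega
      · simpa using b5.symm
      · simp only [Finset.mem_insert, Finset.mem_singleton, not_or]
        exact ⟨n3.symm, b3.symm⟩
      · simp only [Finset.mem_insert, Finset.mem_singleton, not_or]
        exact ⟨hxy, n1.symm, b1.symm⟩
  · push Not at hex
    obtain ⟨F, hF, hsF⟩ := hfxy.exists_facet
    obtain ⟨u, hu, hun⟩ := Finset.exists_mem_notMem_of_card_lt_card
      (s := ({x, y} : Finset (Fin d → ℝ))) (t := F)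
      (lt_of_le_of_lt Finset.card_le_two (by rw [hF.2]; omega))
    simp only [Finset.mem_insert, Finset.mem_singleton, not_or] at hun
    refine F3_core hd3 hE hτc hBx hBy (u := u) ?_ hfxy hxy (fun e => hun.1 e.symm)
      (fun e => hun.2 e.symm) ?_ (by rw [e3]; exact hσ.1)
    · apply hF.li.mono
      intro v hv
      simp only [Finset.mem_insert, Finset.mem_singleton] at hv
      rcases hv with rfl | rfl | rfl
      · exact hsF (by simp)
      · exact hsF (by simp)
      · exact hu
    · intro b hb
      have := hex b hb
      tauto

end CSP

namespace CSP
variable {d : ℕ} {K : CSP d}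

theorem exists_Ms {N : Finset (Fin d → ℝ)} (h : ¬ K.Fc N) : ∃ M ⊆ N, K.Ms M := by
  induction N using Finset.strongInduction with
  | H N ih =>
    by_cases hN : K.Ms N
    · exact ⟨N, Finset.Subset.refl _, hN⟩
    · have : ∃ x ∈ N, ¬ K.Fc (N.erase x) := by
        by_contra hcon
        push Not at hcon
        exact hN ⟨h, hcon⟩
      obtain ⟨x, hx, hf⟩ := this
      obtain ⟨M, h1, h2⟩ := ih _ (Finset.erase_ssubset hx) hf
      exact ⟨M, h1.trans (Finset.erase_subset _ _), h2⟩

theorem no_simplex (hd : 5 ≤ d) {X : Finset (Fin d → ℝ)} (hX : X.card = d + 1)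
    (hf : ∀ a ∈ X, K.Fc (X.erase a)) : False := by
  obtain ⟨c, hc, a1, ha1, hca1⟩ := rel_of_card (s := X) (by omega)
  have hall : ∀ a ∈ X, c a ≠ 0 := by
    intro a ha h0
    have h1 : ∑ v ∈ X.erase a, c v • v = 0 := by
      rw [← hc, ← Finset.add_sum_erase X _ ha, h0, zero_smul, zero_add]
    by_cases e : a1 = a
    · exact hca1 (e ▸ h0)
    · exact hca1 ((hf a ha).li c h1 a1 (Finset.mem_erase.2 ⟨e, ha1⟩))
  have hpos : ∀ c : (Fin d → ℝ) → ℝ, ∑ v ∈ X, c v • v = 0 → (∀ a ∈ X, 0 < c a) → False := by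
    intro c hc hp
    have hX1 : ∃ b ∈ X, b ≠ a1 := Finset.exists_mem_ne (by omega) a1
    obtain ⟨b, hb, hba⟩ := hX1
    have ha1V : a1 ∈ K.V := (hf b hb).1 (Finset.mem_erase.2 ⟨hba.symm, ha1⟩)
    have h1 := fan (fc_single (K.neg a1 ha1V)) (hf a1 ha1) (c := fun _ => c a1) (e := c)
      (fun _ _ => hp a1 ha1) (fun v hv => hp v (Finset.mem_of_mem_erase hv)) (by
      rw [← Finset.add_sum_erase X _ ha1] at hc
      rw [Finset.sum_singleton, smul_neg]
      exact neg_eq_of_add_eq_zero_right hc)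
    have h2 := congrArg Finset.card h1
    rw [Finset.card_singleton, Finset.card_erase_of_mem ha1] at h2
    omega
  by_cases hI : ∃ a ∈ X, 0 < c a
  · by_cases hJ : ∃ a ∈ X, c a < 0
    · obtain ⟨i, hi, hci⟩ := hI
      obtain ⟨j, hj, hcj⟩ := hJ
      have hIf : K.Fc (X.filter fun a => 0 < c a) := (hf j hj).mono (by
        intro a ha
        obtain ⟨h1, h2⟩ := Finset.mem_filter.1 ha
        exact Finset.mem_erase.2 ⟨by rintro rfl; linarith, h1⟩)
      have hJf : K.Fc (X.filter fun a => ¬ 0 < c a) := (hf i hi).mono (by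
        intro a ha
        obtain ⟨h1, h2⟩ := Finset.mem_filter.1 ha
        exact Finset.mem_erase.2 ⟨by rintro rfl; exact h2 hci, h1⟩)
      have h1 := fan hIf hJf (c := c) (e := fun a => - c a)
        (fun a ha => (Finset.mem_filter.1 ha).2) (fun a ha => by
          obtain ⟨h1, h2⟩ := Finset.mem_filter.1 ha
          have := lt_of_le_of_ne (not_lt.1 h2) (hall a h1)
          linarith) (by
        rw [← Finset.sum_filter_add_sum_filter_not X (fun a => 0 < c a)] at hc
        simp only [neg_smul, Finset.sum_neg_distrib]
        exact eq_neg_of_add_eq_zero_left hc)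
      have h2 : i ∈ X.filter fun a => 0 < c a := Finset.mem_filter.2 ⟨hi, hci⟩
      rw [h1] at h2
      exact (Finset.mem_filter.1 h2).2 hci
    · push Not at hJ
      exact hpos c hc fun a ha => lt_of_le_of_ne (hJ a ha) (hall a ha).symm
  · push Not at hI
    refine hpos (fun a => - c a) (by simp only [neg_smul, Finset.sum_neg_distrib, hc, neg_zero]) ?_
    intro a ha
    have := lt_of_le_of_ne (hI a ha) (hall a ha)
    linarith

/-- prime -/
def Prm (K : CSP d) : Prop := ∀ σ : Finset (Fin d → ℝ), K.Ms σ → σ.card ≠ d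

theorem F4a (hd : 5 ≤ d) (hE : K.edges.card + 2 * d = d * K.V.card) (hp : K.Prm)
    {x v : Fin d → ℝ} (hxv : K.Fc {x, v}) (hn : ¬ K.Fc {-x, v})
    {R : Finset (Fin d → ℝ)} (hR : K.Fc R) (hRc : R.card + 1 = d) (hvR : v ∈ R)
    (hxR : ¬ K.Fc (insert x R)) : ∃ τ ⊆ R, v ∈ τ ∧ τ.card + 3 = d ∧ ¬ K.Fc (insert x τ) := by
  have hd3 : 3 ≤ d := by omega
  obtain ⟨M, hMs, hM⟩ := exists_Ms hxR
  have hxM : x ∈ M := by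
    by_contra h
    apply hM.1
    apply hR.mono
    intro a ha
    rcases Finset.mem_insert.1 (hMs ha) with rfl | h2
    · exact absurd ha h
    · exact h2
  have hM'R : M.erase x ⊆ R := by
    intro a ha
    obtain ⟨h1, h2⟩ := Finset.mem_erase.1 ha
    exact (Finset.mem_insert.1 (hMs h2)).resolve_left h1
  have hMc : M.card ≤ d := by
    have := Finset.card_le_card hMs
    have := Finset.card_insert_le x R
    omega
  have h1 : M.card ≠ d := hp M hM
  have h2 : M.card + 1 ≠ d := fun h => F3 hd hE hM h
  have hM'c : (M.erase x).card + 1 = M.card := Finset.card_erase_add_one hxM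
  have hMe : insert x (M.erase x) = M := Finset.insert_erase hxM
  by_cases hs : (insert v (M.erase x)).card + 3 ≤ d
  · obtain ⟨τ, t1, t2, t3⟩ := Finset.exists_subsuperset_card_eq (n := d - 3)
      (Finset.insert_subset hvR hM'R) (by omega) (by omega)
    refine ⟨τ, t2, t1 (Finset.mem_insert_self _ _), by omega, fun h => hM.1 (h.mono ?_)⟩
    rw [← hMe]
    exact Finset.insert_subset_insert _ ((Finset.subset_insert _ _).trans t1)
  · have hvM : v ∉ M.erase x := by
      intro h
      rw [Finset.insert_eq_of_mem h] at hs
      omega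
    rw [Finset.card_insert_of_notMem hvM] at hs
    obtain ⟨r, hr⟩ : (M.erase x).Nonempty := Finset.card_pos.1 (by omega)
    have hrc : ((M.erase x).erase r).card + 1 = (M.erase x).card := Finset.card_erase_add_one hr
    obtain ⟨hrx, hrM⟩ := Finset.mem_erase.1 hr
    have hvn : v ∉ (M.erase x).erase r := fun h => hvM (Finset.mem_of_mem_erase h)
    have hsub : insert v ((M.erase x).erase r) ⊆ R :=
      Finset.insert_subset hvR ((Finset.erase_subset _ _).trans hM'R)
    have hcard : (insert v ((M.erase x).erase r)).card + 3 = d := by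
      rw [Finset.card_insert_of_notMem hvn]; omega
    refine ⟨insert v ((M.erase x).erase r), hsub, Finset.mem_insert_self _ _, hcard, fun hf => ?_⟩
    have := F2 hd3 hE hcard.le hf (r := r) (hR.mono (Finset.insert_subset (hM'R hr) hsub))
      (hM.double hd3 hE (by omega) (by omega) hxM hrM hrx.symm).1 (by
        intro h
        apply hM.1
        apply h.mono
        intro a ha
        simp only [Finset.mem_insert, Finset.mem_erase]
        tauto)
    apply hn
    apply this.mono
    intro a ha
    simp only [Finset.mem_insert, Finset.mem_singleton] at ha ⊢
    tauto

theorem F4b (hd : 5 ≤ d) (hE : K.edges.card + 2 * d = d * K.V.card) (hp : K.Prm)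
    {x v y : Fin d → ℝ} (hxv : K.Fc {x, v}) (hne : x ≠ v) (hn : ¬ K.Fc {-x, v})
    {m : (Fin d → ℝ) → (Fin d → ℝ)}
    (hz : ∀ p q, K.Fc {p, q} → ({p, q} : Finset (Fin d → ℝ)) ≠ {x, y} →
        ({p, q} : Finset (Fin d → ℝ)) ≠ {-x, -y} → viol m p q = 0) :
    ∃ (B : Fin d → ℝ) (S : (Fin d → ℝ) →ₗ[ℝ] (Fin d → ℝ)), Skw S ∧
      ∀ u, u ≠ x → K.Fc {u, v} → m u = B + S u := by
  have hst : ∀ τ : Finset (Fin d → ℝ), v ∈ τ → ¬ K.Fc (insert x τ) →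
      ∀ p q, K.Fc (insert p (insert q τ)) → viol m p q = 0 := by
    intro τ hv hnx p q hf
    apply hz p q (hf.mono (by intro y; simp; tauto))
    · intro e
      rw [insert2_eq e] at hf
      exact hnx (hf.mono (Finset.insert_subset_insert _ (Finset.subset_insert _ _)))
    · intro e
      rw [insert2_eq e] at hf
      apply hn
      apply hf.mono
      intro a ha
      simp only [Finset.mem_insert, Finset.mem_singleton] at ha ⊢
      rcases ha with rfl | rfl <;> tauto
  -- facets containing v can be moved off x
  have hoff : ∀ u, u ≠ x → K.Fc {u, v} → ∃ G, K.Facet G ∧ v ∈ G ∧ u ∈ G ∧ x ∉ G := by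
    intro u hux huv
    obtain ⟨G, hG, hs⟩ := huv.exists_facet
    by_cases hxG : x ∈ G
    · obtain ⟨w, _, hwG, hw⟩ := hG.exists_flip hxG
      refine ⟨_, hw, ?_, ?_, ?_⟩
      · exact Finset.mem_insert_of_mem (Finset.mem_erase.2 ⟨hne.symm, hs (by simp)⟩)
      · exact Finset.mem_insert_of_mem (Finset.mem_erase.2 ⟨hux, hs (by simp)⟩)
      · intro h
        rcases Finset.mem_insert.1 h with h | h
        · exact hwG (h ▸ hxG)
        · exact (Finset.mem_erase.1 h).1 rfl
    · exact ⟨G, hG, hs (by simp), hs (by simp), hxG⟩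
  have hvv : K.Fc {v, v} := hxv.mono (by intro a; simp; tauto)
  obtain ⟨F, hF, hvF, _, hxF⟩ := hoff v hne.symm hvv
  have hFx : ∀ F, K.Facet F → x ∉ F → ¬ K.Fc (insert x F) := by
    intro F hF hxF h
    have := hF.eq_of_sub h (Finset.subset_insert _ _)
    apply hxF
    rw [this]; simp
  obtain ⟨B, S, hS, hBS⟩ := hF.trivial_on (m := m) (by
    intro p hp q hq
    apply hst F hvF (hFx F hF hxF)
    rw [Finset.insert_eq_of_mem hq, Finset.insert_eq_of_mem hp]
    exact hF.1)
  refine ⟨B, S, hS, fun u hux huv => ?_⟩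
  obtain ⟨G, hG, hvG, huG, hxG⟩ := hoff u hux huv
  refine connect (τ := {v}) x (fun G => ∀ p ∈ G, m p = B + S p) ?_ hF (by simpa using hvF) hxF hG
    (by simpa using hvG) hxG hBS u huG
  intro F z u hF hvF hxF hz hzv hu hux hG hFm
  have hvF' : v ∈ F.erase z := Finset.mem_erase.2 ⟨by rintro rfl; simp at hzv, hvF (by simp)⟩
  have hRc : (F.erase z).card + 1 = d := by rw [Finset.card_erase_add_one hz, hF.2]
  obtain ⟨τ, t1, t2, t3, t4⟩ := F4a hd hE hp hxv hn (hF.1.mono (Finset.erase_subset z F)) hRc hvF'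
    (by
      intro h
      have hxR : x ∉ F.erase z := fun h => hxF (Finset.mem_of_mem_erase h)
      have hf : K.Facet (insert x (F.erase z)) := ⟨h, by
        rw [Finset.card_insert_of_notMem hxR, hRc]⟩
      have := hF.flip_uniq hz hG (Finset.subset_insert _ _) hf (Finset.subset_insert _ _)
        (by intro e; apply hu; rw [← e]; simp) (by intro e; apply hxF; rw [← e]; simp)
      have h2 : x ∈ insert u (F.erase z) := by rw [this]; simp
      rcases Finset.mem_insert.1 h2 with h3 | h3
      · exact hux h3.symm
      · exact hxR h3)
  exact propagate hF hz hu hG t1 t3 (hst τ t2 t4) hS hFm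

theorem F4 (hd : 5 ≤ d) (hE : K.edges.card + 2 * d = d * K.V.card) (hp : K.Prm)
    {x v : Fin d → ℝ} (hxv : K.Fc {x, v}) (hne : x ≠ v) : K.Fc {-x, v} := by
  by_contra hn
  have hd3 : 3 ≤ d := by omega
  set L := K.V.filter fun w => w ≠ x ∧ K.Fc (insert w {x, v}) with hL
  have hmemL : ∀ w, w ∈ L ↔ w ≠ x ∧ K.Fc (insert w {x, v}) := by
    intro w
    rw [hL, Finset.mem_filter]
    exact ⟨fun h => h.2, fun h => ⟨h.2.1 (by simp), h⟩⟩
  have hvL : v ∈ L := (hmemL v).2 ⟨hne.symm, hxv.mono (by intro a; simp)⟩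
  have hmu : ∀ y ∈ L, ∃ μ : Fin d → ℝ, ∀ w ∈ L, μ ⬝ᵥ (x - w) = if w = y then 1 else 0 := by
    intro y hy
    obtain ⟨hyx, hyf⟩ := (hmemL y).1 hy
    have hfxy : K.Fc {x, y} := hyf.mono (by intro a; simp; tauto)
    obtain ⟨m, hev, h1, hz⟩ := exists_single hd3 hE hyx.symm hfxy
    obtain ⟨B, S, hS, hBS⟩ := F4b hd hE hp hxv hne hn hz
    refine ⟨m x - B - S x, fun w hw => ?_⟩
    obtain ⟨hwx, hwf⟩ := (hmemL w).1 hw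
    have hmw := hBS w hwx (hwf.mono (by intro a; simp; tauto))
    have e : (m x - B - S x) ⬝ᵥ (x - w) = viol m x w := by
      unfold viol
      have e1 : m x - m w = (m x - B - S x) + S (x - w) := by rw [hmw, map_sub]; abel
      rw [e1, dotProduct_add, hS.self, add_zero, dotProduct_comm]
    rw [e]
    by_cases hwy : w = y
    · rw [if_pos hwy, hwy, h1]
    · rw [if_neg hwy]
      apply hz x w (hwf.mono (by intro a; simp; tauto))
      · exact pair_ne_of_right hwx hwy
      · apply pair_ne_of_left (ne_neg (hxv.1 (by simp)))
        intro e
        exact hfxy.not_neg (v := y) (by simp) (by rw [← e]; simp)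
  have hLc : L.card ≤ d := by
    have hli : LI (L.image fun w => x - w) := by
      intro c hc u hu
      obtain ⟨y, hy, rfl⟩ := Finset.mem_image.1 hu
      obtain ⟨μ, hμ⟩ := hmu y hy
      rw [Finset.sum_image (fun a _ b _ h => sub_right_injective h)] at hc
      have := congrArg (fun z => μ ⬝ᵥ z) hc
      simp only [dotProduct_sum, dotProduct_smul, dotProduct_zero, smul_eq_mul] at this
      rw [Finset.sum_eq_single y] at this
      · rw [hμ y hy, if_pos rfl, mul_one] at this; exact this
      · intro b hb hby
        rw [hμ b hb, if_neg hby, mul_zero]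
      · intro h; exact absurd hy h
    have := hli.card_le
    rwa [Finset.card_image_of_injective _ sub_right_injective] at this
  obtain ⟨F0, hF0, hs0⟩ := hxv.exists_facet
  have hxF : x ∈ F0 := hs0 (by simp)
  have hvF : v ∈ F0 := hs0 (by simp)
  have hFL : ∀ F, K.Facet F → x ∈ F → v ∈ F → F.erase x ⊆ L := by
    intro F hF hx hv a ha
    obtain ⟨h1, h2⟩ := Finset.mem_erase.1 ha
    exact (hmemL a).2 ⟨h1, hF.1.mono (Finset.insert_subset h2 (Finset.insert_subset hx (by simpa using hv)))⟩
  -- the flips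
  have hflip : ∀ z ∈ F0, z ≠ x → z ≠ v → ∃ u ∈ L, u ∉ F0 ∧ K.Facet (insert u (F0.erase z)) := by
    intro z hz hzx hzv
    obtain ⟨u, _, hu, hf⟩ := hF0.exists_flip hz
    refine ⟨u, hFL _ hf ?_ ?_ ?_, hu, hf⟩
    · exact Finset.mem_insert_of_mem (Finset.mem_erase.2 ⟨hzx.symm, hxF⟩)
    · exact Finset.mem_insert_of_mem (Finset.mem_erase.2 ⟨hzv.symm, hvF⟩)
    · exact Finset.mem_erase.2 ⟨by rintro rfl; exact hu hxF, by simp⟩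
  obtain ⟨z0, hz0, hz0n⟩ := Finset.exists_mem_notMem_of_card_lt_card
      (s := ({x, v} : Finset (Fin d → ℝ))) (t := F0)
      (lt_of_le_of_lt Finset.card_le_two (by rw [hF0.2]; omega))
  simp only [Finset.mem_insert, Finset.mem_singleton, not_or] at hz0n
  obtain ⟨s0, hs0L, hs0F, hs0f⟩ := hflip z0 hz0 hz0n.1 hz0n.2
  have hLeq : L = insert s0 (F0.erase x) := by
    symm
    apply Finset.eq_of_subset_of_card_le
    · exact Finset.insert_subset hs0L (hFL F0 hF0 hxF hvF)
    · rw [Finset.card_insert_of_notMem (fun h => hs0F (Finset.mem_of_mem_erase h)),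
        Finset.card_erase_add_one hxF, hF0.2]
      exact hLc
  have hs0u : ∀ z ∈ F0, z ≠ x → z ≠ v → K.Facet (insert s0 (F0.erase z)) := by
    intro z hz hzx hzv
    obtain ⟨u, huL, hu, hf⟩ := hflip z hz hzx hzv
    rw [hLeq] at huL
    rcases Finset.mem_insert.1 huL with rfl | h
    · exact hf
    · exact absurd (Finset.mem_of_mem_erase h) hu
  set X := insert s0 F0 with hX
  have hXc : X.card = d + 1 := by rw [hX, Finset.card_insert_of_notMem hs0F, hF0.2]
  have hs0x : s0 ≠ x := by rintro rfl; exact hs0F hxF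
  have hs0v : s0 ≠ v := by rintro rfl; exact hs0F hvF
  -- erasing anything but x, v gives a facet
  have hA : ∀ a ∈ X, a ≠ x → a ≠ v → K.Fc (X.erase a) := by
    intro a ha hax hav
    rcases Finset.mem_insert.1 ha with rfl | h
    · rw [hX, Finset.erase_insert hs0F]; exact hF0.1
    · have hne : s0 ≠ a := by rintro rfl; exact hs0F h
      rw [hX, Finset.erase_insert_of_ne hne]
      exact (hs0u a h hax hav).1
  have hxX : x ∈ X := Finset.mem_insert_of_mem hxF
  have hvX : v ∈ X := Finset.mem_insert_of_mem hvF
  have hvXx : v ∈ X.erase x := Finset.mem_erase.2 ⟨hne.symm, hvX⟩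
  have hxXv : x ∈ X.erase v := Finset.mem_erase.2 ⟨hne, hxX⟩
  have hsig : K.Fc ((X.erase x).erase v) := by
    by_contra hcon
    have hms : K.Ms ((X.erase x).erase v) := by
      refine ⟨hcon, fun a ha => ?_⟩
      obtain ⟨h1, h2⟩ := Finset.mem_erase.1 ha
      obtain ⟨h3, h4⟩ := Finset.mem_erase.1 h2
      refine (hA a h4 h3 h1).mono ?_
      exact Finset.erase_subset_erase _ ((Finset.erase_subset _ _).trans (Finset.erase_subset _ _))
    refine F3 hd hE hms ?_
    rw [Finset.card_erase_of_mem hvXx, Finset.card_erase_of_mem hxX]; omega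
  have hB : ∀ x v : Fin d → ℝ, x ∈ X → v ∈ X → x ≠ v → (∀ a ∈ X, a ≠ x → a ≠ v → K.Fc (X.erase a)) →
      K.Fc ((X.erase x).erase v) → K.Fc (X.erase x) := by
    intro x v hx hv hne hA hsig
    by_contra hcon
    refine hp (X.erase x) ⟨hcon, fun a ha => ?_⟩ (by rw [Finset.card_erase_of_mem hx]; omega)
    obtain ⟨h1, h2⟩ := Finset.mem_erase.1 ha
    by_cases hav : a = v
    · rw [hav]; exact hsig
    · exact (hA a h2 h1 hav).mono (Finset.erase_subset_erase _ (Finset.erase_subset _ _))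
  apply no_simplex hd hXc (K := K)
  intro a ha
  by_cases hax : a = x
  · rw [hax]; exact hB x v hxX hvX hne hA hsig
  · by_cases hav : a = v
    · rw [hav]
      exact hB v x hvX hxX hne.symm (fun a h h1 h2 => hA a h h2 h1)
        (by rw [Finset.erase_right_comm]; exact hsig)
    · exact hA a ha hax hav

theorem F5 (hd : 5 ≤ d) (hE : K.edges.card + 2 * d = d * K.V.card) (hp : K.Prm) :
    ∃ F, K.Facet F ∧ ∀ v ∈ K.V, v ∈ F ∨ -v ∈ F := by
  have hd3 : 3 ≤ d := by omega
  obtain ⟨F, hF, _⟩ := (fc_empty (K := K)).exists_facet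
  have h0 : ∀ F, K.Facet F → (0 : Fin d → ℝ) ∉ F := fun F hF h => zero_notMem (hF.sub h)
  refine ⟨F, hF, fun v hv => ?_⟩
  obtain ⟨G, hG, hvG⟩ := (fc_single hv).exists_facet
  refine connect (τ := ∅) 0 (fun G => ∀ p ∈ G, p ∈ F ∨ -p ∈ F) ?_ hF (by simp) (h0 F hF) hG
    (by simp) (h0 G hG) (fun p hp => Or.inl hp) v (hvG (by simp))
  intro G z u hG _ _ hz _ hu _ hGu hGF
  have hzu : u = -z := by
    by_contra hne
    have hdb : ∀ w ∈ G.erase z, ∀ a ∈ insert u G, a ≠ w → K.Fc {w, a} ∧ K.Fc {w, -a} := by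
      intro w hw a ha hne
      have h1 : K.Fc {w, a} := by
        rcases Finset.mem_insert.1 ha with rfl | h
        · exact hGu.1.mono (Finset.insert_subset (Finset.mem_insert_of_mem hw) (by simp))
        · exact hG.1.mono (Finset.insert_subset (Finset.mem_of_mem_erase hw) (by simpa using h))
      refine ⟨h1, ?_⟩
      have h2 : K.Fc {-a, w} := F4 hd hE hp (by rw [Finset.pair_comm]; exact h1) hne
      rw [Finset.pair_comm]; exact h2
    have hcz : (G.erase z).card + 1 = d := by rw [Finset.card_erase_add_one hz, hG.2]
    obtain ⟨w, hw, w', hw', hww⟩ := Finset.one_lt_card.1 (show 1 < (G.erase z).card by omega)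
    have hli := F1 hd3 hE (Z := insert u G) (by
      intro a ha hna
      have huV : u ∈ K.V := hGu.sub (by simp)
      have key : ∀ b ∈ G, u ≠ -b := by
        intro b hb e
        by_cases hbz : b = z
        · exact hne (by rw [e, hbz])
        · exact hGu.1.not_neg (v := b) (Finset.mem_insert_of_mem (Finset.mem_erase.2 ⟨hbz, hb⟩))
            (by rw [← e]; simp)
      rcases Finset.mem_insert.1 ha with h1 | h1 <;> rcases Finset.mem_insert.1 hna with h2 | h2
      · rw [h1] at h2; exact ne_neg huV h2.symm
      · exact key _ h2 (by rw [neg_neg, h1])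
      · exact key _ h1 h2.symm
      · exact hG.1.not_neg h1 h2)
      (Finset.mem_insert_of_mem (Finset.mem_of_mem_erase hw))
      (Finset.mem_insert_of_mem (Finset.mem_of_mem_erase hw')) hww (hdb w hw) (hdb w' hw')
    have := hli.card_le
    rw [Finset.card_insert_of_notMem hu, hG.2] at this
    omega
  intro p hp
  rcases Finset.mem_insert.1 hp with rfl | h
  · rw [hzu, neg_neg]; exact (hGF z hz).symm
  · exact hGF p (Finset.mem_of_mem_erase h)

end CSP

theorem aff_zero {d : ℕ} {S : Set (Fin d → ℝ)} (hS : affineSpan ℝ S = ⊤) {h : Fin d → ℝ}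
    (hh : ∀ v ∈ S, h ⬝ᵥ v = 0) : h = 0 := by
  let f : (Fin d → ℝ) →ₗ[ℝ] ℝ := dotProductBilin ℝ ℝ h
  have hf : ∀ x, f x = h ⬝ᵥ x := fun x => rfl
  have h1 : affineSpan ℝ S ≤ (LinearMap.ker f).toAffineSubspace := by
    rw [affineSpan_le]
    intro v hv
    change v ∈ LinearMap.ker f
    rw [LinearMap.mem_ker, hf]
    exact hh v hv
  have h2 : ∀ x, h ⬝ᵥ x = 0 := by
    intro x
    have : x ∈ (LinearMap.ker f).toAffineSubspace := h1 (hS ▸ AffineSubspace.mem_top ℝ _ x)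
    have : x ∈ LinearMap.ker f := this
    rwa [LinearMap.mem_ker, hf] at this
  exact dotProduct_self_eq_zero.1 (h2 h)

theorem hull_le {d : ℕ} {V : Finset (Fin d → ℝ)} {a : Fin d → ℝ} {c : ℝ}
    (h : ∀ v ∈ V, a ⬝ᵥ v ≤ c) : ∀ y ∈ polyBody V, a ⬝ᵥ y ≤ c := by
  let f : (Fin d → ℝ) →ₗ[ℝ] ℝ := dotProductBilin ℝ ℝ a
  have hf : ∀ x, f x = a ⬝ᵥ x := fun x => rfl
  have h1 : polyBody V ⊆ {y | f y ≤ c} :=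
    convexHull_min (fun v hv => h v hv) (convex_halfSpace_le f.isLinear c)
  exact fun y hy => h1 hy

theorem mem_body {d : ℕ} {V : Finset (Fin d → ℝ)} {v : Fin d → ℝ} (hv : v ∈ V) :
    v ∈ polyBody V := subset_convexHull ℝ _ (Finset.mem_coe.2 hv)

theorem SPolytope.V_nonempty {d : ℕ} (P : SPolytope d) : P.V.Nonempty := by
  rw [Finset.nonempty_iff_ne_empty]
  intro h
  have := P.span_top
  rw [h, Finset.coe_empty, AffineSubspace.span_empty] at this
  exact AffineSubspace.bot_ne_top ℝ _ _ this

theorem proper_of_pol {d : ℕ} (P : SPolytope d) (hcs : IsCS P) {a : Fin d → ℝ}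
    (ha : ∀ v ∈ P.V, a ⬝ᵥ v ≤ 1) : IsProperFace P.V {y ∈ polyBody P.V | a ⬝ᵥ y = 1} := by
  refine ⟨⟨dotProductBilin ℝ ℝ a, 1, hull_le ha, rfl⟩, fun h => ?_⟩
  obtain ⟨v, hv⟩ := P.V_nonempty
  have h1 : v ∈ {y ∈ polyBody P.V | a ⬝ᵥ y = 1} := h.symm.subset (mem_body hv)
  have h2 : -v ∈ {y ∈ polyBody P.V | a ⬝ᵥ y = 1} := h.symm.subset (mem_body (hcs v hv))
  have e1 := h1.2
  have e2 := h2.2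
  rw [dotProduct_neg] at e2
  linarith

theorem li_of_pol {d : ℕ} (P : SPolytope d) (hcs : IsCS P) {a : Fin d → ℝ}
    (ha : ∀ v ∈ P.V, a ⬝ᵥ v ≤ 1) : LI (P.V.filter fun v => a ⬝ᵥ v = 1) := by
  have h := (P.simplicial _ (proper_of_pol P hcs ha)).1
  set T := P.V.filter fun v => a ⬝ᵥ v = 1 with hT
  have hm : ∀ v ∈ T, v ∈ (P.V : Set (Fin d → ℝ)) ∩ {y ∈ polyBody P.V | a ⬝ᵥ y = 1} := by
    intro v hv
    obtain ⟨h1, h2⟩ := Finset.mem_filter.1 hv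
    exact ⟨h1, mem_body h1, h2⟩
  have h' := h.comp_embedding (⟨fun x : {x // x ∈ T} => ⟨x.1, hm x.1 x.2⟩, by
    intro x y hxy
    exact Subtype.ext (Subtype.mk.inj hxy)⟩ :
    {x // x ∈ T} ↪ {y : Fin d → ℝ // y ∈ (P.V : Set (Fin d → ℝ)) ∩ {y ∈ polyBody P.V | a ⬝ᵥ y = 1}})
  rw [affineIndependent_iff] at h'
  intro c hc v hv
  have hs : ∑ v ∈ T, c v = 0 := by
    have e : a ⬝ᵥ (∑ v ∈ T, c v • v) = 0 := by rw [hc, dotProduct_zero]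
    rw [dotProduct_sum] at e
    rw [← e]
    refine Finset.sum_congr rfl fun v hv => ?_
    rw [dotProduct_smul, (Finset.mem_filter.1 hv).2]; simp
  refine h' Finset.univ (fun x => c x.1) ?_ ?_ ⟨v, hv⟩ (Finset.mem_univ _)
  · rw [← hs]; exact Finset.sum_coe_sort T c
  · rw [← hc]; exact Finset.sum_coe_sort T (fun v => c v • v)

theorem vert_pol {d : ℕ} (hd : 0 < d) (P : SPolytope d) (hcs : IsCS P) {v : Fin d → ℝ}
    (hv : v ∈ P.V) : ∃ a : Fin d → ℝ, (∀ v ∈ P.V, a ⬝ᵥ v ≤ 1) ∧ a ⬝ᵥ v = 1 := by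
  obtain ⟨f, u, h1, h2⟩ := geometric_hahn_banach_closed_point (convex_convexHull ℝ _)
    ((P.V.erase v).finite_toSet.isClosed_convexHull ℝ) (P.extreme v hv)
  obtain ⟨a, ha⟩ := dot_of_lin f.toLinearMap
  have ha' : ∀ x, a ⬝ᵥ x = f x := ha
  have hlt : ∀ w ∈ P.V, w ≠ v → a ⬝ᵥ w < a ⬝ᵥ v := by
    intro w hw hne
    rw [ha', ha']
    exact (h1 w (subset_convexHull ℝ _ (by simp [hw, hne]))).trans h2
  have hv0 : v ≠ 0 := by
    rintro rfl
    have hz : ∀ w ∈ (P.V : Set (Fin d → ℝ)), (fun _ : Fin d => (1 : ℝ)) ⬝ᵥ w = 0 := by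
      intro w hw
      by_cases h0 : w = 0
      · rw [h0, dotProduct_zero]
      · have e1 := hlt w hw h0
        have e2 := hlt (-w) (hcs w hw) (neg_ne_zero.2 h0)
        rw [dotProduct_neg] at e2
        rw [dotProduct_zero] at e1 e2
        linarith
    have := congrFun (aff_zero P.span_top hz) ⟨0, hd⟩
    simp at this
  have hpos : 0 < a ⬝ᵥ v := by
    have := hlt (-v) (hcs v hv) (by
      intro h
      exact hv0 (self_eq_neg.1 h.symm))
    rw [dotProduct_neg] at this
    linarith
  refine ⟨(a ⬝ᵥ v)⁻¹ • a, ?_, ?_⟩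
  · intro w hw
    rw [smul_dotProduct, smul_eq_mul, inv_mul_le_one₀ hpos]
    by_cases h : w = v
    · rw [h]
    · exact (hlt w hw h).le
  · rw [smul_dotProduct, smul_eq_mul, inv_mul_cancel₀ hpos.ne']

def toCSP {d : ℕ} (hd : 0 < d) (P : SPolytope d) (hcs : IsCS P) : CSP d where
  V := P.V
  neg := hcs
  span := fun _ hh => aff_zero P.span_top fun v hv => hh v hv
  simp := fun _ ha => li_of_pol P hcs ha
  vert := fun _ hv => vert_pol hd P hcs hv

theorem bface_iff {d : ℕ} (hd : 0 < d) (P : SPolytope d) (hcs : IsCS P)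
    (s : Finset (Fin d → ℝ)) : BFace P s ↔ (toCSP hd P hcs).Fc s := by
  constructor
  · rintro ⟨hs, F, ⟨⟨f, c, hle, rfl⟩, hne⟩, hsF⟩
    obtain ⟨a, ha⟩ := dot_of_lin f
    have hav : ∀ v ∈ P.V, a ⬝ᵥ v ≤ c := fun v hv => by rw [ha]; exact hle v (mem_body hv)
    have hc0 : 0 ≤ c := by
      obtain ⟨v, hv⟩ := P.V_nonempty
      have e1 := hav v hv
      have e2 := hav (-v) (hcs v hv)
      rw [dotProduct_neg] at e2
      linarith
    have hc : 0 < c := by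
      rcases hc0.lt_or_eq with h | h
      · exact h
      · exfalso
        subst h
        have a0 : a = 0 := aff_zero P.span_top (by
          intro v hv
          have e1 := hav v hv
          have e2 := hav (-v) (hcs v hv)
          rw [dotProduct_neg] at e2
          linarith)
        apply hne
        ext y
        simp [← ha, a0]
    refine ⟨hs, c⁻¹ • a, ?_, ?_⟩
    · intro v hv
      rw [smul_dotProduct, smul_eq_mul, inv_mul_le_one₀ hc]
      exact hav v hv
    · intro v hv
      have := (hsF hv).2
      rw [smul_dotProduct, smul_eq_mul, ha, this, inv_mul_cancel₀ hc.ne']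
  · rintro ⟨hs, a, ha, h1⟩
    exact ⟨hs, _, proper_of_pol P hcs ha, fun v hv => ⟨mem_body (hs hv), h1 v hv⟩⟩

theorem edges_eq {d : ℕ} (hd : 0 < d) (P : SPolytope d) (hcs : IsCS P) :
    edgeFinset P = (toCSP hd P hcs).edges := by
  ext e
  rw [CSP.mem_edges, edgeFinset, Finset.mem_filter, Finset.mem_powerset, bface_iff hd P hcs]
  exact ⟨fun h => h.2, fun h => ⟨h.2.1, h⟩⟩

theorem prm_of {d : ℕ} (hd : 2 ≤ d) (P : SPolytope d) (hcs : IsCS P) (hp : IsPrimePoly P) :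
    (toCSP (by omega) P hcs).Prm := by
  intro σ hσ hc
  apply hp
  refine ⟨σ, ⟨?_, ?_, ?_⟩, hc⟩
  · intro x hx
    obtain ⟨y, hy, hne⟩ := Finset.exists_mem_ne (show 1 < σ.card by omega) x
    exact (hσ.2 y hy).1 (Finset.mem_erase.2 ⟨hne.symm, hx⟩)
  · rw [bface_iff (by omega) P hcs]; exact hσ.1
  · intro τ hτ
    rw [bface_iff (by omega) P hcs]
    obtain ⟨x, hx, hxt⟩ := Finset.exists_of_ssubset hτ
    exact (hσ.2 x hx).mono fun y hy =>
      Finset.mem_erase.2 ⟨fun h => hxt (h ▸ hy), hτ.1 hy⟩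

theorem count_of {d : ℕ} (hd : 0 < d) (P : SPolytope d) (hcs : IsCS P)
    (hg2 : g2 P = (d.choose 2 : ℤ) - (d : ℤ)) :
    (toCSP hd P hcs).edges.card + 2 * d = d * (toCSP hd P hcs).V.card := by
  have hch : (d + 1).choose 2 = d + d.choose 2 := by
    rw [Nat.choose_succ_succ' d 1, Nat.choose_one_right]
  unfold g2 f1 f0 at hg2
  rw [edges_eq hd P hcs, hch] at hg2
  have hV : (toCSP hd P hcs).V = P.V := rfl
  rw [hV]
  zify
  push_cast at hg2
  linarith

/-- Let `d ≥ 5` and let `P` be a prime cs simplicial `d`-polytope with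
`g₂(P) = C(d,2) - d`, in general position. If `G'` is a subgraph of the graph of `∂P`,
closed under `v ↦ -v`, such that `(G', p)` is infinitesimally rigid and affinely spans
`ℝ^d`, then `G'` equals the graph of `∂P`. -/
theorem stmt19 {d : ℕ} (hd : 5 ≤ d) (P : SPolytope d) (hp : IsPrimePoly P) (hcs : IsCS P)
    (hg2 : g2 P = (d.choose 2 : ℤ) - (d : ℤ)) (hgen : GenPos P)
    (G' : FinGraph (Fin d → ℝ))
    (hsubV : G'.verts ⊆ P.V) (hsubE : G'.edges ⊆ edgeFinset P)
    (hclV : ∀ v ∈ G'.verts, -v ∈ G'.verts)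
    (hclE : ∀ e ∈ G'.edges, e.image (fun x => -x) ∈ G'.edges)
    (hrig : IsInfRigid d G' (fun x => x))
    (hspan : affineSpan ℝ ((G'.verts : Set (Fin d → ℝ))) = ⊤) :
    G'.verts = P.V ∧ G'.edges = edgeFinset P := by
  have hd0 : 0 < d := by omega
  have hE := count_of hd0 P hcs hg2
  have hprm := prm_of (by omega) P hcs hp
  have hee := edges_eq hd0 P hcs
  have hKV : (toCSP hd0 P hcs).V = P.V := rfl
  generalize hK : toCSP hd0 P hcs = K at hE hprm hee hKV
  obtain ⟨F, hF, hFV⟩ := CSP.F5 hd hE hprm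
  have hFG : ∀ z ∈ F, z ∈ G'.verts := by
    intro z hz
    by_contra hn
    have hn' : -z ∉ G'.verts := fun h => hn (by simpa using hclV _ h)
    have h0 : ev F z = 0 := aff_zero hspan (by
      intro v hv
      have hv' : v ∈ G'.verts := hv
      have hvz : v ≠ z := fun h => hn (h ▸ hv')
      have hvz' : -v ≠ z := fun h => hn' (by rw [← h, neg_neg]; exact hv')
      rcases hFV v (hKV ▸ hsubV hv') with h | h
      · exact hF.li.ev_ne h hvz
      · have := hF.li.ev_ne h hvz'
        rw [dotProduct_neg] at this
        linarith)
    have := hF.li.ev_self hz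
    rw [h0, zero_dotProduct] at this
    exact zero_ne_one this
  have hV : G'.verts = P.V := by
    apply Finset.Subset.antisymm hsubV
    intro v hv
    rcases hFV v (hKV ▸ hv) with h | h
    · exact hFG v h
    · simpa using hclV _ (hFG _ h)
  refine ⟨hV, Finset.Subset.antisymm hsubE fun e he => ?_⟩
  by_contra hn
  rw [hee, CSP.mem_edges] at he
  obtain ⟨x, y, hxy, rfl⟩ := Finset.card_eq_two.1 he.1
  obtain ⟨m, _, h1, hz⟩ := CSP.exists_single (by omega) hE hxy he.2
  have hn' : ({-x, -y} : Finset (Fin d → ℝ)) ∉ G'.edges := by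
    intro h
    apply hn
    simpa [Finset.image_insert] using hclE _ h
  have hmot : IsMotion G' (fun x => x) m := by
    intro e heG u hu v hv
    change viol m u v = 0
    by_cases huv : u = v
    · rw [huv]; simp [viol]
    · have hek := hsubE heG
      rw [hee, CSP.mem_edges] at hek
      have hs : ({u, v} : Finset (Fin d → ℝ)) = e := by
        apply Finset.eq_of_subset_of_card_le
        · intro w hw
          rcases Finset.mem_insert.1 hw with rfl | hw
          · exact hu
          · rw [Finset.mem_singleton.1 hw]; exact hv
        · rw [hek.1, Finset.card_pair huv]
      refine hz u v (hs ▸ hek.2) ?_ ?_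
      · rw [hs]; exact fun h => hn (h ▸ heG)
      · rw [hs]; exact fun h => hn' (h ▸ heG)
  obtain ⟨A, b, hA, hm⟩ := hrig m hmot
  have hx := hm x (hV ▸ (hKV ▸ he.2.1 (by simp)))
  have hy := hm y (hV ▸ (hKV ▸ he.2.1 (by simp)))
  have h0 : viol m x y = 0 := by
    unfold viol
    have e1 : m x - m y = A.mulVec (x - y) := by
      rw [hx, hy, Matrix.mulVec_sub]; abel
    rw [e1]
    have e2 : (x - y) ⬝ᵥ A.mulVec (x - y) = - ((x - y) ⬝ᵥ A.mulVec (x - y)) := by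
      conv_lhs => rw [Matrix.dotProduct_mulVec, ← Matrix.mulVec_transpose, hA, Matrix.neg_mulVec,
        neg_dotProduct, dotProduct_comm]
    linarith
  rw [h0] at h1
  exact zero_ne_one h1
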